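/- Let r ≥ 130 be an integer and let a ∈ (0, (r-129)/256). Then there exist l₀ = l₀(r,a) ∈ ℕ and ξ = ξ(r,a) > 0 such that for every integer l ≥ l₀, with 𝒱_l := {v ∈ V_r : |v|_∞ = rl}, any linearly edge-reinforced random walk measure P on G_r with constant initial weights a started at 0 satisfies P[τ_{𝒱_l} < τ_0] ≤ 8·l^{−ξ}. -/

import Mathlib

open MeasureTheory
open scoped ENNReal Classical

namespace ERRWZ2

/-- The vertex set `V_r` of the diluted lattice `G_r`. -/
def Vr (r : ℕ) : Set (ℤ × ℤ) := {x | (r : ℤ) ∣ x.1 ∨ (r : ℤ) ∣ x.2}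

/-- The set `L_r = rℤ²` of four-way crossings. -/
def Lr (r : ℕ) : Set (ℤ × ℤ) := {x | (r : ℤ) ∣ x.1 ∧ (r : ℤ) ∣ x.2}

/-- Maximum norm on `ℤ²`. -/
def linf (v : ℤ × ℤ) : ℤ := max |v.1| |v.2|

/-- Adjacency in `G_r`: both endpoints in `V_r` and Euclidean distance one. -/
def AdjG (r : ℕ) (u v : ℤ × ℤ) : Prop :=
  u ∈ Vr r ∧ v ∈ Vr r ∧ (u.1 - v.1) ^ 2 + (u.2 - v.2) ^ 2 = 1

/-- Weight at time `t` of the undirected edge `{x,y}` for the trajectory `u`. -/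
noncomputable def wt (a : ℝ) (u : ℕ → ℤ × ℤ) (t : ℕ) (x y : ℤ × ℤ) : ℝ :=
  a + (((Finset.range t).filter fun s =>
    (u s = x ∧ u (s + 1) = y) ∨ (u s = y ∧ u (s + 1) = x)).card : ℝ)

/-- Total weight at time `t` of all edges of `G_r` incident to the current position `u t`. -/
noncomputable def totWt (r : ℕ) (a : ℝ) (u : ℕ → ℤ × ℤ) (t : ℕ) : ℝ :=
  ∑ d ∈ ({(1, 0), (-1, 0), (0, 1), (0, -1)} : Finset (ℤ × ℤ)),
    if AdjG r (u t) (u t + d) then wt a u t (u t) (u t + d) else 0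

/-- Hitting time `τ_A = inf{t ≥ 1 : X_t ∈ A}` (with value `⊤` if the set is never hit). -/
noncomputable def tau (A : Set (ℤ × ℤ)) (X : ℕ → ℤ × ℤ) : ℕ∞ :=
  sInf ((fun t : ℕ => (t : ℕ∞)) '' {t : ℕ | 1 ≤ t ∧ X t ∈ A})

/-- `P` is a linearly edge-reinforced random walk on `G_r` with constant initial
weights `a`, started at `(0,0)`. -/
def IsERRW (r : ℕ) (a : ℝ) (P : Measure (ℕ → ℤ × ℤ)) : Prop :=
  IsProbabilityMeasure P ∧
    ∀ (n : ℕ) (u : ℕ → ℤ × ℤ),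
      P {X | ∀ t ≤ n, X t = u t} =
        if u 0 = (0, 0) ∧ ∀ t < n, AdjG r (u t) (u (t + 1)) then
          ENNReal.ofReal (∏ t ∈ Finset.range n, wt a u t (u t) (u (t + 1)) / totWt r a u t)
        else 0

end ERRWZ2

namespace ERRWZ2

open Set Real

/-- The density of the inverse-Gaussian type law of a single Schur complement. -/
noncomputable def igDensity (θ η y : ℝ) : ℝ :=
  if 0 < y then (√(2 * π))⁻¹ * (θ * (√y)⁻¹) * exp (-(θ * √y - η / √y) ^ 2 / 2) else 0

lemma igDensity_nonneg {θ η y : ℝ} (hθ : 0 ≤ θ) : 0 ≤ igDensity θ η y := by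
  unfold igDensity
  split_ifs <;> positivity

lemma measurable_igDensity : Measurable fun p : ℝ × ℝ × ℝ => igDensity p.1 p.2.1 p.2.2 := by
  unfold igDensity
  refine Measurable.ite ?_ (by fun_prop) (by fun_prop)
  exact measurableSet_lt measurable_const (by fun_prop)

/-- The standard Gaussian density. -/
noncomputable def stdGauss (s : ℝ) : ℝ := (√(2 * π))⁻¹ * exp (-s ^ 2 / 2)

lemma stdGauss_neg (s : ℝ) : stdGauss (-s) = stdGauss s := by simp [stdGauss]

lemma lintegral_stdGauss : ∫⁻ s, ENNReal.ofReal (stdGauss s) = 1 := by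
  have h := ProbabilityTheory.lintegral_gaussianPDFReal_eq_one 0 (v := 1) one_ne_zero
  rw [← h]
  congr 1
  ext s
  simp [stdGauss, ProbabilityTheory.gaussianPDFReal]

lemma lintegral_stdGauss_Ioi : ∫⁻ s in Ioi 0, ENNReal.ofReal (stdGauss s) = 2⁻¹ := by
  have himg : ∫⁻ s in Iio 0, ENNReal.ofReal (stdGauss s)
      = ∫⁻ s in Ioi 0, ENNReal.ofReal (stdGauss s) := by
    have h := lintegral_image_eq_lintegral_abs_deriv_mul (s := Ioi (0 : ℝ)) (f := fun x => -x)
      (f' := fun _ => -1) measurableSet_Ioi (fun x _ => (hasDerivAt_neg x).hasDerivWithinAt)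
      (fun x _ y _ h => neg_injective h) (fun s => ENNReal.ofReal (stdGauss s))
    rw [Set.image_neg_eq_neg, Set.neg_Ioi, neg_zero] at h
    rw [h]
    simp [stdGauss_neg]
  have h2 : (∫⁻ s in Iio 0, ENNReal.ofReal (stdGauss s))
      + ∫⁻ s in Ioi 0, ENNReal.ofReal (stdGauss s) = 1 := by
    have := lintegral_add_compl (μ := volume) (fun s => ENNReal.ofReal (stdGauss s))
      (measurableSet_Iio (a := (0 : ℝ)))
    rw [compl_Iio, ← restrict_Ioi_eq_restrict_Ici, lintegral_stdGauss] at this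
    exact this
  rw [himg, ← two_mul] at h2
  rw [← mul_one (2⁻¹ : ℝ≥0∞), ← h2, ← mul_assoc, ENNReal.inv_mul_cancel two_ne_zero (by simp),
    one_mul]

lemma hasDerivAt_schlomilch (θ η : ℝ) {y : ℝ} (hy : 0 < y) :
    HasDerivAt (fun y => θ * √y - η / √y) (θ / (2 * √y) + η / (2 * y * √y)) y := by
  have hs : 0 < √y := sqrt_pos.2 hy
  have h1 := hasDerivAt_sqrt hy.ne'
  have h2 := (h1.const_mul θ).sub ((hasDerivAt_const y η).div h1 hs.ne')
  refine h2.congr_deriv ?_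
  have : √y ^ 2 = y := sq_sqrt hy.le
  rw [this]
  field_simp
  ring

lemma strictMonoOn_schlomilch {θ η : ℝ} (hθ : 0 < θ) (hη : 0 ≤ η) :
    StrictMonoOn (fun y => θ * √y - η / √y) (Ioi 0) := by
  intro x hx y hy hxy
  have hx' : 0 < √x := sqrt_pos.2 hx
  have h1 : √x < √y := sqrt_lt_sqrt (le_of_lt hx) hxy
  have h2 : η / √y ≤ η / √x := by gcongr
  have h3 : θ * √x < θ * √y := by gcongr
  simp only
  linarith

lemma image_schlomilch {θ η : ℝ} (hθ : 0 < θ) (hη : 0 < η) :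
    (fun y => θ * √y - η / √y) '' Ioi 0 = univ := by
  refine eq_univ_of_forall fun s => ?_
  have hd : |s| < √(s ^ 2 + 4 * θ * η) := by
    rw [← sqrt_sq_eq_abs]
    exact sqrt_lt_sqrt (sq_nonneg _) (by nlinarith [mul_pos hθ hη])
  have hd2 : √(s ^ 2 + 4 * θ * η) ^ 2 = s ^ 2 + 4 * θ * η := sq_sqrt (by positivity)
  set d := √(s ^ 2 + 4 * θ * η)
  have hx : 0 < s + d := by linarith [neg_abs_le s]
  have hx' : 0 < (s + d) / (2 * θ) := by positivity
  refine ⟨((s + d) / (2 * θ)) ^ 2, by simpa using by positivity, ?_⟩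
  simp only
  rw [sqrt_sq hx'.le]
  field_simp
  nlinarith

lemma image_schlomilch_zero {θ : ℝ} (hθ : 0 < θ) :
    (fun y => θ * √y - 0 / √y) '' Ioi 0 = Ioi 0 := by
  ext s
  constructor
  · rintro ⟨y, hy, rfl⟩
    have : 0 < √y := sqrt_pos.2 hy
    simpa using by positivity
  · intro hs
    have hs' : 0 < s := hs
    refine ⟨(s / θ) ^ 2, by simpa using by positivity, ?_⟩
    simp only
    rw [sqrt_sq (by positivity)]
    field_simp
    simp

lemma lintegral_schlomilch {θ η : ℝ} (hθ : 0 < θ) (hη : 0 ≤ η) :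
    (∫⁻ y in Ioi 0, ENNReal.ofReal (igDensity θ η y))
      + ∫⁻ y in Ioi 0, ENNReal.ofReal (igDensity θ η y * (η / (θ * y)))
      = 2 * ∫⁻ s in (fun y => θ * √y - η / √y) '' Ioi 0, ENNReal.ofReal (stdGauss s) := by
  rw [lintegral_image_eq_lintegral_abs_deriv_mul measurableSet_Ioi
    (fun y hy => (hasDerivAt_schlomilch θ η hy).hasDerivWithinAt)
    (strictMonoOn_schlomilch hθ hη).injOn, ← lintegral_const_mul' _ _ (by simp),
    ← lintegral_add_left]
  · refine setLIntegral_congr_fun measurableSet_Ioi fun y (hy : 0 < y) => ?_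
    have hs : 0 < √y := sqrt_pos.2 hy
    rw [← ENNReal.ofReal_add (igDensity_nonneg hθ.le)
      (mul_nonneg (igDensity_nonneg hθ.le) (by positivity)),
      ← ENNReal.ofReal_mul (by positivity), ← ENNReal.ofReal_ofNat 2,
      ← ENNReal.ofReal_mul (by positivity), abs_of_nonneg (by positivity)]
    congr 1
    rw [igDensity, if_pos hy, stdGauss]
    field_simp
  · exact (measurable_igDensity.comp
      (by fun_prop : Measurable fun y : ℝ => (θ, η, y))).ennreal_ofReal

lemma lintegral_ig_inversion {θ η : ℝ} (hθ : 0 < θ) (hη : 0 < η) :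
    ∫⁻ y in Ioi 0, ENNReal.ofReal (igDensity θ η y)
      = ∫⁻ y in Ioi 0, ENNReal.ofReal (igDensity θ η y * (η / (θ * y))) := by
  have himg : (fun y : ℝ => (η / θ) ^ 2 / y) '' Ioi 0 = Ioi 0 := by
    ext s
    constructor
    · rintro ⟨y, hy, rfl⟩
      have hy' : 0 < y := hy
      simpa using by positivity
    · intro hs
      have hs' : 0 < s := hs
      exact ⟨(η / θ) ^ 2 / s, by simpa using by positivity, by field_simp⟩
  conv_lhs => rw [← himg]
  rw [lintegral_image_eq_lintegral_abs_deriv_mul (f' := fun y => -((η / θ) ^ 2 / y ^ 2))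
    measurableSet_Ioi]
  · refine setLIntegral_congr_fun measurableSet_Ioi fun y (hy : 0 < y) => ?_
    have hs : 0 < √y := sqrt_pos.2 hy
    have hys : y = √y ^ 2 := (sq_sqrt hy.le).symm
    rw [← ENNReal.ofReal_mul (by positivity)]
    congr 1
    have h1 : √((η / θ) ^ 2 / y) = (η / θ) / √y := by
      rw [sqrt_div (by positivity), sqrt_sq (by positivity)]
    rw [igDensity, igDensity, if_pos hy, if_pos (by positivity), h1, abs_neg,
      abs_of_pos (by positivity)]
    have h2 : -(θ * (η / θ / √y) - η / (η / θ / √y)) ^ 2 / 2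
        = -(θ * √y - η / √y) ^ 2 / 2 := by
      field_simp
      ring
    rw [h2]
    set e := exp (-(θ * √y - η / √y) ^ 2 / 2)
    rw [hys, sqrt_sq hs.le]
    field_simp
  · intro y hy
    have hy' : y ≠ 0 := ne_of_gt hy
    have := (hasDerivAt_const y ((η / θ) ^ 2)).div (hasDerivAt_id y) hy'
    refine (this.congr_deriv ?_).hasDerivWithinAt
    simp [neg_div]
  · intro x hx y hy h
    have hx' : 0 < x := hx
    have hy' : 0 < y := hy
    have hc : 0 < (η / θ) ^ 2 := by positivity
    simp only at h
    rw [div_eq_div_iff hx'.ne' hy'.ne'] at h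
    exact (mul_left_cancel₀ hc.ne' h).symm

lemma lintegral_ig_eq_setLIntegral (θ η : ℝ) (f : ℝ → ℝ) :
    ∫⁻ y, ENNReal.ofReal (igDensity θ η y * f y)
      = ∫⁻ y in Ioi 0, ENNReal.ofReal (igDensity θ η y * f y) := by
  rw [← lintegral_indicator measurableSet_Ioi]
  congr 1
  ext y
  by_cases hy : 0 < y
  · rw [indicator_of_mem (by exact hy)]
  · rw [indicator_of_notMem (by exact hy), igDensity, if_neg hy]
    simp

lemma lintegral_igDensity {θ η : ℝ} (hθ : 0 < θ) (hη : 0 ≤ η) :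
    ∫⁻ y, ENNReal.ofReal (igDensity θ η y) = 1 := by
  have h0 := lintegral_ig_eq_setLIntegral θ η (fun _ => 1)
  simp only [mul_one] at h0
  rw [h0]
  have h := lintegral_schlomilch hθ hη
  rcases hη.eq_or_lt with rfl | hη
  · rw [image_schlomilch_zero hθ, lintegral_stdGauss_Ioi, ENNReal.mul_inv_cancel two_ne_zero
      (by simp)] at h
    simpa using h
  · rw [image_schlomilch hθ hη, Measure.restrict_univ, lintegral_stdGauss,
      ← lintegral_ig_inversion hθ hη, ← two_mul] at h
    exact (ENNReal.mul_right_inj two_ne_zero (by simp)).1 h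

lemma lintegral_igDensity_mul {θ η : ℝ} (hθ : 0 < θ) (hη : 0 < η) :
    ∫⁻ y, ENNReal.ofReal (igDensity θ η y * (η / y)) = ENNReal.ofReal θ := by
  have h := lintegral_igDensity hθ hη.le
  have h0 := lintegral_ig_eq_setLIntegral θ η (fun _ => 1)
  simp only [mul_one] at h0
  rw [h0, lintegral_ig_inversion hθ hη, ← lintegral_ig_eq_setLIntegral θ η (fun y => η / (θ * y))]
    at h
  rw [← mul_one (ENNReal.ofReal θ), ← h, ← lintegral_const_mul' _ _ (by simp)]
  congr 1
  ext y
  rw [← ENNReal.ofReal_mul hθ.le]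
  congr 1
  field_simp

/-- The half moment of the reciprocal of the Schur complement. -/
noncomputable def igHalf (η : ℝ) : ℝ≥0∞ :=
  ∫⁻ y, ENNReal.ofReal (igDensity 1 η y * (√y)⁻¹)

lemma igHalf_eq {η : ℝ} (hη : 0 < η) :
    igHalf η = ∫⁻ s in Ioi 0,
      ENNReal.ofReal ((√(2 * π))⁻¹ * s⁻¹ * exp (-(η * (√s - 1 / √s) ^ 2) / 2)) := by
  rw [igHalf, lintegral_ig_eq_setLIntegral 1 η (fun y => (√y)⁻¹)]
  have himg : (fun s : ℝ => η * s) '' Ioi 0 = Ioi 0 := by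
    rw [image_mul_left_Ioi hη, mul_zero]
  conv_lhs => rw [← himg]
  rw [lintegral_image_eq_lintegral_abs_deriv_mul (f' := fun _ => η) measurableSet_Ioi
    (fun y _ => by simpa using ((hasDerivAt_id y).const_mul η).hasDerivWithinAt)
    (fun x _ y _ h => mul_left_cancel₀ hη.ne' h)]
  refine setLIntegral_congr_fun measurableSet_Ioi fun y (hy : 0 < y) => ?_
  have hs : 0 < √y := sqrt_pos.2 hy
  have hs' : 0 < √η := sqrt_pos.2 hη
  rw [← ENNReal.ofReal_mul (abs_nonneg _), abs_of_pos hη]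
  congr 1
  rw [igDensity, if_pos (by positivity), sqrt_mul hη.le]
  have hη2 : η = √η ^ 2 := (sq_sqrt hη.le).symm
  have hy2 : y = √y ^ 2 := (sq_sqrt hy.le).symm
  have h2 : -(1 * (√η * √y) - η / (√η * √y)) ^ 2 / 2 = -(η * (√y - 1 / √y) ^ 2) / 2 := by
    generalize √η = c at *
    generalize √y = z at *
    subst hη2
    field_simp
  rw [h2]
  set e := exp (-(η * (√y - 1 / √y) ^ 2) / 2)
  clear_value e
  generalize √η = c at *
  generalize √y = z at *
  subst hη2 hy2
  field_simp

lemma igHalf_anti {η η' : ℝ} (hη : 0 < η) (h : η ≤ η') : igHalf η' ≤ igHalf η := by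
  rw [igHalf_eq hη, igHalf_eq (hη.trans_le h)]
  refine setLIntegral_mono' measurableSet_Ioi fun s (hs : 0 < s) => ?_
  gcongr

lemma measurable_igHalf : Measurable igHalf := by
  unfold igHalf
  refine Measurable.lintegral_prod_right' (f := fun p : ℝ × ℝ =>
    ENNReal.ofReal (igDensity 1 p.1 p.2 * (√p.2)⁻¹)) ?_
  refine Measurable.ennreal_ofReal (Measurable.mul ?_ (by fun_prop))
  exact measurable_igDensity.comp (by fun_prop : Measurable fun p : ℝ × ℝ => ((1 : ℝ), p.1, p.2))

end ERRWZ2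

namespace ERRWZ2

open Matrix

variable {V : Type*} [Fintype V] [DecidableEq V]

/-- Symmetric, loop-free, nonnegative edge weights. -/
structure IsWeight (W : V → V → ℝ) : Prop where
  symm : ∀ i j, W i j = W j i
  diag : ∀ i, W i i = 0
  nonneg : ∀ i j, 0 ≤ W i j

/-- The operator `b - W` on `S`, extended by the identity outside `S`. -/
def hmat (W : V → V → ℝ) (b : V → ℝ) (S : Finset V) : Matrix V V ℝ :=
  Matrix.of fun i j =>
    if i ∈ S ∧ j ∈ S then (if i = j then b i else 0) - W i j else if i = j then 1 else 0

/-- Restriction of a vector to `S`, extended by zero. -/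
def restr (S : Finset V) (f : V → ℝ) : V → ℝ := fun j => if j ∈ S then f j else 0

/-- The solution `p` of `H_S p = W i` on `S`. -/
noncomputable def peelDir (W : V → V → ℝ) (b : V → ℝ) (S : Finset V) (i : V) : V → ℝ :=
  (hmat W b S)⁻¹ *ᵥ restr S (W i)

/-- The Schur complement of `S` in `insert i S`. -/
noncomputable def schur (W : V → V → ℝ) (b : V → ℝ) (S : Finset V) (i : V) : ℝ :=
  b i - restr S (W i) ⬝ᵥ peelDir W b S i

lemma restr_apply_of_notMem {S : Finset V} {i : V} (hi : i ∉ S) (f : V → ℝ) :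
    restr S f i = 0 := by simp [restr, hi]

lemma restr_apply_of_mem {S : Finset V} {i : V} (hi : i ∈ S) (f : V → ℝ) :
    restr S f i = f i := by simp [restr, hi]

lemma restr_insert {S : Finset V} {i : V} (hi : i ∉ S) (f : V → ℝ) :
    restr (insert i S) f = restr S f + f i • Pi.single i 1 := by
  ext j
  by_cases hj : j = i
  · subst hj
    simp [restr, hi]
  · simp [restr, hj]

lemma restr_add (S : Finset V) (f g : V → ℝ) : restr S (f + g) = restr S f + restr S g := by
  ext j
  by_cases hj : j ∈ S <;> simp [restr, hj]

lemma restr_smul (S : Finset V) (c : ℝ) (f : V → ℝ) : restr S (c • f) = c • restr S f := by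
  ext j
  by_cases hj : j ∈ S <;> simp [restr, hj]

lemma restr_nonneg {S : Finset V} {f : V → ℝ} (hf : ∀ j, 0 ≤ f j) (j : V) : 0 ≤ restr S f j := by
  unfold restr
  split_ifs
  exacts [hf j, le_rfl]

section

variable {W : V → V → ℝ} {b : V → ℝ} {S : Finset V} {i : V}

lemma hmat_mulVec_of_notMem {i : V} (hi : i ∉ S) (x : V → ℝ) : (hmat W b S *ᵥ x) i = x i := by
  simp [hmat, mulVec, dotProduct, hi]

lemma hmat_insert (hW : IsWeight W) (hi : i ∉ S) :
    hmat W b (insert i S) = hmat W b S + (b i - 1) • vecMulVec (Pi.single i 1) (Pi.single i 1)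
      - vecMulVec (Pi.single i 1) (restr S (W i)) - vecMulVec (restr S (W i)) (Pi.single i 1) := by
  ext j k
  by_cases hj : j = i
  · subst hj
    by_cases hk : k = j
    · subst hk
      simp [hmat, restr, hi, vecMulVec_apply, hW.diag]
    · simp [hmat, restr, hi, vecMulVec_apply, hk, Ne.symm hk]
      split_ifs <;> simp
  · by_cases hk : k = i
    · subst hk
      simp [hmat, restr, hi, vecMulVec_apply, hj, hW.symm j k]
      split_ifs <;> simp
    · simp [hmat, restr, vecMulVec_apply, hk, hj]

lemma hmat_transpose (hW : IsWeight W) : (hmat W b S)ᵀ = hmat W b S := by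
  ext j k
  simp only [hmat, transpose_apply, of_apply, hW.symm k j, and_comm (a := k ∈ S), eq_comm (a := k)]
  by_cases h : j = k
  · subst h
    simp
  · simp [h]

lemma hmat_dotProduct_comm (hW : IsWeight W) (x y : V → ℝ) :
    x ⬝ᵥ hmat W b S *ᵥ y = y ⬝ᵥ hmat W b S *ᵥ x := by
  rw [dotProduct_mulVec, ← mulVec_transpose, hmat_transpose hW, dotProduct_comm]

lemma hmat_isHermitian (hW : IsWeight W) : (hmat W b S).IsHermitian := by
  rw [IsHermitian, conjTranspose_eq_transpose_of_trivial, hmat_transpose hW]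

lemma hmat_inv_transpose (hW : IsWeight W) : ((hmat W b S)⁻¹)ᵀ = (hmat W b S)⁻¹ := by
  rw [transpose_nonsing_inv, hmat_transpose hW]

lemma hmat_inv_dotProduct_comm (hW : IsWeight W) (x y : V → ℝ) :
    x ⬝ᵥ (hmat W b S)⁻¹ *ᵥ y = y ⬝ᵥ (hmat W b S)⁻¹ *ᵥ x := by
  rw [dotProduct_mulVec, ← mulVec_transpose, hmat_inv_transpose hW, dotProduct_comm]

lemma hmat_posDef_iff (hW : IsWeight W) :
    (hmat W b S).PosDef ↔ ∀ x : V → ℝ, x ≠ 0 → 0 < x ⬝ᵥ hmat W b S *ᵥ x := by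
  rw [posDef_iff_dotProduct_mulVec]
  exact ⟨fun h => by simpa using h.2, fun h => ⟨hmat_isHermitian hW, by simpa using h⟩⟩

lemma hmat_insert_mulVec (hW : IsWeight W) (hi : i ∉ S) (x : V → ℝ) :
    hmat W b (insert i S) *ᵥ x = hmat W b S *ᵥ x
      + ((b i - 1) * x i - restr S (W i) ⬝ᵥ x) • Pi.single i 1 - x i • restr S (W i) := by
  rw [hmat_insert hW hi]
  simp only [sub_mulVec, add_mulVec, smul_mulVec, vecMulVec_mulVec, single_one_dotProduct]
  ext j
  simp
  ring

lemma hmat_mul_inv (hP : (hmat W b S).PosDef) : hmat W b S * (hmat W b S)⁻¹ = 1 :=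
  mul_nonsing_inv _ ((isUnit_iff_isUnit_det _).1 hP.isUnit)

lemma hmat_inv_mul (hP : (hmat W b S).PosDef) : (hmat W b S)⁻¹ * hmat W b S = 1 :=
  nonsing_inv_mul _ ((isUnit_iff_isUnit_det _).1 hP.isUnit)

lemma hmat_mulVec_inv (hP : (hmat W b S).PosDef) (x : V → ℝ) :
    hmat W b S *ᵥ (hmat W b S)⁻¹ *ᵥ x = x := by
  rw [mulVec_mulVec, hmat_mul_inv hP, one_mulVec]

lemma hmat_inv_mulVec_of_notMem (hP : (hmat W b S).PosDef) {i : V} (hi : i ∉ S)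
    (x : V → ℝ) : ((hmat W b S)⁻¹ *ᵥ x) i = x i := by
  rw [← hmat_mulVec_of_notMem (W := W) (b := b) hi ((hmat W b S)⁻¹ *ᵥ x), hmat_mulVec_inv hP]

lemma peelDir_of_notMem (hP : (hmat W b S).PosDef) {j : V} (hj : j ∉ S) :
    peelDir W b S i j = 0 := by
  rw [peelDir, hmat_inv_mulVec_of_notMem hP hj, restr_apply_of_notMem hj]

lemma hmat_mulVec_peelDir (hP : (hmat W b S).PosDef) :
    hmat W b S *ᵥ peelDir W b S i = restr S (W i) :=
  hmat_mulVec_inv hP _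
lemma hmat_mulVec_single (hi : i ∉ S) :
    hmat W b S *ᵥ Pi.single i 1 = Pi.single i 1 := by
  ext j
  rw [mulVec_single_one, Matrix.col_apply, hmat]
  by_cases h : j = i <;> simp [hi, h]

lemma hmat_inv_mulVec_single (hP : (hmat W b S).PosDef) (hi : i ∉ S) :
    (hmat W b S)⁻¹ *ᵥ Pi.single i 1 = Pi.single i 1 := by
  conv_lhs => rw [← hmat_mulVec_single (b := b) hi, mulVec_mulVec, hmat_inv_mul hP, one_mulVec]

lemma hmat_insert_quadratic (hW : IsWeight W) (hP : (hmat W b S).PosDef) (hi : i ∉ S)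
    (x : V → ℝ) :
    x ⬝ᵥ hmat W b (insert i S) *ᵥ x
      = (x - x i • (Pi.single i 1 + peelDir W b S i)) ⬝ᵥ
          hmat W b S *ᵥ (x - x i • (Pi.single i 1 + peelDir W b S i))
        + schur W b S i * x i ^ 2 := by
  have h1 := hmat_mulVec_peelDir (i := i) hP
  have h2 := hmat_mulVec_single (W := W) (b := b) hi
  have h3 : peelDir W b S i i = 0 := peelDir_of_notMem hP hi
  have h4 : restr S (W i) i = 0 := restr_apply_of_notMem hi _
  have h5 : (hmat W b S *ᵥ x) i = x i := hmat_mulVec_of_notMem hi x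
  have h6 : peelDir W b S i ⬝ᵥ hmat W b S *ᵥ x = restr S (W i) ⬝ᵥ x := by
    rw [hmat_dotProduct_comm hW, h1, dotProduct_comm]
  rw [hmat_insert_mulVec hW hi, schur]
  simp only [mulVec_sub, mulVec_smul, mulVec_add, h1, h2, dotProduct_sub, dotProduct_add,
    dotProduct_smul, sub_dotProduct, add_dotProduct, smul_dotProduct, h6, dotProduct_single_one,
    single_one_dotProduct, h3, h4, h5, smul_eq_mul, dotProduct_comm x,
    dotProduct_comm (peelDir W b S i) (restr S (W i)), Pi.single_eq_same, Pi.sub_apply,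
    Pi.smul_apply, Pi.add_apply]
  ring

lemma hmat_posDef_of_insert (hW : IsWeight W) (hi : i ∉ S)
    (hP : (hmat W b (insert i S)).PosDef) : (hmat W b S).PosDef := by
  rw [hmat_posDef_iff hW] at hP ⊢
  intro x hx
  set x₀ := x - x i • Pi.single i 1 with hx₀
  have hx₀i : x₀ i = 0 := by simp [hx₀]
  have hxe : x = x₀ + x i • Pi.single i 1 := by simp [hx₀]
  have hq : x ⬝ᵥ hmat W b S *ᵥ x = x₀ ⬝ᵥ hmat W b (insert i S) *ᵥ x₀ + x i ^ 2 := by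
    have h5 : (hmat W b S *ᵥ x₀) i = 0 := by rw [hmat_mulVec_of_notMem hi, hx₀i]
    rw [hmat_insert_mulVec hW hi, hx₀i]
    conv_lhs => rw [hxe]
    simp only [mulVec_smul, mulVec_add, hmat_mulVec_single hi, dotProduct_sub, dotProduct_add,
      dotProduct_smul, add_dotProduct, smul_dotProduct, dotProduct_single_one,
      single_one_dotProduct, h5, hx₀i, smul_eq_mul, Pi.single_eq_same, Pi.smul_apply, Pi.add_apply]
    ring
  rw [hq]
  by_cases h0 : x₀ = 0
  · have : x i ≠ 0 := by
      intro h
      rw [h0, h] at hxe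
      simp at hxe
      exact hx hxe
    rw [h0]
    simp
    positivity
  · exact add_pos_of_pos_of_nonneg (hP x₀ h0) (sq_nonneg _)

lemma hmat_posDef_insert (hW : IsWeight W) (hi : i ∉ S) :
    (hmat W b (insert i S)).PosDef ↔ (hmat W b S).PosDef ∧ 0 < schur W b S i := by
  constructor
  · intro hP
    have hP' := hmat_posDef_of_insert hW hi hP
    refine ⟨hP', ?_⟩
    have h3 : peelDir W b S i i = 0 := peelDir_of_notMem hP' hi
    have h := hmat_insert_quadratic hW hP' hi (Pi.single i 1 + peelDir W b S i)
    have hz : (Pi.single i 1 + peelDir W b S i : V → ℝ) i = 1 := by simp [h3]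
    rw [hz, one_smul, sub_self, zero_dotProduct, zero_add, one_pow, mul_one] at h
    rw [← h]
    refine (hmat_posDef_iff hW).1 hP _ fun h0 => ?_
    rw [h0] at hz
    simp at hz
  · rintro ⟨hP, hy⟩
    refine (hmat_posDef_iff hW).2 fun x hx => ?_
    rw [hmat_insert_quadratic hW hP hi]
    by_cases h0 : x i = 0
    · rw [h0]
      simpa using (hmat_posDef_iff hW).1 hP x hx
    · refine add_pos_of_nonneg_of_pos ?_ (by positivity)
      by_cases h1 : x - x i • (Pi.single i 1 + peelDir W b S i) = 0
      · rw [h1]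
        simp
      · exact ((hmat_posDef_iff hW).1 hP _ h1).le

lemma hmat_empty : hmat W b ∅ = 1 := by
  ext i j
  simp [hmat, one_apply]

lemma hmat_posDef_empty : (hmat W b ∅).PosDef := by
  rw [hmat_empty]
  exact PosDef.one

lemma hmat_insert_inv (hW : IsWeight W) (hi : i ∉ S) (hP : (hmat W b S).PosDef)
    (hy : schur W b S i ≠ 0) :
    (hmat W b (insert i S))⁻¹ = (hmat W b S)⁻¹ - vecMulVec (Pi.single i 1) (Pi.single i 1)
      + (schur W b S i)⁻¹ • vecMulVec (Pi.single i 1 + peelDir W b S i)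
          (Pi.single i 1 + peelDir W b S i) := by
  apply inv_eq_right_inv
  have h3 : peelDir W b S i i = 0 := peelDir_of_notMem hP hi
  have h4 : restr S (W i) i = 0 := restr_apply_of_notMem hi _
  have hz : hmat W b (insert i S) *ᵥ (Pi.single i 1 + peelDir W b S i)
      = schur W b S i • Pi.single i 1 := by
    rw [hmat_insert_mulVec hW hi, mulVec_add, hmat_mulVec_single hi, hmat_mulVec_peelDir hP,
      schur]
    ext j
    simp [h3, h4, dotProduct_add]
    ring
  have he : hmat W b (insert i S) *ᵥ Pi.single i 1
      = b i • Pi.single i 1 - restr S (W i) := by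
    rw [hmat_insert_mulVec hW hi, hmat_mulVec_single hi]
    ext j
    simp [h4]
    ring
  have hr : Pi.single i (1 : ℝ) ᵥ* (hmat W b S)⁻¹ = Pi.single i 1 := by
    rw [← mulVec_transpose, hmat_inv_transpose hW, hmat_inv_mulVec_single hP hi]
  have hr2 : restr S (W i) ᵥ* (hmat W b S)⁻¹ = peelDir W b S i := by
    rw [← mulVec_transpose, hmat_inv_transpose hW, peelDir]
  have hM : hmat W b (insert i S) * (hmat W b S)⁻¹
      = 1 + (b i - 1) • vecMulVec (Pi.single i 1) (Pi.single i 1)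
        - vecMulVec (Pi.single i 1) (peelDir W b S i)
        - vecMulVec (restr S (W i)) (Pi.single i 1) := by
    rw [hmat_insert hW hi]
    simp only [sub_mul, add_mul, smul_mul_assoc, vecMulVec_mul, hr, hr2, hmat_mul_inv hP]
  rw [mul_add, mul_sub, mul_smul_comm, mul_vecMulVec, mul_vecMulVec, hz, he, hM, smul_vecMulVec,
    smul_smul, inv_mul_cancel₀ hy, one_smul]
  ext j k
  simp [vecMulVec_apply]
  ring

lemma hmat_insert_inv_mulVec (hW : IsWeight W) (hi : i ∉ S) (hP : (hmat W b S).PosDef)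
    (hy : schur W b S i ≠ 0) (η : V → ℝ) :
    (hmat W b (insert i S))⁻¹ *ᵥ restr (insert i S) η = (hmat W b S)⁻¹ *ᵥ restr S η
      + ((η i + peelDir W b S i ⬝ᵥ restr S η) / schur W b S i) •
          (Pi.single i 1 + peelDir W b S i) := by
  have h3 : peelDir W b S i i = 0 := peelDir_of_notMem hP hi
  have h4 : restr S η i = 0 := restr_apply_of_notMem hi _
  rw [hmat_insert_inv hW hi hP hy, restr_insert hi]
  simp only [add_mulVec, sub_mulVec, smul_mulVec, vecMulVec_mulVec, mulVec_add, mulVec_smul,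
    hmat_inv_mulVec_single hP hi, single_one_dotProduct, add_dotProduct, h4,
    dotProduct_single_one]
  ext j
  simp [h3]
  ring

lemma hmat_insert_det (hW : IsWeight W) (hi : i ∉ S) (hP : (hmat W b S).PosDef) :
    (hmat W b (insert i S)).det = schur W b S i * (hmat W b S).det := by
  have h3 : peelDir W b S i i = 0 := peelDir_of_notMem hP hi
  have hr : Pi.single i (1 : ℝ) ᵥ* hmat W b S = Pi.single i 1 := by
    rw [← mulVec_transpose, hmat_transpose hW, hmat_mulVec_single hi]
  have hr2 : peelDir W b S i ᵥ* hmat W b S = restr S (W i) := by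
    rw [← mulVec_transpose, hmat_transpose hW, hmat_mulVec_peelDir hP]
  have hfac : hmat W b (insert i S)
      = (1 - vecMulVec (Pi.single i 1) (peelDir W b S i))
        * (1 + (schur W b S i - 1) • vecMulVec (Pi.single i 1) (Pi.single i 1))
        * hmat W b S * (1 - vecMulVec (peelDir W b S i) (Pi.single i 1)) := by
    have e1 : (1 + (schur W b S i - 1) • vecMulVec (Pi.single i 1) (Pi.single i 1)) * hmat W b S
        * (1 - vecMulVec (peelDir W b S i) (Pi.single i 1))
        = hmat W b S + (schur W b S i - 1) • vecMulVec (Pi.single i 1) (Pi.single i 1)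
          - vecMulVec (restr S (W i)) (Pi.single i 1) := by
      simp only [add_mul, one_mul, mul_sub, mul_one, smul_mul_assoc, vecMulVec_mul, hr,
        mul_vecMulVec, hmat_mulVec_peelDir hP, vecMulVec_mulVec,
        single_one_dotProduct, h3]
      simp
    rw [mul_assoc, mul_assoc, ← mul_assoc (1 + _), e1, hmat_insert hW hi, schur]
    simp only [sub_mul, mul_sub, mul_add, one_mul, vecMulVec_mul, hr2,
      mul_smul_comm, mul_vecMulVec, vecMulVec_mulVec, dotProduct_single_one, h3]
    ext j k
    simp [vecMulVec_apply, dotProduct_comm (restr S (W i))]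
    ring
  have d1 : (1 - vecMulVec (Pi.single i 1) (peelDir W b S i)).det = 1 := by
    have := det_one_sub_mul_comm (replicateCol Unit (Pi.single i (1 : ℝ)))
      (replicateRow Unit (peelDir W b S i))
    rw [← vecMulVec_eq] at this
    rw [this]
    simp [Matrix.mul_apply, h3, Pi.single_apply]
  have d2 : (1 - vecMulVec (peelDir W b S i) (Pi.single i 1)).det = 1 := by
    rw [← det_transpose, transpose_sub, transpose_one, transpose_vecMulVec, d1]
  have d3 : ((1 : Matrix V V ℝ) +
      (schur W b S i - 1) • vecMulVec (Pi.single i 1) (Pi.single i 1)).det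
      = schur W b S i := by
    rw [← smul_vecMulVec, vecMulVec_eq Unit, det_one_add_mul_comm]
    simp [Matrix.mul_apply, Pi.single_apply]
  rw [hfac, det_mul, det_mul, det_mul, d1, d2, d3]
  ring

lemma hmat_inv_nonneg (hW : IsWeight W) (hP : (hmat W b S).PosDef) (j k : V) :
    0 ≤ (hmat W b S)⁻¹ j k := by
  induction S using Finset.induction_on generalizing j k with
  | empty =>
    rw [hmat_empty, inv_one, one_apply]
    split_ifs <;> simp
  | insert i S hi ih =>
    obtain ⟨hP', hy⟩ := (hmat_posDef_insert hW hi).1 hP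
    have hp : ∀ j, 0 ≤ peelDir W b S i j := fun j =>
      Finset.sum_nonneg fun k _ => mul_nonneg (ih hP' j k) (restr_nonneg (hW.nonneg i) k)
    have hz : ∀ j, 0 ≤ (Pi.single i 1 + peelDir W b S i : V → ℝ) j := fun j =>
      add_nonneg (by by_cases h : j = i <;> simp [h]) (hp j)
    rw [hmat_insert_inv hW hi hP' hy.ne']
    refine add_nonneg ?_ (mul_nonneg (inv_nonneg.2 hy.le) (mul_nonneg (hz j) (hz k)))
    rw [Matrix.sub_apply, vecMulVec_apply]
    by_cases hj : j = i
    · subst hj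
      have h := congrFun (hmat_inv_mulVec_single hP' hi) k
      rw [mulVec_single_one, col_apply] at h
      have h' : (hmat W b S)⁻¹ j k = (hmat W b S)⁻¹ k j := by
        conv_lhs => rw [← hmat_inv_transpose hW, transpose_apply]
      rw [h', h]
      by_cases hk : k = j <;> simp [hk]
    · simpa [hj] using ih hP' j k

lemma peelDir_nonneg (hW : IsWeight W) (hP : (hmat W b S).PosDef) (j : V) :
    0 ≤ peelDir W b S i j :=
  Finset.sum_nonneg fun k _ => mul_nonneg (hmat_inv_nonneg hW hP j k) (restr_nonneg (hW.nonneg i) k)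

end

end ERRWZ2

namespace ERRWZ2

open Matrix Set Real

variable {V : Type*} [Fintype V] [DecidableEq V]

/-- The Green operator of `b - W` on `S` applied to `η`. -/
noncomputable def grn (W : V → V → ℝ) (b : V → ℝ) (S : Finset V) (η : V → ℝ) : V → ℝ :=
  (hmat W b S)⁻¹ *ᵥ restr S η

/-- The unnormalised density `det (b - W)^{-1/2}` on the set where `b - W` is positive definite. -/
noncomputable def detDensity (W : V → V → ℝ) (b : V → ℝ) (S : Finset V) : ℝ :=
  if (hmat W b S).PosDef then (√(2 * π) ^ S.card * √(hmat W b S).det)⁻¹ else 0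

/-- The density of the random potential on `S` with boundary field `η` and parameters `θ`. -/
noncomputable def potDensity (W : V → V → ℝ) (S : Finset V) (η θ : V → ℝ) (b : V → ℝ) : ℝ :=
  detDensity W b S * (∏ i ∈ S, θ i) *
    exp (-(restr S θ ⬝ᵥ hmat W b S *ᵥ restr S θ) / 2 - (restr S η ⬝ᵥ grn W b S η) / 2
      + restr S η ⬝ᵥ restr S θ)

/-- The numerator of the Green operator at the last peeled vertex. -/
noncomputable def peelSource (W : V → V → ℝ) (b : V → ℝ) (S : Finset V) (i : V) (η : V → ℝ) : ℝ :=
  η i + peelDir W b S i ⬝ᵥ restr S η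

section Measurability

variable {α : Type*} [MeasurableSpace α]

lemma measurable_matrix_det {M : α → Matrix V V ℝ} (hM : ∀ i j, Measurable fun x => M x i j) :
    Measurable fun x => (M x).det := by
  simp only [det_apply]
  refine Finset.measurable_fun_sum _ fun σ _ => Measurable.const_smul ?_ _
  exact Finset.measurable_fun_prod _ fun i _ => hM _ _

lemma measurable_matrix_inv {M : α → Matrix V V ℝ} (hM : ∀ i j, Measurable fun x => M x i j)
    (i j : V) : Measurable fun x => (M x)⁻¹ i j := by
  have h : ∀ x, (M x)⁻¹ i j = (M x).det⁻¹ * ((M x).updateRow j (Pi.single i 1)).det := fun x => by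
    rw [inv_def, Ring.inverse_eq_inv', Matrix.smul_apply, adjugate_apply, smul_eq_mul]
  simp only [h]
  refine (measurable_matrix_det hM).inv.mul (measurable_matrix_det fun k l => ?_)
  simp only [updateRow_apply]
  split_ifs
  exacts [measurable_const, hM _ _]

lemma measurable_dotProduct {f g : α → V → ℝ} (hf : Measurable f) (hg : Measurable g) :
    Measurable fun x => f x ⬝ᵥ g x :=
  Finset.measurable_fun_sum _ fun i _ =>
    (measurable_pi_iff.1 hf i).mul (measurable_pi_iff.1 hg i)

lemma measurable_mulVec {M : α → Matrix V V ℝ} (hM : ∀ i j, Measurable fun x => M x i j)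
    {g : α → V → ℝ} (hg : Measurable g) : Measurable fun x => M x *ᵥ g x :=
  measurable_pi_iff.2 fun i => Finset.measurable_fun_sum _ fun j _ =>
    (hM i j).mul (measurable_pi_iff.1 hg j)

lemma measurable_restr {f : α → V → ℝ} (hf : Measurable f) (S : Finset V) :
    Measurable fun x => restr S (f x) := by
  refine measurable_pi_iff.2 fun j => ?_
  by_cases hj : j ∈ S <;> simp only [restr, hj, if_true, if_false]
  exacts [measurable_pi_iff.1 hf j, measurable_const]

variable {W : α → V → V → ℝ} {b : α → V → ℝ}

lemma measurable_hmat (hW : Measurable W) (hb : Measurable b) (S : Finset V) (i j : V) :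
    Measurable fun x => hmat (W x) (b x) S i j := by
  simp only [hmat, of_apply]
  have h1 : Measurable fun x => W x i j := measurable_pi_iff.1 (measurable_pi_iff.1 hW i) j
  have h2 : Measurable fun x => b x i := measurable_pi_iff.1 hb i
  split_ifs <;> fun_prop

lemma measurable_grn (hW : Measurable W) (hb : Measurable b) (S : Finset V) {η : α → V → ℝ}
    (hη : Measurable η) : Measurable fun x => grn (W x) (b x) S (η x) :=
  measurable_mulVec (measurable_matrix_inv (measurable_hmat hW hb S)) (measurable_restr hη S)

lemma measurable_peelDir (hW : Measurable W) (hb : Measurable b) (S : Finset V) (i : V) :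
    Measurable fun x => peelDir (W x) (b x) S i :=
  measurable_grn hW hb S (measurable_pi_iff.1 hW i)

lemma measurable_schur (hW : Measurable W) (hb : Measurable b) (S : Finset V) (i : V) :
    Measurable fun x => schur (W x) (b x) S i :=
  (measurable_pi_iff.1 hb i).sub (measurable_dotProduct
    (measurable_restr (measurable_pi_iff.1 hW i) S) (measurable_peelDir hW hb S i))

lemma measurableSet_posDef (hW : Measurable W) (hb : Measurable b) (hw : ∀ x, IsWeight (W x))
    (S : Finset V) : MeasurableSet {x | (hmat (W x) (b x) S).PosDef} := by
  induction S using Finset.induction_on with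
  | empty => simp [hmat_posDef_empty]
  | insert i S hi ih =>
    simp only [hmat_posDef_insert (hw _) hi]
    exact ih.inter (measurableSet_lt measurable_const (measurable_schur hW hb S i))

lemma measurable_detDensity (hW : Measurable W) (hb : Measurable b) (hw : ∀ x, IsWeight (W x))
    (S : Finset V) : Measurable fun x => detDensity (W x) (b x) S := by
  refine Measurable.ite (measurableSet_posDef hW hb hw S) ?_ measurable_const
  exact ((measurable_matrix_det (measurable_hmat hW hb S)).sqrt.const_mul _).inv

lemma measurable_potDensity (hW : Measurable W) (hb : Measurable b) (hw : ∀ x, IsWeight (W x))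
    (S : Finset V) {η : α → V → ℝ} (hη : Measurable η) (θ : V → ℝ) :
    Measurable fun x => potDensity (W x) S (η x) θ (b x) := by
  refine ((measurable_detDensity hW hb hw S).mul measurable_const).mul (Measurable.exp ?_)
  have hθ : Measurable fun _ : α => restr S θ := measurable_const
  refine (((measurable_dotProduct hθ (measurable_mulVec (measurable_hmat hW hb S) hθ)).neg.div_const
    _).sub ((measurable_dotProduct (measurable_restr hη S) (measurable_grn hW hb S
    hη)).div_const _)).add (measurable_dotProduct (measurable_restr hη S) hθ)

end Measurability

section Peeling

variable {W : V → V → ℝ} {b : V → ℝ} {S : Finset V} {i : V}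

lemma detDensity_nonneg : 0 ≤ detDensity W b S := by
  unfold detDensity
  split_ifs <;> positivity

lemma potDensity_nonneg {η θ : V → ℝ} (hθ : ∀ i, 0 < θ i) : 0 ≤ potDensity W S η θ b :=
  mul_nonneg (mul_nonneg detDensity_nonneg (Finset.prod_nonneg fun i _ => (hθ i).le)) (exp_nonneg _)

lemma posDef_of_potDensity_ne_zero {η θ : V → ℝ} (h : potDensity W S η θ b ≠ 0) :
    (hmat W b S).PosDef := by
  by_contra hP
  simp [potDensity, detDensity, hP] at h

lemma peelSource_nonneg (hW : IsWeight W) (hP : (hmat W b S).PosDef) {η : V → ℝ}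
    (hη : ∀ j, 0 ≤ η j) : η i ≤ peelSource W b S i η :=
  le_add_of_nonneg_right (Finset.sum_nonneg fun j _ =>
    mul_nonneg (peelDir_nonneg hW hP j) (restr_nonneg hη j))

lemma grn_insert (hW : IsWeight W) (hi : i ∉ S) (hP : (hmat W b S).PosDef)
    (hy : schur W b S i ≠ 0) (η : V → ℝ) :
    grn W b (insert i S) η = grn W b S η
      + (peelSource W b S i η / schur W b S i) • (Pi.single i 1 + peelDir W b S i) :=
  hmat_insert_inv_mulVec hW hi hP hy η

lemma grn_insert_self (hW : IsWeight W) (hi : i ∉ S) (hP : (hmat W b S).PosDef)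
    (hy : schur W b S i ≠ 0) (η : V → ℝ) :
    grn W b (insert i S) η i = peelSource W b S i η / schur W b S i := by
  have h1 : grn W b S η i = 0 := by
    rw [grn, hmat_inv_mulVec_of_notMem hP hi, restr_apply_of_notMem hi]
  rw [grn_insert hW hi hP hy]
  simp [h1, peelDir_of_notMem hP hi]

lemma potDensity_insert (hW : IsWeight W) (hi : i ∉ S) (η θ : V → ℝ) :
    potDensity W (insert i S) η θ b
      = igDensity (θ i) (peelSource W b S i η) (schur W b S i)
        * potDensity W S (η + θ i • W i) θ b := by
  by_cases hP : (hmat W b S).PosDef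
  swap
  · have : ¬ (hmat W b (insert i S)).PosDef := fun h => hP (hmat_posDef_of_insert hW hi h)
    simp [potDensity, detDensity, hP, this]
  by_cases hy : 0 < schur W b S i
  swap
  · have : ¬ (hmat W b (insert i S)).PosDef := fun h => hy ((hmat_posDef_insert hW hi).1 h).2
    simp [potDensity, detDensity, igDensity, hy, this]
  have hP' := (hmat_posDef_insert hW hi).2 ⟨hP, hy⟩
  have hdet : 0 < (hmat W b S).det := hP.det_pos
  have h3 : peelDir W b S i i = 0 := peelDir_of_notMem hP hi
  have hθi : restr S θ i = 0 := restr_apply_of_notMem hi _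
  have hηi : restr S η i = 0 := restr_apply_of_notMem hi _
  have h4 : restr S (W i) i = 0 := restr_apply_of_notMem hi _
  have h1 : grn W b S η i = 0 := by
    rw [grn, hmat_inv_mulVec_of_notMem hP hi, restr_apply_of_notMem hi]
  have hy2 : √(schur W b S i) ^ 2 = schur W b S i := sq_sqrt hy.le
  have hs : 0 < √(schur W b S i) := sqrt_pos.2 hy
  have hb : b i = schur W b S i + restr S (W i) ⬝ᵥ peelDir W b S i := by rw [schur]; ring
  have hE1 : restr (insert i S) θ ⬝ᵥ hmat W b (insert i S) *ᵥ restr (insert i S) θ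
      = restr S θ ⬝ᵥ hmat W b S *ᵥ restr S θ - 2 * θ i * (restr S (W i) ⬝ᵥ restr S θ)
        + b i * θ i ^ 2 := by
    have h5 : (hmat W b S *ᵥ restr S θ) i = 0 := by rw [hmat_mulVec_of_notMem hi, hθi]
    rw [hmat_insert_mulVec hW hi, restr_insert hi]
    simp only [mulVec_smul, mulVec_add, hmat_mulVec_single hi, dotProduct_sub, dotProduct_add,
      dotProduct_smul, add_dotProduct, smul_dotProduct, dotProduct_single_one,
      single_one_dotProduct, h5, hθi, h4, smul_eq_mul, Pi.single_eq_same, Pi.smul_apply,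
      Pi.add_apply, dotProduct_comm (restr S θ) (restr S (W i))]
    ring
  have hE2 : restr (insert i S) η ⬝ᵥ grn W b (insert i S) η
      = restr S η ⬝ᵥ grn W b S η + peelSource W b S i η ^ 2 / schur W b S i := by
    rw [grn_insert hW hi hP hy.ne', restr_insert hi]
    simp only [dotProduct_add, dotProduct_smul, add_dotProduct, smul_dotProduct,
      dotProduct_single_one, single_one_dotProduct, hηi, h1, h3, smul_eq_mul,
      dotProduct_comm (restr S η) (peelDir W b S i), peelSource, Pi.single_eq_same,
      Pi.add_apply, Pi.smul_apply]
    ring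
  have hE3 : restr (insert i S) η ⬝ᵥ restr (insert i S) θ
      = restr S η ⬝ᵥ restr S θ + η i * θ i := by
    rw [restr_insert hi, restr_insert hi]
    simp only [dotProduct_add, dotProduct_smul, add_dotProduct, smul_dotProduct,
      dotProduct_single_one, single_one_dotProduct, hηi, hθi, smul_eq_mul, Pi.single_eq_same,
      Pi.add_apply, Pi.smul_apply]
    ring
  have hE4 : restr S (η + θ i • W i) ⬝ᵥ grn W b S (η + θ i • W i)
      = restr S η ⬝ᵥ grn W b S η + 2 * θ i * (peelDir W b S i ⬝ᵥ restr S η)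
        + θ i ^ 2 * (restr S (W i) ⬝ᵥ peelDir W b S i) := by
    have h6 : restr S (W i) ⬝ᵥ grn W b S η = peelDir W b S i ⬝ᵥ restr S η := by
      rw [grn, hmat_inv_dotProduct_comm hW, dotProduct_comm, peelDir]
    have h7 : grn W b S (η + θ i • W i) = grn W b S η + θ i • peelDir W b S i := by
      rw [grn, grn, peelDir, restr_add, restr_smul, mulVec_add, mulVec_smul]
    rw [h7, restr_add, restr_smul]
    simp only [dotProduct_add, dotProduct_smul, add_dotProduct, smul_dotProduct, h6, smul_eq_mul,
      dotProduct_comm (restr S η) (peelDir W b S i)]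
    ring
  have hE5 : restr S (η + θ i • W i) ⬝ᵥ restr S θ
      = restr S η ⬝ᵥ restr S θ + θ i * (restr S (W i) ⬝ᵥ restr S θ) := by
    rw [restr_add, restr_smul]
    simp only [add_dotProduct, smul_dotProduct, smul_eq_mul]
  have hE6 : (θ i * √(schur W b S i) - peelSource W b S i η / √(schur W b S i)) ^ 2
      = θ i ^ 2 * schur W b S i - 2 * θ i * peelSource W b S i η
        + peelSource W b S i η ^ 2 / schur W b S i := by
    rw [sub_sq, mul_pow, div_pow, hy2]
    field_simp
  have hE7 : peelSource W b S i η = η i + peelDir W b S i ⬝ᵥ restr S η := rfl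
  rw [potDensity, potDensity, detDensity, detDensity, if_pos hP, if_pos hP', igDensity, if_pos hy,
    hmat_insert_det hW hi hP, sqrt_mul hy.le, Finset.prod_insert hi,
    Finset.card_insert_of_notMem hi, pow_succ, hE1, hE2, hE3, hE4, hE5, hE6]
  have key : ∀ a b c d : ℝ, a * b * (c * d) = (a * c) * (b * d) := fun _ _ _ _ => by ring
  refine Eq.trans ?_ (key _ _ _ _).symm
  rw [← exp_add]
  congr 1
  · field_simp
  · congr 1
    rw [hE7, hb]
    ring

end Peeling

end ERRWZ2

namespace ERRWZ2

open Matrix Set Real Function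

variable {V : Type*} [Fintype V] [DecidableEq V]
variable {W : V → V → ℝ} {b : V → ℝ} {S : Finset V} {i : V}

section Locality

lemma hmat_update (hi : i ∉ S) (y : ℝ) : hmat W (update b i y) S = hmat W b S := by
  ext j k
  simp only [hmat, of_apply]
  by_cases hj : j = i
  · subst hj
    simp [hi]
  · simp [hj]

lemma grn_update (hi : i ∉ S) (y : ℝ) (η : V → ℝ) :
    grn W (update b i y) S η = grn W b S η := by rw [grn, grn, hmat_update hi]

lemma peelDir_update (hi : i ∉ S) (y : ℝ) :
    peelDir W (update b i y) S i = peelDir W b S i := by rw [peelDir, peelDir, hmat_update hi]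

lemma peelSource_update (hi : i ∉ S) (y : ℝ) (η : V → ℝ) :
    peelSource W (update b i y) S i η = peelSource W b S i η := by
  rw [peelSource, peelSource, peelDir_update hi]

lemma schur_update (hi : i ∉ S) (y : ℝ) :
    schur W (update b i y) S i = y - restr S (W i) ⬝ᵥ peelDir W b S i := by
  rw [schur, peelDir_update hi, update_self]

lemma potDensity_update (hi : i ∉ S) (y : ℝ) (η θ : V → ℝ) :
    potDensity W S η θ (update b i y) = potDensity W S η θ b := by
  rw [potDensity, potDensity, detDensity, detDensity, hmat_update hi, grn_update hi]

end Locality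

lemma measurable_potDensity_right (hW : IsWeight W) (S : Finset V) (η θ : V → ℝ) :
    Measurable fun b => ENNReal.ofReal (potDensity W S η θ b) :=
  (measurable_potDensity (W := fun _ => W) (b := id) measurable_const measurable_id
    (fun _ => hW) S (η := fun _ => η) measurable_const θ).ennreal_ofReal

lemma measurable_hmat_inv (S : Finset V) (i j : V) : Measurable fun b => (hmat W b S)⁻¹ i j :=
  measurable_matrix_inv (measurable_hmat (W := fun _ => W) (b := id) measurable_const
    measurable_id S) i j

lemma measurable_grn_right (S : Finset V) (η : V → ℝ) (i : V) :
    Measurable fun b => grn W b S η i :=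
  measurable_pi_iff.1 (measurable_grn (W := fun _ => W) (b := id) measurable_const
    measurable_id S (η := fun _ => η) measurable_const) i

lemma ofReal_potDensity_mul_congr {η θ : V → ℝ} {X Y : ℝ≥0∞}
    (h : (hmat W b S).PosDef → X = Y) :
    ENNReal.ofReal (potDensity W S η θ b) * X = ENNReal.ofReal (potDensity W S η θ b) * Y := by
  by_cases h0 : potDensity W S η θ b = 0
  · simp [h0]
  · rw [h (posDef_of_potDensity_ne_zero h0)]

lemma ofReal_potDensity_mul_mono {η θ : V → ℝ} {X Y : ℝ≥0∞}
    (h : (hmat W b S).PosDef → X ≤ Y) :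
    ENNReal.ofReal (potDensity W S η θ b) * X ≤ ENNReal.ofReal (potDensity W S η θ b) * Y := by
  by_cases h0 : potDensity W S η θ b = 0
  · simp [h0]
  · exact mul_le_mul_right (h (posDef_of_potDensity_ne_zero h0)) _

variable {ν : V → Measure ℝ} [∀ i, SigmaFinite (ν i)]

lemma lmarginal_potDensity_insert (hW : IsWeight W) (hi : i ∉ S) (hν : ν i = volume)
    {η θ : V → ℝ} (hθ : ∀ j, 0 < θ j) {F : (V → ℝ) → ℝ≥0∞} (hF : Measurable F) :
    ∫⋯∫⁻_insert i S, (fun b => ENNReal.ofReal (potDensity W (insert i S) η θ b) * F b) ∂ν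
      = ∫⋯∫⁻_S, (fun b => ENNReal.ofReal (potDensity W S (η + θ i • W i) θ b) *
          ∫⁻ y, ENNReal.ofReal (igDensity (θ i) (peelSource W b S i η) y) *
            F (update b i (y + restr S (W i) ⬝ᵥ peelDir W b S i))) ∂ν := by
  have hm : Measurable fun b => ENNReal.ofReal (potDensity W (insert i S) η θ b) * F b :=
    (measurable_potDensity_right hW _ _ _).mul hF
  rw [lmarginal_insert' _ hm hi]
  congr 1
  ext b
  rw [hν, ← lintegral_add_right_eq_self _ (restr S (W i) ⬝ᵥ peelDir W b S i),
    ← lintegral_const_mul' _ _ ENNReal.ofReal_ne_top]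
  congr 1
  ext y
  rw [potDensity_insert hW hi, potDensity_update hi, schur_update hi, peelSource_update hi,
    add_sub_cancel_right, mul_comm (igDensity _ _ _), ENNReal.ofReal_mul (potDensity_nonneg hθ),
    mul_assoc]

lemma lmarginal_potDensity (hW : IsWeight W) (hν : ∀ i ∈ S, ν i = volume)
    {η θ : V → ℝ} (hη : ∀ j, 0 ≤ η j) (hθ : ∀ j, 0 < θ j) :
    ∫⋯∫⁻_S, (fun b => ENNReal.ofReal (potDensity W S η θ b)) ∂ν = 1 := by
  induction S using Finset.induction_on generalizing η with
  | empty =>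
    ext b
    have h0 : ∀ f : V → ℝ, restr ∅ f = 0 := fun f => by ext; simp [restr]
    simp [potDensity, detDensity, h0, hmat_empty, PosDef.one]
  | insert i S hi ih =>
    have h := lmarginal_potDensity_insert (ν := ν) hW hi (hν i (Finset.mem_insert_self _ _))
      (η := η) hθ (F := fun _ => 1) measurable_const
    simp only [mul_one] at h
    rw [h, ← ih (fun j hj => hν j (Finset.mem_insert_of_mem hj)) (η := η + θ i • W i)
      fun j => add_nonneg (hη j) (mul_nonneg (hθ i).le (hW.nonneg i j))]
    congr 1
    ext b
    rw [← mul_one (ENNReal.ofReal (potDensity W S _ θ b)), mul_one (ENNReal.ofReal _)]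
    nth_rw 2 [← mul_one (ENNReal.ofReal (potDensity W S _ θ b))]
    exact ofReal_potDensity_mul_congr fun hP =>
      lintegral_igDensity (hθ i) ((hη i).trans (peelSource_nonneg hW hP hη))

lemma hmat_update_posDef_insert (hi : i ∉ S) (hP : (hmat W b S).PosDef) (y : ℝ) :
    (hmat W (update b i (y + restr S (W i) ⬝ᵥ peelDir W b S i)) S).PosDef ∧
      schur W (update b i (y + restr S (W i) ⬝ᵥ peelDir W b S i)) S i = y := by
  rw [hmat_update hi, schur_update hi, add_sub_cancel_right]
  exact ⟨hP, rfl⟩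

lemma lmarginal_potDensity_grn (hW : IsWeight W) (hi : i ∉ S) (hν : ∀ j ∈ insert i S, ν j = volume)
    {η θ : V → ℝ} (hη : ∀ j, 0 ≤ η j) (hθ : ∀ j, 0 < θ j)
    (hpos : ∀ b, (hmat W b S).PosDef → 0 < peelSource W b S i η) :
    ∫⋯∫⁻_insert i S, (fun b => ENNReal.ofReal (potDensity W (insert i S) η θ b) *
      ENNReal.ofReal (grn W b (insert i S) η i)) ∂ν = fun _ => ENNReal.ofReal (θ i) := by
  rw [lmarginal_potDensity_insert hW hi (hν i (Finset.mem_insert_self _ _)) hθ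
    (measurable_grn_right _ _ _).ennreal_ofReal]
  have h1 := lmarginal_potDensity (ν := ν) hW (fun j hj => hν j (Finset.mem_insert_of_mem hj))
    (η := η + θ i • W i) (fun j => add_nonneg (hη j) (mul_nonneg (hθ i).le (hW.nonneg i j))) hθ
  ext x
  have h2 := congrFun h1 x
  rw [lmarginal] at h2 ⊢
  rw [← mul_one (ENNReal.ofReal (θ i)), ← Pi.one_apply (M := fun _ => ℝ≥0∞) x, ← h2,
    ← lintegral_const_mul' _ _ ENNReal.ofReal_ne_top]
  congr 1
  ext z
  rw [mul_comm (ENNReal.ofReal (θ i))]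
  refine ofReal_potDensity_mul_congr fun hP => ?_
  rw [← lintegral_igDensity_mul (hθ i) (hpos _ hP)]
  congr 1
  ext y
  by_cases hy : 0 < y
  · obtain ⟨hP', hs⟩ := hmat_update_posDef_insert hi hP y
    rw [grn_insert_self hW hi hP' (by rw [hs]; exact hy.ne'), hs, peelSource_update hi,
      ENNReal.ofReal_mul (igDensity_nonneg (hθ i).le)]
  · simp [igDensity, hy]

lemma hmat_insert_inv_apply (hW : IsWeight W) (hi : i ∉ S) (hP : (hmat W b S).PosDef)
    (hy : schur W b S i ≠ 0) (v : V) :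
    (hmat W b (insert i S))⁻¹ i v
      = (Pi.single i 1 + peelDir W b S i : V → ℝ) v / schur W b S i := by
  have h := congrFun (hmat_inv_mulVec_single hP hi) v
  rw [mulVec_single_one, col_apply] at h
  have h' : (hmat W b S)⁻¹ i v = (hmat W b S)⁻¹ v i := by
    conv_lhs => rw [← hmat_inv_transpose hW, transpose_apply]
  rw [hmat_insert_inv hW hi hP hy, Matrix.add_apply, Matrix.sub_apply, Matrix.smul_apply,
    vecMulVec_apply, vecMulVec_apply, h', h]
  simp [peelDir_of_notMem hP hi]
  ring

lemma peelDir_apply (hW : IsWeight W) (v : V) :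
    peelDir W b S i v = ∑ j ∈ S, W i j * (hmat W b S)⁻¹ j v := by
  have h' : ∀ j, (hmat W b S)⁻¹ v j = (hmat W b S)⁻¹ j v := fun j => by
    conv_lhs => rw [← hmat_inv_transpose hW, transpose_apply]
  simp only [peelDir, mulVec, dotProduct, h', restr, mul_ite, mul_zero, Finset.sum_ite_mem,
    Finset.univ_inter]
  exact Finset.sum_congr rfl fun j _ => mul_comm _ _

lemma lmarginal_potDensity_sqrt_le (hW : IsWeight W) (hi : i ∉ S) (hν : ν i = volume)
    {η : V → ℝ} (hη : ∀ j, 0 ≤ η j) (hηi : 0 < η i) (v : V) :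
    ∫⋯∫⁻_insert i S, (fun b => ENNReal.ofReal (potDensity W (insert i S) η 1 b) *
        ENNReal.ofReal (√((hmat W b (insert i S))⁻¹ i v))) ∂ν
      ≤ ∫⋯∫⁻_S, (fun b => ENNReal.ofReal (potDensity W S (η + W i) 1 b) *
        (igHalf (η i) * ENNReal.ofReal √((Pi.single i 1 + peelDir W b S i : V → ℝ) v))) ∂ν := by
  rw [lmarginal_potDensity_insert hW hi hν (θ := 1) (fun _ => one_pos)
    (measurable_hmat_inv _ _ _).sqrt.ennreal_ofReal]
  refine lmarginal_mono fun b => ?_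
  simp only [Pi.one_apply, one_smul]
  refine ofReal_potDensity_mul_mono fun hP => ?_
  refine le_trans (le_of_eq ?_) (mul_le_mul_left (igHalf_anti hηi (peelSource_nonneg hW hP hη)) _)
  rw [igHalf, ← lintegral_mul_const' _ _ ENNReal.ofReal_ne_top]
  congr 1
  ext y
  by_cases hy : 0 < y
  · obtain ⟨hP', hs⟩ := hmat_update_posDef_insert hi hP y
    rw [hmat_insert_inv_apply hW hi hP' (by rw [hs]; exact hy.ne'), hs, peelDir_update hi,
      sqrt_div' _ hy.le, div_eq_inv_mul, ENNReal.ofReal_mul (igDensity_nonneg zero_le_one),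
      ENNReal.ofReal_mul (inv_nonneg.2 (sqrt_nonneg _)), mul_assoc]
  · simp [igDensity, hy]

/-- The weight of one step in the self-avoiding path expansion of the half moment. -/
noncomputable def stepWeight (x : ℝ) : ℝ≥0∞ := ENNReal.ofReal √x * igHalf x

lemma measurable_stepWeight : Measurable stepWeight :=
  measurable_id.sqrt.ennreal_ofReal.mul measurable_igHalf

/-- The self-avoiding path expansion, with general step weights `f`. -/
noncomputable def sawSum (f : V → V → ℝ≥0∞) : ℕ → Finset V → V → V → ℝ≥0∞
  | 0, _, _, _ => 0
  | n + 1, S, i, v => if i = v then 1 else ∑ j ∈ S.erase i, f i j * sawSum f n (S.erase i) j v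

lemma le_sqrt_sq (x : ℝ) : x ≤ √x ^ 2 := by
  rcases le_total 0 x with h | h
  · rw [sq_sqrt h]
  · exact h.trans (sq_nonneg _)

lemma sqrt_sum_le (s : Finset V) (f : V → ℝ) : √(∑ j ∈ s, f j) ≤ ∑ j ∈ s, √(f j) := by
  induction s using Finset.induction_on with
  | empty => simp
  | insert j s hj ih =>
    rw [Finset.sum_insert hj, Finset.sum_insert hj]
    refine (sqrt_le_iff.2 ⟨by positivity, ?_⟩ :
      √(f j + ∑ j ∈ s, f j) ≤ √(f j) + √(∑ j ∈ s, f j)).trans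
      (by gcongr)
    have h1 := le_sqrt_sq (f j)
    have h2 := le_sqrt_sq (∑ j ∈ s, f j)
    nlinarith [mul_nonneg (sqrt_nonneg (f j)) (sqrt_nonneg (∑ j ∈ s, f j))]

lemma lmarginal_potDensity_sqrt_le_sawSum (hW : IsWeight W) (n : ℕ) (hn : S.card ≤ n)
    (hν : ∀ j ∈ S, ν j = volume) (hi : i ∈ S) {η : V → ℝ} (hη : ∀ j, 0 ≤ η j) (hηi : 0 < η i)
    (v : V) (x : V → ℝ) :
    (∫⋯∫⁻_S, (fun b => ENNReal.ofReal (potDensity W S η 1 b) *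
        ENNReal.ofReal √((hmat W b S)⁻¹ i v)) ∂ν) x
      ≤ igHalf (η i) * sawSum (fun i j => stepWeight (W i j)) n S i v := by
  induction n generalizing S i η with
  | zero =>
    rw [Nat.le_zero, Finset.card_eq_zero] at hn
    simp [hn] at hi
  | succ n ih =>
    have hi' : i ∉ S.erase i := Finset.notMem_erase i S
    have hSi : insert i (S.erase i) = S := Finset.insert_erase hi
    have h := lmarginal_potDensity_sqrt_le (ν := ν) hW hi' (hν i hi) hη hηi v x
    rw [hSi] at h
    refine h.trans ?_
    have hη' : ∀ j, 0 ≤ (η + W i) j := fun j => add_nonneg (hη j) (hW.nonneg i j)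
    have hν' : ∀ j ∈ S.erase i, ν j = volume := fun j hj => hν j (Finset.mem_of_mem_erase hj)
    by_cases hiv : i = v
    · subst hiv
      have h1 := congrFun (lmarginal_potDensity (ν := ν) hW hν' hη' (θ := 1) fun _ => one_pos) x
      rw [lmarginal] at h1 ⊢
      rw [sawSum, if_pos rfl, ← Pi.one_apply (M := fun _ => ℝ≥0∞) x, ← h1]
      have hm := ((measurable_potDensity_right hW (S.erase i) (η + W i) 1).comp
        (measurable_updateFinset (δ := V) (X := fun _ : V => ℝ) (s := S.erase i) (x := x)))
      refine le_trans (lintegral_mono fun z => ?_) (lintegral_const_mul _ hm).le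
      rw [Function.comp_apply, mul_comm _ (ENNReal.ofReal (potDensity _ _ _ _ _))]
      refine ofReal_potDensity_mul_mono (W := W) (S := S.erase i) fun hP => le_of_eq ?_
      simp [peelDir_of_notMem hP hi']
    · rw [sawSum, if_neg hiv, Finset.mul_sum]
      calc _ ≤ (∫⋯∫⁻_S.erase i, (fun b => ∑ j ∈ S.erase i, igHalf (η i) *
              ENNReal.ofReal √(W i j) *
              (ENNReal.ofReal (potDensity W (S.erase i) (η + W i) 1 b) *
              ENNReal.ofReal √((hmat W b (S.erase i))⁻¹ j v))) ∂ν) x := by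
            refine lmarginal_mono (fun b => ?_) x
            have hz : (Pi.single i 1 + peelDir W b (S.erase i) i : V → ℝ) v
                = ∑ j ∈ S.erase i, W i j * (hmat W b (S.erase i))⁻¹ j v := by
              rw [← peelDir_apply hW]
              simp [Ne.symm hiv]
            have hs : ENNReal.ofReal √((Pi.single i 1 + peelDir W b (S.erase i) i : V → ℝ) v)
                ≤ ∑ j ∈ S.erase i, ENNReal.ofReal √(W i j) *
                  ENNReal.ofReal √((hmat W b (S.erase i))⁻¹ j v) := by
              rw [hz]
              refine (ENNReal.ofReal_le_ofReal (sqrt_sum_le _ _)).trans ?_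
              rw [ENNReal.ofReal_sum_of_nonneg fun _ _ => sqrt_nonneg _]
              refine Finset.sum_le_sum fun j _ => ?_
              rw [sqrt_mul (hW.nonneg i j), ENNReal.ofReal_mul (sqrt_nonneg _)]
            refine (mul_le_mul_right (mul_le_mul_right hs _) _).trans (le_of_eq ?_)
            rw [Finset.mul_sum, Finset.mul_sum]
            refine Finset.sum_congr rfl fun j _ => ?_
            ring
        _ = ∑ j ∈ S.erase i, igHalf (η i) * ENNReal.ofReal √(W i j) *
              (∫⋯∫⁻_S.erase i, (fun b => ENNReal.ofReal (potDensity W (S.erase i) (η + W i) 1 b) *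
              ENNReal.ofReal √((hmat W b (S.erase i))⁻¹ j v)) ∂ν) x := by
            have hm : ∀ j, Measurable fun b =>
                ENNReal.ofReal (potDensity W (S.erase i) (η + W i) 1 b) *
                ENNReal.ofReal √((hmat W b (S.erase i))⁻¹ j v) := fun j =>
              (measurable_potDensity_right hW _ _ _).mul
                (measurable_hmat_inv _ _ _).sqrt.ennreal_ofReal
            have hm' := fun j => (hm j).comp
              (measurable_updateFinset (δ := V) (X := fun _ : V => ℝ) (s := S.erase i) (x := x))
            simp only [lmarginal]
            rw [lintegral_finsetSum]
            · exact Finset.sum_congr rfl fun j _ => lintegral_const_mul _ (hm' j)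
            · exact fun j _ => (hm' j).const_mul _
        _ ≤ _ := by
            refine Finset.sum_le_sum fun j hj => ?_
            rcases (hW.nonneg i j).eq_or_lt with h0 | h0
            · simp [← h0]
            · rw [stepWeight, mul_assoc, mul_assoc]
              refine mul_le_mul_right (mul_le_mul_right ?_ _) _
              have hcard : (S.erase i).card ≤ n := by
                rw [Finset.card_erase_of_mem hi]
                omega
              refine (ih hcard hν' hj hη' (add_pos_of_nonneg_of_pos (hη j) h0)).trans ?_
              exact mul_le_mul_left (igHalf_anti h0 (le_add_of_nonneg_left (hη j))) _

end ERRWZ2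

namespace ERRWZ2

open Matrix Set Real Function

variable {V : Type*} [Fintype V] [DecidableEq V]

/-- The harmonic field with value `1` at the root `o`. -/
noncomputable def rootField (W : V → V → ℝ) (o : V) (b : V → ℝ) (v : V) : ℝ :=
  if v = o then 1 else grn W b (Finset.univ.erase o) (W o) v

/-- The random potential, completed at the root so that `rootField` is harmonic everywhere. -/
noncomputable def rootPot (W : V → V → ℝ) (o : V) (b : V → ℝ) (v : V) : ℝ :=
  if v = o then ∑ j, W o j * rootField W o b j else b v

/-- Lebesgue measure at every vertex except the root. -/
noncomputable def rootMeasure (o : V) (i : V) : Measure ℝ :=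
  if i = o then Measure.dirac 0 else volume

instance (o i : V) : SigmaFinite (rootMeasure o i) := by
  unfold rootMeasure
  split_ifs <;> infer_instance

lemma rootMeasure_of_mem (o : V) {i : V} (hi : i ∈ Finset.univ.erase o) :
    rootMeasure o i = volume := if_neg (Finset.ne_of_mem_erase hi)

lemma lintegral_rootMeasure (o : V) {f : (V → ℝ) → ℝ≥0∞} (hf : Measurable f) :
    ∫⁻ b, f b ∂(Measure.pi (rootMeasure o))
      = (∫⋯∫⁻_Finset.univ.erase o, f ∂rootMeasure o) 0 := by
  rw [lintegral_eq_lmarginal_univ (0 : V → ℝ), ← Finset.insert_erase (Finset.mem_univ o),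
    lmarginal_insert _ hf (Finset.notMem_erase o _), rootMeasure, if_pos rfl, lintegral_dirac',
    Finset.erase_insert (Finset.notMem_erase o _)]
  · congr 1
    exact update_eq_self (f := (0 : V → ℝ)) o
  · exact (hf.lmarginal _).comp (measurable_update _)

section

variable {W : V → V → ℝ} {b : V → ℝ} {o : V}

lemma rootField_self : rootField W o b o = 1 := if_pos rfl

lemma rootField_of_ne {v : V} (h : v ≠ o) :
    rootField W o b v = grn W b (Finset.univ.erase o) (W o) v := if_neg h

lemma rootPot_of_ne {v : V} (h : v ≠ o) : rootPot W o b v = b v := if_neg h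

lemma grn_nonneg (hW : IsWeight W) {S : Finset V} (hP : (hmat W b S).PosDef) {η : V → ℝ}
    (hη : ∀ j, 0 ≤ η j) (v : V) : 0 ≤ grn W b S η v :=
  Finset.sum_nonneg fun k _ => mul_nonneg (hmat_inv_nonneg hW hP v k) (restr_nonneg hη k)

lemma rootField_nonneg (hW : IsWeight W) (hP : (hmat W b (Finset.univ.erase o)).PosDef) (v : V) :
    0 ≤ rootField W o b v := by
  unfold rootField
  split_ifs
  exacts [zero_le_one, grn_nonneg hW hP (hW.nonneg o) v]

lemma hmat_mulVec_of_mem {S : Finset V} {i : V} (hi : i ∈ S) (x : V → ℝ) :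
    (hmat W b S *ᵥ x) i = b i * x i - ∑ j ∈ S, W i j * x j := by
  simp only [hmat, mulVec, dotProduct, of_apply, hi, true_and]
  have h : ∀ j, (if j ∈ S then (if i = j then b i else 0) - W i j else if i = j then 1 else 0) * x j
      = (if i = j then b i * x i else 0) - if j ∈ S then W i j * x j else 0 := fun j => by
    by_cases hj : j ∈ S
    · by_cases hij : i = j
      · subst hij
        simp [hi]
        ring
      · simp [hj, hij]
    · have hij : i ≠ j := fun h => hj (h ▸ hi)
      simp [hj, hij]
  simp_rw [h]
  rw [Finset.sum_sub_distrib, Finset.sum_ite_eq, if_pos (Finset.mem_univ i), ← Finset.sum_filter,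
    Finset.filter_mem_eq_inter, Finset.univ_inter]

lemma sum_eq_root_add (f : V → ℝ) (o : V) :
    ∑ j, f j = f o + ∑ j ∈ Finset.univ.erase o, f j :=
  (Finset.add_sum_erase _ _ (Finset.mem_univ o)).symm

lemma rootPot_mul_rootField (hW : IsWeight W) (hP : (hmat W b (Finset.univ.erase o)).PosDef)
    (i : V) : rootPot W o b i * rootField W o b i = ∑ j, W i j * rootField W o b j := by
  by_cases hi : i = o
  · subst hi
    rw [rootPot, if_pos rfl, rootField_self, mul_one]
  · have hiS : i ∈ Finset.univ.erase o := by simp [hi]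
    have h := congrFun (hmat_mulVec_inv hP (restr (Finset.univ.erase o) (W o))) i
    rw [← grn, hmat_mulVec_of_mem hiS, restr_apply_of_mem hiS] at h
    have hs : ∑ j ∈ Finset.univ.erase o, W i j * rootField W o b j
        = ∑ j ∈ Finset.univ.erase o, W i j * grn W b (Finset.univ.erase o) (W o) j :=
      Finset.sum_congr rfl fun j hj => by rw [rootField_of_ne (Finset.ne_of_mem_erase hj)]
    rw [rootPot_of_ne hi, sum_eq_root_add _ o, rootField_self, rootField_of_ne hi, mul_one,
      hs, hW.symm i o, ← h]
    ring

lemma rootField_pos (hW : IsWeight W) (hP : (hmat W b (Finset.univ.erase o)).PosDef) {v : V}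
    (hv : Relation.ReflTransGen (fun i j => 0 < W i j) v o) : 0 < rootField W o b v := by
  induction hv using Relation.ReflTransGen.head_induction_on with
  | refl => simp [rootField_self]
  | head h _ ih =>
    rename_i i j _
    refine lt_of_le_of_ne (rootField_nonneg hW hP i) fun h0 => ?_
    have h1 := rootPot_mul_rootField hW hP i
    rw [← h0, mul_zero] at h1
    have h2 := (Finset.sum_eq_zero_iff_of_nonneg fun k _ =>
      mul_nonneg (hW.nonneg i k) (rootField_nonneg hW hP k)).1 h1.symm j (Finset.mem_univ j)
    exact (mul_pos h ih).ne' h2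

lemma rootPot_pos (hW : IsWeight W) (hP : (hmat W b (Finset.univ.erase o)).PosDef)
    (hc : ∀ v, Relation.ReflTransGen (fun i j => 0 < W i j) v o) {i j : V} (hij : 0 < W i j) :
    0 < rootPot W o b i := by
  have h1 := rootPot_mul_rootField hW hP i
  have h2 : 0 < ∑ j, W i j * rootField W o b j :=
    Finset.sum_pos' (fun k _ => mul_nonneg (hW.nonneg i k) (rootField_nonneg hW hP k))
      ⟨j, Finset.mem_univ j, mul_pos hij (rootField_pos hW hP (hc j))⟩
  rw [← h1] at h2
  exact pos_of_mul_pos_left h2 (rootField_nonneg hW hP i)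

lemma restr_dotProduct (S : Finset V) (f g : V → ℝ) : restr S f ⬝ᵥ g = ∑ i ∈ S, f i * g i := by
  simp [dotProduct, restr, ite_mul]

lemma grn_smul (S : Finset V) (c : ℝ) (η : V → ℝ) : grn W b S (c • η) = c • grn W b S η := by
  rw [grn, restr_smul, mulVec_smul, grn]

lemma potDensity_exponent (hW : IsWeight W) (θ : V → ℝ) :
    -(restr (Finset.univ.erase o) θ ⬝ᵥ hmat W b (Finset.univ.erase o) *ᵥ
        restr (Finset.univ.erase o) θ) / 2
      - (restr (Finset.univ.erase o) (θ o • W o) ⬝ᵥ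
          grn W b (Finset.univ.erase o) (θ o • W o)) / 2
      + restr (Finset.univ.erase o) (θ o • W o) ⬝ᵥ restr (Finset.univ.erase o) θ
    = (∑ i, ∑ j, θ i * θ j * W i j) / 2 - (∑ i, θ i ^ 2 * rootPot W o b i) / 2 := by
  set S := Finset.univ.erase o with hS
  have h1 : restr S θ ⬝ᵥ hmat W b S *ᵥ restr S θ
      = ∑ i ∈ S, (θ i ^ 2 * b i) - ∑ i ∈ S, ∑ j ∈ S, θ i * θ j * W i j := by
    rw [restr_dotProduct, ← Finset.sum_sub_distrib]
    refine Finset.sum_congr rfl fun i hi => ?_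
    rw [hmat_mulVec_of_mem hi, restr_apply_of_mem hi, mul_sub, Finset.mul_sum]
    congr 1
    · ring
    · refine Finset.sum_congr rfl fun j hj => ?_
      rw [restr_apply_of_mem hj]
      ring
  have h2 : restr S (θ o • W o) ⬝ᵥ grn W b S (θ o • W o)
      = θ o ^ 2 * ∑ j ∈ S, W o j * rootField W o b j := by
    rw [grn_smul, restr_dotProduct, Finset.mul_sum]
    refine Finset.sum_congr rfl fun j hj => ?_
    rw [rootField_of_ne (Finset.ne_of_mem_erase hj)]
    simp
    ring
  have h3 : restr S (θ o • W o) ⬝ᵥ restr S θ = ∑ j ∈ S, θ o * θ j * W o j := by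
    rw [restr_dotProduct]
    refine Finset.sum_congr rfl fun j hj => ?_
    rw [restr_apply_of_mem hj]
    simp
    ring
  have h4 : ∑ i, ∑ j, θ i * θ j * W i j
      = 2 * (∑ j ∈ S, θ o * θ j * W o j) + ∑ i ∈ S, ∑ j ∈ S, θ i * θ j * W i j := by
    rw [sum_eq_root_add _ o, sum_eq_root_add (fun j => θ o * θ j * W o j) o, hW.diag]
    have : ∀ i, ∑ j, θ i * θ j * W i j
        = θ o * θ i * W o i + ∑ j ∈ S, θ i * θ j * W i j := fun i => by
      rw [sum_eq_root_add _ o, hW.symm i o, mul_comm (θ i) (θ o)]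
    rw [Finset.sum_congr rfl fun i _ => this i, Finset.sum_add_distrib]
    ring
  have h5 : ∑ i, θ i ^ 2 * rootPot W o b i
      = θ o ^ 2 * (∑ j ∈ S, W o j * rootField W o b j) + ∑ i ∈ S, (θ i ^ 2 * b i) := by
    rw [sum_eq_root_add _ o, Finset.sum_congr rfl fun i hi => by
      rw [rootPot_of_ne (Finset.ne_of_mem_erase hi)], rootPot, if_pos rfl,
      sum_eq_root_add (fun j => W o j * rootField W o b j) o, hW.diag, zero_mul, zero_add]
  rw [h1, h2, h3, h4, h5]
  ring

lemma potDensity_tilt (hW : IsWeight W) {t : V → ℝ} (ht : ∀ i, 0 < t i) :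
    potDensity W (Finset.univ.erase o) (√(t o) • W o) (fun i => √(t i)) b
        * exp ((∑ i, ∑ j, W i j * (1 - √(t i) * √(t j))) / 2)
      = potDensity W (Finset.univ.erase o) (W o) 1 b * (∏ i ∈ Finset.univ.erase o, √(t i))
        * exp (-(∑ i, (t i - 1) * rootPot W o b i) / 2) := by
  have h1 := potDensity_exponent (b := b) (o := o) hW (fun i => √(t i))
  have h2 := potDensity_exponent (b := b) (o := o) hW 1
  simp only [Pi.one_apply, one_smul] at h2
  rw [potDensity, potDensity, h1, h2]
  simp only [Pi.one_apply, Finset.prod_const_one, mul_one]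
  have e : (∑ i, ∑ j, √(t i) * √(t j) * W i j) / 2 - (∑ i, √(t i) ^ 2 * rootPot W o b i) / 2
      + (∑ i, ∑ j, W i j * (1 - √(t i) * √(t j))) / 2
      = (∑ i : V, ∑ j, W i j) / 2 - (∑ i, 1 ^ 2 * rootPot W o b i) / 2
      + -(∑ i, (t i - 1) * rootPot W o b i) / 2 := by
    simp only [sub_mul, Finset.sum_sub_distrib, one_pow, one_mul,
      sq_sqrt (ht _).le, mul_comm (W _ _)]
    ring
  rw [mul_assoc, ← exp_add, e, exp_add]
  simp only [one_pow, one_mul]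
  ring

end

end ERRWZ2

namespace ERRWZ2

open Matrix Set Real Function

variable {V : Type*} [Fintype V] [DecidableEq V]
variable {W : V → V → ℝ} {b : V → ℝ} {o : V}

lemma peelSource_pos (hW : IsWeight W)
    (hc : ∀ v, Relation.ReflTransGen (fun i j => 0 < W i j) v o) {c : ℝ} (hc0 : 0 < c) {i : V}
    (hi : i ≠ o) (hP : (hmat W b ((Finset.univ.erase o).erase i)).PosDef) :
    0 < peelSource W b ((Finset.univ.erase o).erase i) i (c • W o) := by
  have hi' := Finset.notMem_erase i (Finset.univ.erase o)
  have hiS : insert i ((Finset.univ.erase o).erase i) = Finset.univ.erase o :=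
    Finset.insert_erase (by simp [hi])
  obtain ⟨hP', hs⟩ := hmat_update_posDef_insert hi' hP 1
  have hPS := (hmat_posDef_insert hW hi').2 ⟨hP', by rw [hs]; exact one_pos⟩
  have h := grn_insert_self hW hi' hP' (by rw [hs]; exact one_ne_zero) (c • W o)
  rw [hs, div_one, peelSource_update hi', hiS, grn_smul, Pi.smul_apply, ← rootField_of_ne hi] at h
  rw [hiS] at hPS
  rw [← h]
  exact mul_pos hc0 (rootField_pos hW hPS (hc i))

lemma lmarginal_tilted_rootField (hW : IsWeight W)
    (hc : ∀ v, Relation.ReflTransGen (fun i j => 0 < W i j) v o) {t : V → ℝ} (ht : ∀ i, 0 < t i)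
    (v : V) :
    ∫⋯∫⁻_Finset.univ.erase o, (fun b =>
      ENNReal.ofReal (potDensity W (Finset.univ.erase o) (√(t o) • W o) (fun i => √(t i)) b) *
        ENNReal.ofReal (√(t o) * rootField W o b v)) ∂rootMeasure o
      = fun _ => ENNReal.ofReal √(t v) := by
  have hη : ∀ j, 0 ≤ (√(t o) • W o) j := fun j => mul_nonneg (sqrt_nonneg _) (hW.nonneg o j)
  have hθ : ∀ j, 0 < √(t j) := fun j => sqrt_pos.2 (ht j)
  by_cases hv : v = o
  · subst hv
    have h := lmarginal_potDensity (ν := rootMeasure v) hW (fun i hi => rootMeasure_of_mem v hi)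
      hη hθ
    ext x
    have h' := congrFun h x
    rw [lmarginal] at h' ⊢
    simp only [rootField_self, mul_one]
    rw [lintegral_mul_const' _ _ ENNReal.ofReal_ne_top, h', Pi.one_apply, one_mul]
  · have hi' := Finset.notMem_erase v (Finset.univ.erase o)
    have hiS : insert v ((Finset.univ.erase o).erase v) = Finset.univ.erase o :=
      Finset.insert_erase (by simp [hv])
    have h := lmarginal_potDensity_grn (ν := rootMeasure o) hW hi'
      (fun j hj => rootMeasure_of_mem o (hiS ▸ hj)) hη hθ
      fun b hP => peelSource_pos hW hc (hθ o) hv hP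
    rw [hiS] at h
    simpa only [rootField_of_ne hv, grn_smul, Pi.smul_apply, smul_eq_mul] using h

lemma measurable_rootField {α : Type*} [MeasurableSpace α] {W : α → V → V → ℝ} {b : α → V → ℝ}
    (hW : Measurable W) (hb : Measurable b) (v : V) :
    Measurable fun x => rootField (W x) o (b x) v := by
  unfold rootField
  split_ifs
  · exact measurable_const
  · exact measurable_pi_iff.1 (measurable_grn hW hb _ (measurable_pi_iff.1 hW o)) v

lemma measurable_rootPot {α : Type*} [MeasurableSpace α] {W : α → V → V → ℝ} {b : α → V → ℝ}
    (hW : Measurable W) (hb : Measurable b) (v : V) :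
    Measurable fun x => rootPot (W x) o (b x) v := by
  unfold rootPot
  split_ifs
  · exact Finset.measurable_fun_sum _ fun j _ =>
      (measurable_pi_iff.1 (measurable_pi_iff.1 hW o) j).mul (measurable_rootField hW hb j)
  · exact measurable_pi_iff.1 hb v

lemma lintegral_rootField (hW : IsWeight W)
    (hc : ∀ v, Relation.ReflTransGen (fun i j => 0 < W i j) v o) {t : V → ℝ} (ht : ∀ i, 0 < t i)
    (v : V) :
    ∫⁻ b, ENNReal.ofReal (potDensity W (Finset.univ.erase o) (W o) 1 b) *
      (ENNReal.ofReal (rootField W o b v) *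
        ENNReal.ofReal (exp (-(∑ i, (t i - 1) * rootPot W o b i) / 2)))
        ∂(Measure.pi (rootMeasure o))
      = ENNReal.ofReal (√(t v) * (∏ i, √(t i))⁻¹ *
          exp ((∑ i, ∑ j, W i j * (1 - √(t i) * √(t j))) / 2)) := by
  set S := Finset.univ.erase o with hS
  set E := exp ((∑ i, ∑ j, W i j * (1 - √(t i) * √(t j))) / 2) with hE
  have hθ : ∀ j, 0 < √(t j) := fun j => sqrt_pos.2 (ht j)
  have hp : 0 < ∏ i, √(t i) := Finset.prod_pos fun i _ => hθ i
  have hps : ∏ i, √(t i) = √(t o) * ∏ i ∈ S, √(t i) :=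
    (Finset.mul_prod_erase _ _ (Finset.mem_univ o)).symm
  have hpt : ∀ b, ENNReal.ofReal (potDensity W S (W o) 1 b) *
      (ENNReal.ofReal (rootField W o b v) *
        ENNReal.ofReal (exp (-(∑ i, (t i - 1) * rootPot W o b i) / 2)))
      = ENNReal.ofReal ((∏ i, √(t i))⁻¹ * E) *
        (ENNReal.ofReal (potDensity W S (√(t o) • W o) (fun i => √(t i)) b) *
          ENNReal.ofReal (√(t o) * rootField W o b v)) := fun b => by
    have h1 : 0 ≤ potDensity W S (W o) 1 b := potDensity_nonneg fun _ => one_pos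
    have h2 : 0 ≤ potDensity W S (√(t o) • W o) (fun i => √(t i)) b := potDensity_nonneg hθ
    rw [← mul_assoc, mul_right_comm, ← ENNReal.ofReal_mul h1, ENNReal.ofReal_mul (hθ o).le,
      ← mul_assoc, ← mul_assoc, ← ENNReal.ofReal_mul (by positivity),
      ← ENNReal.ofReal_mul (by positivity), ← ENNReal.ofReal_mul (by positivity),
      ← ENNReal.ofReal_mul (by positivity)]
    congr 1
    have h := potDensity_tilt (b := b) (o := o) hW ht
    rw [← hS, ← hE] at h
    have hps' : (∏ i ∈ S, √(t i)) ≠ 0 := (Finset.prod_pos fun i _ => hθ i).ne'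
    rw [hps]
    have := (hθ o).ne'
    generalize exp (-(∑ i, (t i - 1) * rootPot W o b i) / 2) = X at h ⊢
    field_simp
    linear_combination (-rootField W o b v) * h
  simp_rw [hpt]
  have hm : Measurable fun b => ENNReal.ofReal (potDensity W S (√(t o) • W o) (fun i => √(t i)) b) *
      ENNReal.ofReal (√(t o) * rootField W o b v) :=
    (measurable_potDensity_right hW _ _ _).mul
      ((measurable_rootField (W := fun _ => W) measurable_const measurable_id v).const_mul
        _).ennreal_ofReal
  rw [lintegral_const_mul' _ _ ENNReal.ofReal_ne_top, lintegral_rootMeasure o hm, ← hS,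
    lmarginal_tilted_rootField hW hc ht, ← ENNReal.ofReal_mul (by positivity)]
  congr 1
  ring

end ERRWZ2

namespace ERRWZ2

open Set Real Function

section Product

variable {ι : Type*} [Fintype ι] [DecidableEq ι] {μ : ι → Measure ℝ}
  [∀ i, IsProbabilityMeasure (μ i)]

lemma lintegral_pi_mul {e : ι} {f : ℝ → ℝ≥0∞} (hf : Measurable f) {F : (ι → ℝ) → ℝ≥0∞}
    (hF : Measurable F) (hFe : ∀ w y, F (update w e y) = F w) :
    ∫⁻ w, f (w e) * F w ∂(Measure.pi μ) = (∫⁻ y, f y ∂μ e) * ∫⁻ w, F w ∂(Measure.pi μ) := by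
  have hm : Measurable fun w : ι → ℝ => f (w e) * F w := (hf.comp (measurable_pi_apply e)).mul hF
  have key : ∀ g : (ι → ℝ) → ℝ≥0∞, Measurable g → ∫⁻ w, g w ∂(Measure.pi μ)
      = (∫⋯∫⁻_Finset.univ.erase e, (fun w => ∫⁻ y, g (update w e y) ∂μ e) ∂μ) 0 := fun g hg => by
    rw [lintegral_eq_lmarginal_univ (0 : ι → ℝ), ← Finset.insert_erase (Finset.mem_univ e),
      lmarginal_insert' _ hg (Finset.notMem_erase e _),
      Finset.erase_insert (Finset.notMem_erase e _)]
  rw [key _ hm, key _ hF]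
  simp only [hFe, update_self, lintegral_const, measure_univ, mul_one]
  simp_rw [lintegral_mul_const _ hf]
  rw [lmarginal, lmarginal, lintegral_const_mul]
  exact hF.comp measurable_updateFinset

lemma lintegral_pi_prod (s : Finset ι) {f : ι → ℝ → ℝ≥0∞} (hf : ∀ i, Measurable (f i)) :
    ∫⁻ w, ∏ e ∈ s, f e (w e) ∂(Measure.pi μ) = ∏ e ∈ s, ∫⁻ y, f e y ∂μ e := by
  induction s using Finset.induction_on with
  | empty => simp
  | insert e s he ih =>
    rw [Finset.prod_insert he, ← ih]
    simp_rw [Finset.prod_insert he]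
    refine lintegral_pi_mul (hf e) (Finset.measurable_fun_prod _ fun i _ =>
      (hf i).comp (measurable_pi_apply i)) fun w y => ?_
    refine Finset.prod_congr rfl fun i hi => ?_
    rw [update_of_ne (ne_of_mem_of_not_mem hi he)]

end Product

lemma lintegral_gammaMeasure {a : ℝ} {f : ℝ → ℝ≥0∞} (hf : Measurable f) :
    ∫⁻ x, f x ∂(ProbabilityTheory.gammaMeasure a 1)
      = ∫⁻ x in Ioi 0, ENNReal.ofReal ((Gamma a)⁻¹ * x ^ (a - 1) * exp (-x)) * f x := by
  have hm : Measurable (ProbabilityTheory.gammaPDF a 1) :=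
    (ProbabilityTheory.measurable_gammaPDFReal a 1).ennreal_ofReal
  rw [ProbabilityTheory.gammaMeasure, lintegral_withDensity_eq_lintegral_mul _ hm hf,
    ← lintegral_add_compl _ (measurableSet_Ioi (a := (0 : ℝ)))]
  rw [compl_Ioi, setLIntegral_congr (Iio_ae_eq_Iic (a := (0 : ℝ))).symm]
  rw [setLIntegral_congr_fun measurableSet_Iio (g := fun _ => 0) fun x hx => ?_, lintegral_zero,
    add_zero]
  · refine setLIntegral_congr_fun measurableSet_Ioi fun x hx => ?_
    simp [ProbabilityTheory.gammaPDF_of_nonneg (le_of_lt hx)]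
  · simp [ProbabilityTheory.gammaPDF_of_neg hx]

lemma ae_pos_gammaMeasure (a : ℝ) : ∀ᵐ x ∂(ProbabilityTheory.gammaMeasure a 1), 0 < x := by
  rw [ae_iff, ProbabilityTheory.gammaMeasure, withDensity_apply _ (by measurability)]
  have h : {x : ℝ | ¬ 0 < x} = Iic 0 := by ext; simp
  rw [h, setLIntegral_congr (Iio_ae_eq_Iic (a := (0 : ℝ))).symm,
    ProbabilityTheory.lintegral_gammaPDF_of_nonpos le_rfl]

lemma lintegral_gammaMeasure_tilt {a : ℝ} (ha : 0 < a) (k : ℕ) {g : ℝ} (hg : 0 < g) :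
    ∫⁻ x, ENNReal.ofReal (|x| ^ k * exp (|x| * (1 - g))) ∂(ProbabilityTheory.gammaMeasure a 1)
      = ENNReal.ofReal (Gamma (a + k) / Gamma a * g ^ (-(a + k))) := by
  have hak : 0 < a + k := by positivity
  rw [lintegral_gammaMeasure (by fun_prop)]
  have h1 : ∀ x ∈ Ioi (0 : ℝ), ENNReal.ofReal ((Gamma a)⁻¹ * x ^ (a - 1) * exp (-x)) *
      ENNReal.ofReal (|x| ^ k * exp (|x| * (1 - g)))
      = ENNReal.ofReal ((Gamma a)⁻¹ * (x ^ (a + k - 1) * exp (-(g * x)))) := fun x hx => by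
    have hx' : 0 < x := hx
    have hG := Gamma_pos_of_pos ha
    rw [← ENNReal.ofReal_mul (by positivity), abs_of_pos hx']
    congr 1
    have e1 : exp (-(g * x)) = exp (-x) * exp (x * (1 - g)) := by
      rw [← exp_add]
      congr 1
      ring
    have e2 : x ^ (a + k - 1) = x ^ (a - 1) * x ^ k := by
      rw [← rpow_natCast, ← rpow_add hx']
      congr 1
      ring
    rw [e1, e2]
    ring
  rw [setLIntegral_congr_fun measurableSet_Ioi h1]
  have hG := Gamma_pos_of_pos ha
  have hf : IntegrableOn (fun x => (Gamma a)⁻¹ * (x ^ (a + k - 1) * exp (-(g * x)))) (Ioi 0) := by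
    refine Integrable.const_mul ?_ _
    have := integrableOn_rpow_mul_exp_neg_mul_rpow (s := a + k - 1) (p := 1) (b := g)
      (by linarith) one_pos hg
    simpa [IntegrableOn] using this
  rw [← ofReal_integral_eq_lintegral_ofReal hf, integral_const_mul,
    integral_rpow_mul_exp_neg_mul_Ioi hak hg]
  · congr 1
    rw [rpow_neg hg.le, one_div, inv_rpow hg.le]
    ring
  · filter_upwards [ae_restrict_mem measurableSet_Ioi] with x hx
    have hx' : 0 < x := hx
    positivity

section Graph

variable {V : Type*} [Fintype V] [DecidableEq V] (G : SimpleGraph V)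

lemma sum_adj_eq_sum_edges (φ : V → V → ℝ) :
    ∑ i, ∑ j, (if G.Adj i j then φ i j else 0)
      = ∑ e ∈ G.edgeFinset, Sym2.lift ⟨fun i j => φ i j + φ j i, fun _ _ => add_comm _ _⟩ e := by
  rw [← Finset.sum_product', Finset.univ_product_univ, ← Finset.sum_filter]
  rw [← Finset.sum_fiberwise_of_maps_to (t := G.edgeFinset) (g := fun p : V × V => s(p.1, p.2))]
  · refine Finset.sum_congr rfl fun e he => ?_
    induction e with | h x y =>
    rw [SimpleGraph.mem_edgeFinset, SimpleGraph.mem_edgeSet] at he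
    have h : (Finset.univ.filter fun p : V × V => G.Adj p.1 p.2).filter
        (fun p => s(p.1, p.2) = s(x, y))
        = {(x, y), (y, x)} := by
      ext ⟨p, q⟩
      simp only [Finset.mem_filter, Finset.mem_univ, true_and, Finset.mem_insert,
        Finset.mem_singleton, Sym2.eq_iff, Prod.mk.injEq]
      constructor
      · exact fun h => h.2
      · rintro (⟨rfl, rfl⟩ | ⟨rfl, rfl⟩)
        exacts [⟨he, by simp⟩, ⟨he.symm, by simp⟩]
    rw [h, Finset.sum_pair (by simp [he.ne])]
    simp
  · rintro ⟨i, j⟩ h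
    simpa using h

end Graph

end ERRWZ2

namespace ERRWZ2

open Set Real Function

variable {V : Type*} [Fintype V] [DecidableEq V] (G : SimpleGraph V)

/-- The weight matrix of a graph with edge weights `|w|`. -/
noncomputable def edgeW (w : Sym2 V → ℝ) (i j : V) : ℝ := if G.Adj i j then |w s(i, j)| else 0

/-- The sum of an edge function over the edges at a vertex. -/
noncomputable def wdeg (x : Sym2 V → ℝ) (i : V) : ℝ := ∑ j, if G.Adj i j then x s(i, j) else 0

/-- Independent standard gamma edge weights. -/
noncomputable def weightMeasure (a : ℝ) : Measure (Sym2 V → ℝ) :=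
  Measure.pi fun _ => ProbabilityTheory.gammaMeasure a 1

/-- The law of the random environment: edge weights and potential. -/
noncomputable def env (o : V) (a : ℝ) : Measure ((Sym2 V → ℝ) × (V → ℝ)) :=
  ((weightMeasure a).prod (Measure.pi (rootMeasure o))).withDensity fun p =>
    ENNReal.ofReal (potDensity (edgeW G p.1) (Finset.univ.erase o) (edgeW G p.1 o) 1 p.2)

lemma isWeight_edgeW (w : Sym2 V → ℝ) : IsWeight (edgeW G w) where
  symm i j := by simp only [edgeW, G.adj_comm i j, Sym2.eq_swap (a := i)]
  diag i := by simp [edgeW]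
  nonneg i j := by
    unfold edgeW
    split_ifs <;> positivity

lemma measurable_edgeW : Measurable (edgeW G) := by
  refine measurable_pi_iff.2 fun i => measurable_pi_iff.2 fun j => ?_
  unfold edgeW
  split_ifs
  · exact (measurable_pi_apply (s(i, j) : Sym2 V)).abs
  · exact measurable_const

lemma isProbabilityMeasure_weightMeasure {a : ℝ} (ha : 0 < a) :
    IsProbabilityMeasure (weightMeasure a : Measure (Sym2 V → ℝ)) := by
  have := ProbabilityTheory.isProbabilityMeasure_gammaMeasure ha one_pos
  unfold weightMeasure
  infer_instance

lemma measurable_env_density (o : V) : Measurable fun p : (Sym2 V → ℝ) × (V → ℝ) =>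
    ENNReal.ofReal (potDensity (edgeW G p.1) (Finset.univ.erase o) (edgeW G p.1 o) 1 p.2) := by
  have h : Measurable fun p : (Sym2 V → ℝ) × (V → ℝ) => edgeW G p.1 :=
    (measurable_edgeW G).comp measurable_fst
  exact (measurable_potDensity h measurable_snd (fun p => isWeight_edgeW G p.1) _
    (measurable_pi_iff.1 h o) 1).ennreal_ofReal

lemma lintegral_env (o : V) (a : ℝ) {F : (Sym2 V → ℝ) × (V → ℝ) → ℝ≥0∞} (hF : Measurable F) :
    ∫⁻ p, F p ∂(env G o a) = ∫⁻ w, ∫⁻ b, ENNReal.ofReal (potDensity (edgeW G w)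
        (Finset.univ.erase o) (edgeW G w o) 1 b) * F (w, b)
      ∂(Measure.pi (rootMeasure o)) ∂(weightMeasure a) := by
  rw [env, lintegral_withDensity_eq_lintegral_mul _ (measurable_env_density G o) hF,
    lintegral_prod _ ((measurable_env_density G o).mul hF).aemeasurable]
  rfl

lemma ae_weightMeasure_pos {a : ℝ} (ha : 0 < a) :
    ∀ᵐ w ∂(weightMeasure a : Measure (Sym2 V → ℝ)), ∀ e, 0 < w e := by
  have := ProbabilityTheory.isProbabilityMeasure_gammaMeasure ha one_pos
  rw [ae_all_iff]
  exact fun e => (Measure.quasiMeasurePreserving_eval _ e).ae (ae_pos_gammaMeasure a)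

lemma edgeW_pos {w : Sym2 V → ℝ} (hw : ∀ e, 0 < w e) {i j : V} (h : G.Adj i j) :
    0 < edgeW G w i j := by
  rw [edgeW, if_pos h]
  exact abs_pos.2 (hw _).ne'

variable {G}

lemma reflTransGen_edgeW (hG : G.Connected) {w : Sym2 V → ℝ} (hw : ∀ e, 0 < w e) (v o : V) :
    Relation.ReflTransGen (fun i j => 0 < edgeW G w i j) v o := by
  have h := (SimpleGraph.reachable_iff_reflTransGen v o).1 (hG.preconnected v o)
  exact Relation.ReflTransGen.mono (fun i j hij => edgeW_pos G hw hij) _ _ h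

variable (G)

/-- The geometric mean of a vertex function over an edge. -/
noncomputable def edgeGeom (t : V → ℝ) : Sym2 V → ℝ :=
  Sym2.lift ⟨fun i j => √(t i) * √(t j), fun _ _ => mul_comm _ _⟩

lemma edgeGeom_pos {t : V → ℝ} (ht : ∀ i, 0 < t i) (e : Sym2 V) : 0 < edgeGeom t e := by
  induction e with | h x y =>
  exact mul_pos (sqrt_pos.2 (ht x)) (sqrt_pos.2 (ht y))

lemma sum_edgeW (w : Sym2 V → ℝ) (t : V → ℝ) :
    (∑ i, ∑ j, edgeW G w i j * (1 - √(t i) * √(t j))) / 2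
      = ∑ e ∈ G.edgeFinset, |w e| * (1 - edgeGeom t e) := by
  have h := sum_adj_eq_sum_edges G fun i j => |w s(i, j)| * (1 - √(t i) * √(t j)) / 2
  rw [Finset.sum_div]
  simp_rw [Finset.sum_div]
  have h1 : ∀ i j, edgeW G w i j * (1 - √(t i) * √(t j)) / 2
      = if G.Adj i j then |w s(i, j)| * (1 - √(t i) * √(t j)) / 2 else 0 := fun i j => by
    unfold edgeW
    split_ifs <;> simp
  simp_rw [h1]
  rw [h]
  refine Finset.sum_congr rfl fun e _ => ?_
  induction e with | h x y =>
  simp only [Sym2.lift_mk, edgeGeom, Sym2.eq_swap (a := y), mul_comm (√(t y))]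
  ring

lemma prod_edgeGeom {t : V → ℝ} (ht : ∀ i, 0 < t i) (x : Sym2 V → ℝ) :
    ∏ e ∈ G.edgeFinset, edgeGeom t e ^ (-x e) = ∏ i, t i ^ (-(wdeg G x i) / 2) := by
  have h := sum_adj_eq_sum_edges G fun i j => log (t i) * (-x s(i, j) / 2)
  simp only [rpow_def_of_pos (edgeGeom_pos ht _), rpow_def_of_pos (ht _), ← exp_sum]
  congr 1
  have h1 : ∀ i, log (t i) * (-(wdeg G x i) / 2)
      = ∑ j, if G.Adj i j then log (t i) * (-x s(i, j) / 2) else 0 := fun i => by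
    rw [wdeg, ← Finset.sum_neg_distrib, Finset.sum_div, Finset.mul_sum]
    refine Finset.sum_congr rfl fun j _ => ?_
    split_ifs <;> simp
  simp_rw [h1]
  rw [h]
  refine Finset.sum_congr rfl fun e _ => ?_
  induction e with | h y z =>
  simp only [Sym2.lift_mk, edgeGeom, Sym2.eq_swap (a := z)]
  rw [log_mul (sqrt_pos.2 (ht y)).ne' (sqrt_pos.2 (ht z)).ne', log_sqrt (ht y).le,
    log_sqrt (ht z).le]
  ring

variable (o : V)

lemma measurable_env_rootField (v : V) : Measurable fun p : (Sym2 V → ℝ) × (V → ℝ) =>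
    rootField (edgeW G p.1) o p.2 v :=
  measurable_rootField ((measurable_edgeW G).comp measurable_fst) measurable_snd v

lemma measurable_env_rootPot (v : V) : Measurable fun p : (Sym2 V → ℝ) × (V → ℝ) =>
    rootPot (edgeW G p.1) o p.2 v :=
  measurable_rootPot ((measurable_edgeW G).comp measurable_fst) measurable_snd v

/-- The exponent of `t i` in the mixed moments of the environment. -/
noncomputable def momentExp (a : ℝ) (k : Sym2 V → ℕ) (v i : V) : ℝ :=
  (wdeg G (fun e => a + k e) i + 1 - if i = v then 1 else 0) / 2

/-- The mixed moments of the gamma weights. -/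
noncomputable def gammaRatio (a : ℝ) (k : Sym2 V → ℕ) : ℝ :=
  ∏ e ∈ G.edgeFinset, Gamma (a + k e) / Gamma a

lemma gammaRatio_pos {a : ℝ} (ha : 0 < a) (k : Sym2 V → ℕ) : 0 < gammaRatio G a k :=
  Finset.prod_pos fun e _ => div_pos (Gamma_pos_of_pos (by positivity)) (Gamma_pos_of_pos ha)

lemma lintegral_weightMeasure_tilt {a : ℝ} (ha : 0 < a) {t : V → ℝ} (ht : ∀ i, 0 < t i)
    (k : Sym2 V → ℕ) :
    ∫⁻ w, ∏ e ∈ G.edgeFinset, ENNReal.ofReal (|w e| ^ k e * exp (|w e| * (1 - edgeGeom t e)))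
        ∂(weightMeasure a)
      = ENNReal.ofReal (gammaRatio G a k *
          ∏ i, t i ^ (-(wdeg G (fun e => a + k e) i) / 2)) := by
  have := ProbabilityTheory.isProbabilityMeasure_gammaMeasure ha one_pos
  rw [weightMeasure, lintegral_pi_prod G.edgeFinset
    (f := fun e x => ENNReal.ofReal (|x| ^ k e * exp (|x| * (1 - edgeGeom t e))))
    (fun e => by fun_prop)]
  rw [Finset.prod_congr rfl fun e _ => lintegral_gammaMeasure_tilt ha (k e) (edgeGeom_pos ht e),
    ← ENNReal.ofReal_prod_of_nonneg, Finset.prod_mul_distrib, gammaRatio, ← prod_edgeGeom G ht]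
  intro e _
  have h1 := edgeGeom_pos ht e
  have h2 := Gamma_pos_of_pos ha
  have h3 : 0 < Gamma (a + k e) := Gamma_pos_of_pos (by positivity)
  positivity

lemma lintegral_env_moment {a : ℝ} (ha : 0 < a) (hG : G.Connected) {t : V → ℝ}
    (ht : ∀ i, 0 < t i) (k : Sym2 V → ℕ) (v : V) :
    ∫⁻ p, (∏ e ∈ G.edgeFinset, ENNReal.ofReal (|p.1 e| ^ k e)) *
        (ENNReal.ofReal (rootField (edgeW G p.1) o p.2 v) *
          ENNReal.ofReal (exp (-(∑ i, (t i - 1) * rootPot (edgeW G p.1) o p.2 i) / 2)))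
        ∂(env G o a)
      = ENNReal.ofReal (gammaRatio G a k * ∏ i, t i ^ (-momentExp G a k v i)) := by
  have hm1 : Measurable fun p : (Sym2 V → ℝ) × (V → ℝ) =>
      ∏ e ∈ G.edgeFinset, ENNReal.ofReal (|p.1 e| ^ k e) :=
    Finset.measurable_fun_prod _ fun e _ =>
      (((measurable_pi_apply e).comp measurable_fst).abs.pow_const _).ennreal_ofReal
  have hm2 : Measurable fun p : (Sym2 V → ℝ) × (V → ℝ) =>
      ENNReal.ofReal (exp (-(∑ i, (t i - 1) * rootPot (edgeW G p.1) o p.2 i) / 2)) :=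
    ((Finset.measurable_fun_sum _ fun i _ =>
      (measurable_env_rootPot G o i).const_mul _).neg.div_const 2).exp.ennreal_ofReal
  have hm : Measurable fun p : (Sym2 V → ℝ) × (V → ℝ) =>
      (∏ e ∈ G.edgeFinset, ENNReal.ofReal (|p.1 e| ^ k e)) *
        (ENNReal.ofReal (rootField (edgeW G p.1) o p.2 v) *
          ENNReal.ofReal (exp (-(∑ i, (t i - 1) * rootPot (edgeW G p.1) o p.2 i) / 2))) :=
    hm1.mul ((measurable_env_rootField G o v).ennreal_ofReal.mul hm2)
  rw [lintegral_env G o a hm]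
  have hs : ∀ i, 0 < √(t i) := fun i => sqrt_pos.2 (ht i)
  have hK : 0 ≤ √(t v) * (∏ i, √(t i))⁻¹ :=
    mul_nonneg (hs v).le (inv_nonneg.2 (Finset.prod_nonneg fun i _ => (hs i).le))
  have key : ∀ᵐ w ∂(weightMeasure a : Measure (Sym2 V → ℝ)),
      ∫⁻ b, ENNReal.ofReal (potDensity (edgeW G w) (Finset.univ.erase o) (edgeW G w o) 1 b) *
        ((∏ e ∈ G.edgeFinset, ENNReal.ofReal (|w e| ^ k e)) *
        (ENNReal.ofReal (rootField (edgeW G w) o b v) *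
          ENNReal.ofReal (exp (-(∑ i, (t i - 1) * rootPot (edgeW G w) o b i) / 2))))
        ∂(Measure.pi (rootMeasure o))
      = ENNReal.ofReal (√(t v) * (∏ i, √(t i))⁻¹) *
        ∏ e ∈ G.edgeFinset, ENNReal.ofReal (|w e| ^ k e * exp (|w e| * (1 - edgeGeom t e))) := by
    filter_upwards [ae_weightMeasure_pos ha] with w hw
    simp_rw [← ENNReal.ofReal_prod_of_nonneg (s := G.edgeFinset) (f := fun e => |w e| ^ k e)
      (fun _ _ => by positivity),
      mul_left_comm _ (ENNReal.ofReal (∏ e ∈ G.edgeFinset, |w e| ^ k e))]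
    rw [lintegral_const_mul' _ _ ENNReal.ofReal_ne_top,
      lintegral_rootField (isWeight_edgeW G w) (fun v => reflTransGen_edgeW hG hw v o) ht v,
      sum_edgeW, ← ENNReal.ofReal_prod_of_nonneg (fun _ _ => by positivity),
      Finset.prod_mul_distrib, exp_sum, ← ENNReal.ofReal_mul (by positivity),
      ← ENNReal.ofReal_mul hK]
    congr 1
    ring
  rw [lintegral_congr_ae key, lintegral_const_mul' _ _ ENNReal.ofReal_ne_top,
    lintegral_weightMeasure_tilt G ha ht, ← ENNReal.ofReal_mul hK]
  congr 1
  have hfac : √(t v) * (∏ i, √(t i))⁻¹ = ∏ i, t i ^ (-(1 - if i = v then (1 : ℝ) else 0) / 2) := by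
    rw [← Finset.prod_inv_distrib, ← Finset.mul_prod_erase _ _ (Finset.mem_univ v),
      ← Finset.mul_prod_erase (a := v) Finset.univ _ (Finset.mem_univ v), ← mul_assoc,
      mul_inv_cancel₀ (hs v).ne', if_pos rfl, sub_self, neg_zero, zero_div, rpow_zero]
    congr 1
    refine Finset.prod_congr rfl fun i hi => ?_
    rw [if_neg (Finset.ne_of_mem_erase hi), sqrt_eq_rpow, ← rpow_neg (ht i).le]
    norm_num
  rw [hfac, mul_left_comm, ← Finset.prod_mul_distrib]
  congr 1
  refine Finset.prod_congr rfl fun i _ => ?_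
  rw [← rpow_add (ht i), momentExp]
  congr 1
  ring

end ERRWZ2

namespace ERRWZ2

open Set Real Function

section Tail

lemma lintegral_Ioi_exp_half {b c : ℝ} (hb : 0 < b) :
    ∫⁻ s in Ioi c, ENNReal.ofReal (exp (-((s - c) * b) / 2) / 2) = ENNReal.ofReal b⁻¹ := by
  have hb2 : -b / 2 < 0 := by linarith
  have h0 : ∀ s, exp (-((s - c) * b) / 2) / 2
      = (exp (c * b / 2) / 2) * exp (-b / 2 * s) := fun s => by
    rw [show -((s - c) * b) / 2 = c * b / 2 + -b / 2 * s by ring, exp_add]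
    ring
  simp_rw [h0]
  have hi := integrableOn_exp_mul_Ioi hb2 c
  rw [← ofReal_integral_eq_lintegral_ofReal (hi.const_mul _)
    (ae_of_all _ fun s => by positivity), integral_const_mul, integral_exp_mul_Ioi hb2]
  congr 1
  have h1 : exp (c * b / 2) * exp (-b / 2 * c) = 1 := by
    rw [← exp_add, show c * b / 2 + -b / 2 * c = 0 by ring, exp_zero]
  have h2 : exp (c * b / 2) / 2 * (-exp (-b / 2 * c) / (-b / 2))
      = exp (c * b / 2) * exp (-b / 2 * c) * b⁻¹ := by
    generalize exp (c * b / 2) = x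
    generalize exp (-b / 2 * c) = y
    field_simp
  rw [h2, h1, one_mul]

lemma lintegral_Ioi_rpow_half {q c : ℝ} (hq : 1 < q) (hc : 0 < c) :
    ∫⁻ s in Ioi c, ENNReal.ofReal (s ^ (-q) / 2)
      = ENNReal.ofReal (c ^ (1 - q) * (2 * (q - 1))⁻¹) := by
  have hq' : -q < -1 := by linarith
  have hi := (integrableOn_Ioi_rpow_of_lt hq' hc).div_const 2
  rw [← ofReal_integral_eq_lintegral_ofReal hi, integral_div, integral_Ioi_rpow_of_lt hq' hc]
  · congr 1
    rw [show -q + 1 = 1 - q by ring]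
    have : q - 1 ≠ 0 := by linarith
    have h' : 1 - q ≠ 0 := by linarith
    rw [div_div, mul_inv, show (1 - q) = -(q - 1) by ring]
    field_simp
  · filter_upwards [ae_restrict_mem measurableSet_Ioi] with s hs
    have : 0 < s := hc.trans hs
    positivity

end Tail

variable {V : Type*} [Fintype V] [DecidableEq V] (G : SimpleGraph V) (o : V)

/-- An environment with positive weights and positive definite Green operator. -/
def GoodEnv (p : (Sym2 V → ℝ) × (V → ℝ)) : Prop :=
  (∀ e, 0 < p.1 e) ∧ (hmat (edgeW G p.1) p.2 (Finset.univ.erase o)).PosDef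

lemma ae_goodEnv {a : ℝ} (ha : 0 < a) : ∀ᵐ p ∂(env G o a), GoodEnv G o p := by
  have := isProbabilityMeasure_weightMeasure (V := V) ha
  rw [env, ae_withDensity_iff (measurable_env_density G o)]
  have h := (Measure.quasiMeasurePreserving_fst (μ := (weightMeasure a : Measure (Sym2 V → ℝ)))
    (ν := Measure.pi (rootMeasure o))).ae (ae_weightMeasure_pos ha)
  filter_upwards [h] with p hp h0
  refine ⟨hp, posDef_of_potDensity_ne_zero (η := edgeW G p.1 o) (θ := 1) fun h1 => h0 ?_⟩
  rw [h1, ENNReal.ofReal_zero]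

lemma sFinite_env {a : ℝ} (ha : 0 < a) : SFinite (env G o a) := by
  have := isProbabilityMeasure_weightMeasure (V := V) ha
  unfold env
  infer_instance

lemma measurable_prod_inv_rootPot (m : Multiset V) :
    Measurable fun p : (Sym2 V → ℝ) × (V → ℝ) =>
      (m.map fun i => ENNReal.ofReal (rootPot (edgeW G p.1) o p.2 i)⁻¹).prod := by
  induction m using Multiset.induction_on with
  | empty => simp
  | cons l m ih =>
    simp only [Multiset.map_cons, Multiset.prod_cons]
    exact (measurable_env_rootPot G o l).inv.ennreal_ofReal.mul ih

variable {G o}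

lemma GoodEnv.rootField_pos {p : (Sym2 V → ℝ) × (V → ℝ)} (h : GoodEnv G o p) (hG : G.Connected)
    (v : V) : 0 < rootField (edgeW G p.1) o p.2 v :=
  ERRWZ2.rootField_pos (isWeight_edgeW G p.1) h.2 (reflTransGen_edgeW hG h.1 v o)

lemma GoodEnv.rootPot_pos {p : (Sym2 V → ℝ) × (V → ℝ)} (h : GoodEnv G o p) (hG : G.Connected)
    [Nontrivial V] (v : V) : 0 < rootPot (edgeW G p.1) o p.2 v := by
  obtain ⟨j, hj⟩ := hG.preconnected.exists_adj_of_nontrivial v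
  exact ERRWZ2.rootPot_pos (isWeight_edgeW G p.1) h.2
    (fun v => reflTransGen_edgeW hG h.1 v o) (edgeW_pos G h.1 hj)

variable (G o)

lemma lintegral_env_inv_moment [Nontrivial V] {a : ℝ} (ha : 0 < a) (hG : G.Connected)
    (k : Sym2 V → ℕ) (v : V) (m : Multiset V) {t : V → ℝ} (ht : ∀ i, 0 < t i)
    (hm : ∀ i, ∀ j < m.count i, 0 < momentExp G a k v i - 1 - j) :
    ∫⁻ p, (∏ e ∈ G.edgeFinset, ENNReal.ofReal (|p.1 e| ^ k e)) *
        ((m.map fun i => ENNReal.ofReal (rootPot (edgeW G p.1) o p.2 i)⁻¹).prod *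
        (ENNReal.ofReal (rootField (edgeW G p.1) o p.2 v) *
          ENNReal.ofReal (exp (-(∑ i, (t i - 1) * rootPot (edgeW G p.1) o p.2 i) / 2))))
        ∂(env G o a)
      = ENNReal.ofReal (gammaRatio G a k * ∏ i, (t i ^ (-(momentExp G a k v i - m.count i)) *
          ∏ j ∈ Finset.range (m.count i), (2 * (momentExp G a k v i - 1 - j))⁻¹)) := by
  induction m using Multiset.induction_on generalizing t with
  | empty => simpa using lintegral_env_moment G o ha hG ht k v
  | cons i m ih =>
    have hm' : ∀ l, ∀ j < m.count l, 0 < momentExp G a k v l - 1 - j := fun l j hj =>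
      hm l j (hj.trans_le (Multiset.count_le_count_cons _ _ _))
    have := isProbabilityMeasure_weightMeasure (V := V) ha
    have := sFinite_env G o ha
    set K : (Sym2 V → ℝ) × (V → ℝ) → ℝ≥0∞ := fun p =>
      (∏ e ∈ G.edgeFinset, ENNReal.ofReal (|p.1 e| ^ k e)) *
        (m.map fun i => ENNReal.ofReal (rootPot (edgeW G p.1) o p.2 i)⁻¹).prod *
        ENNReal.ofReal (rootField (edgeW G p.1) o p.2 v) with hK
    have hKm : Measurable K := by
      refine Measurable.mul (Measurable.mul ?_ ?_) (measurable_env_rootField G o v).ennreal_ofReal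
      · exact Finset.measurable_fun_prod _ fun e _ =>
          (((measurable_pi_apply e).comp measurable_fst).abs.pow_const _).ennreal_ofReal
      · exact measurable_prod_inv_rootPot G o m
    set X : ℝ → (Sym2 V → ℝ) × (V → ℝ) → ℝ := fun s p =>
      exp (-(∑ l, (update t i s l - 1) * rootPot (edgeW G p.1) o p.2 l) / 2) with hX
    have hXm : Measurable fun q : ((Sym2 V → ℝ) × (V → ℝ)) × ℝ => X q.2 q.1 := by
      refine ((Finset.measurable_fun_sum _ fun l _ => Measurable.mul ?_
        ((measurable_env_rootPot G o l).comp measurable_fst)).neg.div_const 2).exp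
      by_cases hl : l = i
      · subst hl
        simpa using measurable_snd.sub_const 1
      · simp [hl]
    have hstep : ∀ s ∈ Ioi (t i), ∫⁻ p, K p * ENNReal.ofReal (X s p / 2) ∂(env G o a)
        = ENNReal.ofReal (gammaRatio G a k * ((∏ l ∈ Finset.univ.erase i,
          (t l ^ (-(momentExp G a k v l - m.count l)) *
            ∏ j ∈ Finset.range (m.count l), (2 * (momentExp G a k v l - 1 - j))⁻¹)) *
          ∏ j ∈ Finset.range (m.count i), (2 * (momentExp G a k v i - 1 - j))⁻¹)) *
          ENNReal.ofReal (s ^ (-(momentExp G a k v i - m.count i)) / 2) := fun s hs => by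
      have hs0 : 0 < s := (ht i).trans hs
      have hts : ∀ l, 0 < update t i s l := fun l => by
        by_cases hl : l = i
        · subst hl
          simpa using hs0
        · simpa [hl] using ht l
      have h := ih hts hm'
      have hK2 : ∀ p, K p * ENNReal.ofReal (X s p / 2) = ENNReal.ofReal 2⁻¹ *
          ((∏ e ∈ G.edgeFinset, ENNReal.ofReal (|p.1 e| ^ k e)) *
          ((m.map fun i => ENNReal.ofReal (rootPot (edgeW G p.1) o p.2 i)⁻¹).prod *
          (ENNReal.ofReal (rootField (edgeW G p.1) o p.2 v) * ENNReal.ofReal (X s p)))) :=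
        fun p => by
        rw [div_eq_inv_mul, ENNReal.ofReal_mul (by norm_num)]
        simp only [hK]
        ring
      simp_rw [hK2]
      rw [lintegral_const_mul' _ _ ENNReal.ofReal_ne_top, h,
        ← ENNReal.ofReal_mul (by norm_num), ← ENNReal.ofReal_mul' (by positivity)]
      congr 1
      rw [← Finset.mul_prod_erase _ _ (Finset.mem_univ i), update_self]
      have he : ∏ x ∈ Finset.univ.erase i, (update t i s x ^ (-(momentExp G a k v x - m.count x)) *
            ∏ j ∈ Finset.range (m.count x), (2 * (momentExp G a k v x - 1 - j))⁻¹)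
          = ∏ x ∈ Finset.univ.erase i, (t x ^ (-(momentExp G a k v x - m.count x)) *
            ∏ j ∈ Finset.range (m.count x), (2 * (momentExp G a k v x - 1 - j))⁻¹) :=
        Finset.prod_congr rfl fun x hx => by rw [update_of_ne (Finset.ne_of_mem_erase hx)]
      rw [he]
      ring
    have hpt : ∀ᵐ p ∂(env G o a), (∏ e ∈ G.edgeFinset, ENNReal.ofReal (|p.1 e| ^ k e)) *
        (((i ::ₘ m).map fun i => ENNReal.ofReal (rootPot (edgeW G p.1) o p.2 i)⁻¹).prod *
        (ENNReal.ofReal (rootField (edgeW G p.1) o p.2 v) *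
          ENNReal.ofReal (exp (-(∑ i, (t i - 1) * rootPot (edgeW G p.1) o p.2 i) / 2))))
        = ∫⁻ s in Ioi (t i), K p * ENNReal.ofReal (X s p / 2) := by
      filter_upwards [ae_goodEnv G o ha] with p hp
      have hb := hp.rootPot_pos hG i
      have hs : ∀ s, K p * ENNReal.ofReal (X s p / 2) = K p * ENNReal.ofReal
          (exp (-(∑ l, (t l - 1) * rootPot (edgeW G p.1) o p.2 l) / 2)) *
          ENNReal.ofReal (exp (-((s - t i) * rootPot (edgeW G p.1) o p.2 i) / 2) / 2) := fun s => by
        rw [mul_assoc (K p), ← ENNReal.ofReal_mul (exp_pos _).le, mul_div_assoc', ← exp_add]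
        simp only [hX]
        congr 4
        rw [← Finset.add_sum_erase _ _ (Finset.mem_univ i), update_self,
          ← Finset.add_sum_erase (a := i) _ (fun l => (t l - 1) * rootPot (edgeW G p.1) o p.2 l)
            (Finset.mem_univ i), Finset.sum_congr rfl fun x hx =>
              by rw [update_of_ne (Finset.ne_of_mem_erase hx)]]
        ring
      simp_rw [hs]
      rw [lintegral_const_mul _ (by fun_prop), lintegral_Ioi_exp_half hb, Multiset.map_cons,
        Multiset.prod_cons]
      simp only [hK]
      ring
    rw [lintegral_congr_ae hpt, lintegral_lintegral_swap]
    · rw [setLIntegral_congr_fun measurableSet_Ioi hstep,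
        lintegral_const_mul' _ _ ENNReal.ofReal_ne_top, lintegral_Ioi_rpow_half _ (ht i)]
      · rw [← ENNReal.ofReal_mul]
        · congr 1
          rw [← Finset.mul_prod_erase (a := i) Finset.univ _ (Finset.mem_univ i),
            Multiset.count_cons_self, Finset.prod_range_succ]
          have he : ∏ x ∈ Finset.univ.erase i, (t x ^ (-(momentExp G a k v x -
              (i ::ₘ m).count x)) *
              ∏ j ∈ Finset.range ((i ::ₘ m).count x), (2 * (momentExp G a k v x - 1 - j))⁻¹)
            = ∏ x ∈ Finset.univ.erase i, (t x ^ (-(momentExp G a k v x - m.count x)) *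
              ∏ j ∈ Finset.range (m.count x), (2 * (momentExp G a k v x - 1 - j))⁻¹) :=
            Finset.prod_congr rfl fun x hx => by
              rw [Multiset.count_cons_of_ne (Finset.ne_of_mem_erase hx)]
          rw [he]
          push_cast
          rw [show 1 - (momentExp G a k v i - m.count i) = -(momentExp G a k v i - (m.count i + 1))
            by ring, show momentExp G a k v i - m.count i - 1 = momentExp G a k v i - 1 - m.count i
            by ring]
          ring
        · refine mul_nonneg (gammaRatio_pos G ha k).le (mul_nonneg
            (Finset.prod_nonneg fun l _ => mul_nonneg (rpow_nonneg (ht l).le _) ?_) ?_) <;>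
          exact Finset.prod_nonneg fun j hj => inv_nonneg.2
            (mul_nonneg zero_le_two (hm' _ j (Finset.mem_range.1 hj)).le)
      · have := hm i (m.count i) (by simp)
        linarith
    · exact ((hKm.comp measurable_fst).mul (hXm.div_const 2).ennreal_ofReal).aemeasurable

end ERRWZ2

namespace ERRWZ2

open Set Real Function

variable {V : Type*} [Fintype V] [DecidableEq V] (G : SimpleGraph V) (o : V)

/-- The number of crossings of the edge `e` by the path `u` before time `n`. -/
def crossings (u : ℕ → V) (n : ℕ) (e : Sym2 V) : ℕ :=
  ((Finset.range n).filter fun s => s(u s, u (s + 1)) = e).card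

/-- The multiset of vertices visited by the path `u` before time `n`. -/
def visits (u : ℕ → V) (n : ℕ) : Multiset V := (Multiset.range n).map u

lemma crossings_zero (u : ℕ → V) (e : Sym2 V) : crossings u 0 e = 0 := by simp [crossings]

lemma crossings_succ (u : ℕ → V) (n : ℕ) (e : Sym2 V) :
    crossings u (n + 1) e = crossings u n e + if s(u n, u (n + 1)) = e then 1 else 0 := by
  unfold crossings
  rw [Finset.range_add_one, Finset.filter_insert]
  split_ifs with h
  · rw [Finset.card_insert_of_notMem (by simp)]
  · rfl

lemma visits_zero (u : ℕ → V) : visits u 0 = 0 := rfl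

lemma visits_succ (u : ℕ → V) (n : ℕ) : visits u (n + 1) = u n ::ₘ visits u n := by
  simp [visits, Multiset.range_succ]

lemma count_visits_succ (u : ℕ → V) (n : ℕ) (i : V) :
    (visits u (n + 1)).count i = (visits u n).count i + if i = u n then 1 else 0 := by
  rw [visits_succ, Multiset.count_cons]

lemma wdeg_add (x y : Sym2 V → ℝ) (i : V) :
    wdeg G (fun e => x e + y e) i = wdeg G x i + wdeg G y i := by
  simp only [wdeg, ← Finset.sum_add_distrib]
  refine Finset.sum_congr rfl fun j _ => ?_
  split_ifs <;> simp

lemma wdeg_indicator {x y : V} (h : G.Adj x y) (i : V) :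
    wdeg G (fun e => if s(x, y) = e then (1 : ℝ) else 0) i
      = (if i = x then 1 else 0) + if i = y then 1 else 0 := by
  have hne := h.ne
  have h1 : ∀ j, (if G.Adj i j then (if s(x, y) = s(i, j) then (1 : ℝ) else 0) else 0)
      = (if i = x then (if j = y then 1 else 0) else 0)
        + if i = y then (if j = x then 1 else 0) else 0 := fun j => by
    by_cases hx : i = x
    · subst hx
      by_cases hj : j = y
      · subst hj
        simp [h, hne]
      · simp [hne, Ne.symm hj, hj]
        exact fun h1 h2 => absurd h2 h1.ne
    · by_cases hy : i = y
      · subst hy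
        by_cases hj : j = x
        · subst hj
          simp [h.symm, hx, Sym2.eq_swap]
        · simp [hx, Ne.symm hx, Ne.symm hj, hj]
      · simp [hx, hy, Ne.symm hx, Ne.symm hy]
  rw [wdeg]
  simp_rw [h1]
  rw [Finset.sum_add_distrib]
  split_ifs <;> simp

lemma wdeg_crossings {u : ℕ → V} (h0 : u 0 = o) {n : ℕ} (hu : ∀ s < n, G.Adj (u s) (u (s + 1)))
    (i : V) : wdeg G (fun e => (crossings u n e : ℝ)) i
      = 2 * (visits u n).count i + (if i = u n then 1 else 0) - if i = o then 1 else 0 := by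
  induction n with
  | zero => simp [crossings_zero, visits_zero, wdeg, h0]
  | succ n ih =>
    simp_rw [crossings_succ]
    push_cast
    rw [wdeg_add, ih fun s hs => hu s (hs.trans (Nat.lt_succ_self n)),
      wdeg_indicator G (hu n (Nat.lt_succ_self n)), count_visits_succ]
    push_cast
    ring

lemma wdeg_const_pos [Nontrivial V] {a : ℝ} (ha : 0 < a) (hG : G.Connected) (i : V) :
    0 < wdeg G (fun _ => a) i := by
  obtain ⟨j, hj⟩ := hG.preconnected.exists_adj_of_nontrivial i
  refine Finset.sum_pos' (fun l _ => ?_) ⟨j, Finset.mem_univ j, ?_⟩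
  · split_ifs <;> simp [ha.le]
  · simpa [hj] using ha

lemma gammaRatio_crossings_succ {a : ℝ} (ha : 0 < a) {u : ℕ → V} {n : ℕ}
    (h : G.Adj (u n) (u (n + 1))) : gammaRatio G a (crossings u (n + 1))
      = gammaRatio G a (crossings u n) * (a + crossings u n s(u n, u (n + 1))) := by
  have he : s(u n, u (n + 1)) ∈ G.edgeFinset := by simpa using h
  rw [gammaRatio, gammaRatio, ← Finset.mul_prod_erase _ _ he,
    ← Finset.mul_prod_erase G.edgeFinset (fun e => Gamma (a + crossings u n e) / Gamma a) he,
    crossings_succ, if_pos rfl]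
  have h1 : ∏ e ∈ G.edgeFinset.erase s(u n, u (n + 1)), Gamma (a + crossings u (n + 1) e) / Gamma a
      = ∏ e ∈ G.edgeFinset.erase s(u n, u (n + 1)), Gamma (a + crossings u n e) / Gamma a :=
    Finset.prod_congr rfl fun e hx => by
      rw [crossings_succ, if_neg (Finset.ne_of_mem_erase hx).symm, add_zero]
  rw [h1]
  push_cast
  rw [← add_assoc, Gamma_add_one (by positivity)]
  ring

/-- The step weights of the path formula, after reflection of the index. -/
lemma momentExp_crossings {a : ℝ} {u : ℕ → V} (h0 : u 0 = o) {n : ℕ}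
    (hu : ∀ s < n, G.Adj (u s) (u (s + 1))) (i : V) (x : ℝ) :
    2 * (momentExp G a (crossings u n) (u n) i - 1 - x)
      = wdeg G (fun _ => a) i + 2 * ((visits u n).count i - 1 - x) + 1
        - if i = o then 1 else 0 := by
  rw [momentExp, wdeg_add G (fun _ => a), wdeg_crossings G o h0 hu]
  ring

lemma prod_momentExp_crossings {a : ℝ} {u : ℕ → V} (h0 : u 0 = o) {n : ℕ}
    (hu : ∀ s < n, G.Adj (u s) (u (s + 1))) (i : V) :
    ∏ j ∈ Finset.range ((visits u n).count i),
        (2 * (momentExp G a (crossings u n) (u n) i - 1 - j))⁻¹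
      = ∏ j ∈ Finset.range ((visits u n).count i),
        (wdeg G (fun _ => a) i + 2 * j + 1 - if i = o then 1 else 0)⁻¹ := by
  rw [← Finset.prod_range_reflect]
  refine Finset.prod_congr rfl fun j hj => ?_
  have hj := Finset.mem_range.1 hj
  rw [momentExp_crossings G o h0 hu, Nat.cast_sub (by omega), Nat.cast_sub (by omega)]
  push_cast
  ring_nf

lemma gammaRatio_mul_prod {a : ℝ} (ha : 0 < a) {u : ℕ → V} (h0 : u 0 = o) {n : ℕ}
    (hu : ∀ s < n, G.Adj (u s) (u (s + 1))) :
    gammaRatio G a (crossings u n) * ∏ i, ∏ j ∈ Finset.range ((visits u n).count i),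
        (wdeg G (fun _ => a) i + 2 * j + 1 - if i = o then 1 else 0)⁻¹
      = ∏ s ∈ Finset.range n, (a + crossings u s s(u s, u (s + 1))) /
          wdeg G (fun e => a + crossings u s e) (u s) := by
  induction n with
  | zero =>
    have := (Gamma_pos_of_pos ha).ne'
    simp [gammaRatio, crossings_zero, visits_zero, this]
  | succ n ih =>
    have hu' : ∀ s < n, G.Adj (u s) (u (s + 1)) := fun s hs => hu s (hs.trans (Nat.lt_succ_self n))
    have ih := ih hu'
    rw [Finset.prod_range_succ, ← ih, gammaRatio_crossings_succ G ha (hu n (Nat.lt_succ_self n)),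
      ← Finset.mul_prod_erase _ _ (Finset.mem_univ (u n)),
      ← Finset.mul_prod_erase (a := u n) Finset.univ (fun i =>
        ∏ j ∈ Finset.range ((visits u n).count i),
        (wdeg G (fun _ => a) i + 2 * j + 1 - if i = o then 1 else 0)⁻¹) (Finset.mem_univ (u n)),
      count_visits_succ, if_pos rfl, Finset.prod_range_succ]
    have h1 : ∏ i ∈ Finset.univ.erase (u n), ∏ j ∈ Finset.range ((visits u (n + 1)).count i),
        (wdeg G (fun _ => a) i + 2 * j + 1 - if i = o then 1 else 0)⁻¹
        = ∏ i ∈ Finset.univ.erase (u n), ∏ j ∈ Finset.range ((visits u n).count i),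
        (wdeg G (fun _ => a) i + 2 * j + 1 - if i = o then 1 else 0)⁻¹ :=
      Finset.prod_congr rfl fun i hi => by
        rw [count_visits_succ, if_neg (Finset.ne_of_mem_erase hi), add_zero]
    rw [h1, wdeg_add G (fun _ => a), wdeg_crossings G o h0 hu', if_pos rfl]
    ring

/-- The transition probabilities of the conditioned reversible walk in the environment `p`. -/
noncomputable def jump (p : (Sym2 V → ℝ) × (V → ℝ)) (i j : V) : ℝ :=
  edgeW G p.1 i j * rootField (edgeW G p.1) o p.2 j /
    (rootPot (edgeW G p.1) o p.2 i * rootField (edgeW G p.1) o p.2 i)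

lemma prod_edgeW (w : Sym2 V → ℝ) {u : ℕ → V} {n : ℕ} (hu : ∀ s < n, G.Adj (u s) (u (s + 1))) :
    ∏ s ∈ Finset.range n, edgeW G w (u s) (u (s + 1))
      = ∏ e ∈ G.edgeFinset, |w e| ^ crossings u n e := by
  induction n with
  | zero => simp [crossings_zero]
  | succ n ih =>
    rw [Finset.prod_range_succ, ih fun s hs => hu s (hs.trans (Nat.lt_succ_self n))]
    have he : s(u n, u (n + 1)) ∈ G.edgeFinset := by simpa using hu n (Nat.lt_succ_self n)
    rw [← Finset.mul_prod_erase _ _ he,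
      ← Finset.mul_prod_erase G.edgeFinset (fun e => |w e| ^ crossings u (n + 1) e) he,
      crossings_succ, if_pos rfl, edgeW, if_pos (hu n (Nat.lt_succ_self n))]
    have h1 : ∏ e ∈ G.edgeFinset.erase s(u n, u (n + 1)), |w e| ^ crossings u (n + 1) e
        = ∏ e ∈ G.edgeFinset.erase s(u n, u (n + 1)), |w e| ^ crossings u n e :=
      Finset.prod_congr rfl fun e hx => by
        rw [crossings_succ, if_neg (Finset.ne_of_mem_erase hx).symm, add_zero]
    rw [h1]
    ring

variable {G o}

lemma GoodEnv.prod_jump {p : (Sym2 V → ℝ) × (V → ℝ)} (h : GoodEnv G o p) (hG : G.Connected)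
    [Nontrivial V] {u : ℕ → V} (h0 : u 0 = o) {n : ℕ} (hu : ∀ s < n, G.Adj (u s) (u (s + 1))) :
    ∏ s ∈ Finset.range n, jump G o p (u s) (u (s + 1))
      = (∏ e ∈ G.edgeFinset, |p.1 e| ^ crossings u n e) *
        (((visits u n).map fun i => (rootPot (edgeW G p.1) o p.2 i)⁻¹).prod *
          rootField (edgeW G p.1) o p.2 (u n)) := by
  rw [← prod_edgeW G p.1 hu]
  clear hu
  induction n with
  | zero => simp [visits_zero, h0, rootField_self]
  | succ n ih =>
    rw [Finset.prod_range_succ, ih, Finset.prod_range_succ, visits_succ, Multiset.map_cons,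
      Multiset.prod_cons, jump]
    have h1 := (h.rootField_pos hG (u n)).ne'
    have h2 := (h.rootPot_pos hG (u n)).ne'
    field_simp

variable (G o)

/-- The reinforced walk is a mixture of reversible Markov chains. -/
lemma lintegral_env_jump [Nontrivial V] {a : ℝ} (ha : 0 < a) (hG : G.Connected) {u : ℕ → V}
    (h0 : u 0 = o) {n : ℕ} (hu : ∀ s < n, G.Adj (u s) (u (s + 1))) :
    ∫⁻ p, ENNReal.ofReal (∏ s ∈ Finset.range n, jump G o p (u s) (u (s + 1))) ∂(env G o a)
      = ENNReal.ofReal (∏ s ∈ Finset.range n, (a + crossings u s s(u s, u (s + 1))) /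
          wdeg G (fun e => a + crossings u s e) (u s)) := by
  have hm : ∀ i, ∀ j < (visits u n).count i,
      0 < momentExp G a (crossings u n) (u n) i - 1 - j := fun i j hj => by
    have h1 := momentExp_crossings G o (a := a) h0 hu i j
    have h2 := wdeg_const_pos G ha hG i
    have h3 : (j : ℝ) + 1 ≤ (visits u n).count i := by exact_mod_cast hj
    have h4 : (if i = o then (1 : ℝ) else 0) ≤ 1 := by split_ifs <;> norm_num
    linarith
  have h := lintegral_env_inv_moment G o ha hG (crossings u n) (u n) (visits u n)
    (t := fun _ => 1) (fun _ => one_pos) hm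
  simp only [one_rpow, one_mul, prod_momentExp_crossings G o h0 hu] at h
  rw [gammaRatio_mul_prod G o ha h0 hu] at h
  rw [← h]
  refine lintegral_congr_ae ?_
  filter_upwards [ae_goodEnv G o ha] with p hp
  have hpos : 0 ≤ ((visits u n).map fun i => (rootPot (edgeW G p.1) o p.2 i)⁻¹).prod :=
    Multiset.prod_nonneg fun x hx => by
      obtain ⟨i, _, rfl⟩ := Multiset.mem_map.1 hx
      exact inv_nonneg.2 (hp.rootPot_pos hG i).le
  have hof : ENNReal.ofReal ((visits u n).map fun i => (rootPot (edgeW G p.1) o p.2 i)⁻¹).prod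
      = ((visits u n).map fun i => ENNReal.ofReal (rootPot (edgeW G p.1) o p.2 i)⁻¹).prod := by
    generalize visits u n = m
    induction m using Multiset.induction_on with
    | empty => simp
    | cons i m ih =>
      rw [Multiset.map_cons, Multiset.prod_cons, Multiset.map_cons, Multiset.prod_cons,
        ENNReal.ofReal_mul (inv_nonneg.2 (hp.rootPot_pos hG i).le), ih]
  rw [hp.prod_jump hG h0 hu, ENNReal.ofReal_mul (Finset.prod_nonneg fun _ _ => by positivity),
    ENNReal.ofReal_mul hpos, hof, ENNReal.ofReal_prod_of_nonneg fun _ _ => by positivity]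
  simp

end ERRWZ2

namespace ERRWZ2

open Set Real Function

lemma lintegral_rpow_mul_exp_neg_mul_rpow {p q b : ℝ} (hp : 1 ≤ p) (hq : -1 < q) (hb : 0 < b) :
    ∫⁻ x in Ioi 0, ENNReal.ofReal (x ^ q * exp (-b * x ^ p))
      = ENNReal.ofReal (b ^ (-(q + 1) / p) * (1 / p) * Gamma ((q + 1) / p)) := by
  rw [← integral_rpow_mul_exp_neg_mul_rpow (by linarith) hq hb, ofReal_integral_eq_lintegral_ofReal]
  · exact integrableOn_rpow_mul_exp_neg_mul_rpow hq (zero_lt_one.trans_le hp) hb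
  · filter_upwards [ae_restrict_mem measurableSet_Ioi] with x (hx : 0 < x)
    positivity

/-- The mean step weight. -/
noncomputable def stepMean (a : ℝ) : ℝ≥0∞ :=
  ∫⁻ x, stepWeight x ∂(ProbabilityTheory.gammaMeasure a 1)

/-- The ratio of Gamma values governing the mean step weight. -/
noncomputable def quarterRatio (x : ℝ) : ℝ := Gamma (x + 1 / 4) ^ 2 / (Gamma x * Gamma (x + 1 / 2))

lemma stepMean_eq {a : ℝ} (ha : 0 < a) : stepMean a = ENNReal.ofReal (quarterRatio (a / 2)) := by
  have hG := Gamma_pos_of_pos ha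
  have hpi : 0 < √(2 * π) := by positivity
  have h1 : ∀ x ∈ Ioi (0 : ℝ), ENNReal.ofReal ((Gamma a)⁻¹ * x ^ (a - 1) * exp (-x)) * stepWeight x
      = ∫⁻ y in Ioi 0, ENNReal.ofReal ((Gamma a)⁻¹ * (√(2 * π))⁻¹ *
        (y⁻¹ * exp (-(1 / 2) * y)) * (x ^ (a - 1 / 2) * exp (-(1 / (2 * y)) * x ^ (2 : ℝ)))) :=
    fun x hx => by
    have hx : 0 < x := hx
    rw [stepWeight, igHalf, lintegral_ig_eq_setLIntegral 1 x (fun y => (√y)⁻¹), ← mul_assoc,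
      ← ENNReal.ofReal_mul (by positivity), ← lintegral_const_mul' _ _ ENNReal.ofReal_ne_top]
    refine setLIntegral_congr_fun measurableSet_Ioi fun y (hy : 0 < y) => ?_
    rw [← ENNReal.ofReal_mul (by positivity)]
    congr 1
    rw [igDensity, if_pos hy]
    have e1 : x ^ (a - 1 / 2) = x ^ (a - 1) * √x := by
      rw [sqrt_eq_rpow, ← rpow_add hx]
      congr 1
      ring
    have e2 : exp (-(1 * √y - x / √y) ^ 2 / 2)
        = exp x * exp (-(1 / 2) * y) * exp (-(1 / (2 * y)) * x ^ 2) := by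
      rw [← exp_add, ← exp_add]
      congr 1
      have : (1 * √y - x / √y) ^ 2 = y - 2 * x + x ^ 2 / y := by
        have h := sq_sqrt hy.le
        have h0 : √y ≠ 0 := (sqrt_pos.2 hy).ne'
        rw [sub_sq, div_pow, mul_pow, h]
        field_simp
      rw [this]
      field_simp
      ring
    have e3 : y⁻¹ = (√y)⁻¹ * (√y)⁻¹ := by
      rw [← mul_inv, mul_self_sqrt hy.le]
    have e4 : exp (-x) * exp x = 1 := by rw [← exp_add]; simp
    rw [e1, e2, e3, rpow_two]
    linear_combination ((Gamma a)⁻¹ * x ^ (a - 1) * √x * (√(2 * π))⁻¹ * (√y)⁻¹ * (√y)⁻¹ *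
      exp (-(1 / 2) * y) * exp (-(1 / (2 * y)) * x ^ 2)) * e4
  have h2 : ∀ y ∈ Ioi (0 : ℝ), ∫⁻ x in Ioi 0, ENNReal.ofReal ((Gamma a)⁻¹ * (√(2 * π))⁻¹ *
        (y⁻¹ * exp (-(1 / 2) * y)) * (x ^ (a - 1 / 2) * exp (-(1 / (2 * y)) * x ^ (2 : ℝ))))
      = ENNReal.ofReal ((Gamma a)⁻¹ * (√(2 * π))⁻¹ * (2 ^ (a / 2 + 1 / 4) *
          (1 / 2 * Gamma (a / 2 + 1 / 4)))) *
        ENNReal.ofReal (y ^ (a / 2 + 1 / 4 - 1) * exp (-(1 / 2) * y ^ (1 : ℝ))) := fun y hy => by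
    have hy : 0 < y := hy
    have hG2 : 0 < Gamma (a / 2 + 1 / 4) := Gamma_pos_of_pos (by positivity)
    rw [setLIntegral_congr_fun measurableSet_Ioi fun x _ => ENNReal.ofReal_mul (by positivity),
      lintegral_const_mul' _ _ ENNReal.ofReal_ne_top,
      lintegral_rpow_mul_exp_neg_mul_rpow one_le_two (by linarith) (by positivity),
      ← ENNReal.ofReal_mul (by positivity), ← ENNReal.ofReal_mul (by positivity)]
    congr 1
    have e1 : (1 / (2 * y)) ^ (-(a - 1 / 2 + 1) / 2)
        = 2 ^ (a / 2 + 1 / 4) * y ^ (a / 2 + 1 / 4) := by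
      rw [← mul_rpow zero_le_two hy.le, one_div, inv_rpow (by positivity),
        ← rpow_neg (by positivity)]
      congr 1
      ring
    rw [e1, show (a - 1 / 2 + 1) / 2 = a / 2 + 1 / 4 by ring, rpow_sub hy, rpow_one]
    field_simp
  have hm : Measurable (uncurry fun x y : ℝ => ENNReal.ofReal ((Gamma a)⁻¹ * (√(2 * π))⁻¹ *
        (y⁻¹ * exp (-(1 / 2) * y)) * (x ^ (a - 1 / 2) * exp (-(1 / (2 * y)) * x ^ (2 : ℝ))))) := by
    unfold uncurry
    fun_prop
  have hG2 : 0 < Gamma (a / 2 + 1 / 4) := Gamma_pos_of_pos (by positivity)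
  rw [stepMean, lintegral_gammaMeasure measurable_stepWeight,
    setLIntegral_congr_fun measurableSet_Ioi h1, lintegral_lintegral_swap hm.aemeasurable,
    setLIntegral_congr_fun measurableSet_Ioi h2, lintegral_const_mul' _ _ ENNReal.ofReal_ne_top,
    lintegral_rpow_mul_exp_neg_mul_rpow le_rfl (by linarith) (by norm_num),
    ← ENNReal.ofReal_mul (by positivity)]
  congr 1
  have hdup := Gamma_mul_Gamma_add_half (a / 2)
  rw [quarterRatio, hdup, sub_add_cancel, div_one, div_one, div_one, mul_one,
    show 2 * (a / 2) = a by ring]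
  have e1 : (1 / 2 : ℝ) ^ (-(a / 2 + 1 / 4)) = 2 ^ (a / 2 + 1 / 4) := by
    rw [one_div, inv_rpow zero_le_two, ← rpow_neg zero_le_two, neg_neg]
  have e2 : (2 : ℝ) ^ (a / 2 + 1 / 4) * 2 ^ (a / 2 + 1 / 4) * 2 ^ (1 - a) = 2 * √2 := by
    rw [← rpow_add two_pos, ← rpow_add two_pos, sqrt_eq_rpow,
      show a / 2 + 1 / 4 + (a / 2 + 1 / 4) + (1 - a) = 1 + 1 / 2 by ring, rpow_add two_pos,
      rpow_one]
  have e3 : √(2 * π) = √2 * √π := sqrt_mul zero_le_two _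
  have e4 : (0 : ℝ) < 2 ^ (1 - a) := by positivity
  have e5 : 0 < √2 := by positivity
  have e6 : 0 < √π := by positivity
  rw [e1, e3, eq_div_iff (by positivity)]
  generalize (2 : ℝ) ^ (a / 2 + 1 / 4) = z at e2 ⊢
  field_simp
  linear_combination e2

lemma quarterRatio_le_one {x : ℝ} (hx : 0 < x) : quarterRatio x ≤ 1 := by
  have h0 := Gamma_pos_of_pos hx
  have h1 : 0 < Gamma (x + 1 / 2) := Gamma_pos_of_pos (by positivity)
  have h2 : 0 < Gamma (x + 1 / 4) := Gamma_pos_of_pos (by positivity)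
  rw [quarterRatio, div_le_one (by positivity)]
  have h := convexOn_log_Gamma.2 (mem_Ioi.2 hx) (mem_Ioi.2 (by positivity : 0 < x + 1 / 2))
    (by norm_num : (0 : ℝ) ≤ 1 / 2) (by norm_num : (0 : ℝ) ≤ 1 / 2) (by norm_num)
  simp only [smul_eq_mul, comp_apply] at h
  rw [show 1 / 2 * x + 1 / 2 * (x + 1 / 2) = x + 1 / 4 by ring] at h
  rw [← log_le_log_iff (by positivity) (by positivity), log_pow, log_mul h0.ne' h1.ne']
  push_cast
  linarith

lemma quarterRatio_succ {x : ℝ} (hx : 0 < x) :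
    quarterRatio x = quarterRatio (x + 1) * (1 - 1 / (16 * (x + 1 / 4) ^ 2)) := by
  have h0 := Gamma_pos_of_pos hx
  have h1 : 0 < Gamma (x + 1 / 2) := Gamma_pos_of_pos (by positivity)
  have h2 : 0 < Gamma (x + 1 / 4) := Gamma_pos_of_pos (by positivity)
  have h3 : x + 1 / 4 ≠ 0 := by positivity
  have h4 : x + 1 / 2 ≠ 0 := by positivity
  rw [quarterRatio, quarterRatio, show x + 1 + 1 / 4 = x + 1 / 4 + 1 by ring,
    show x + 1 + 1 / 2 = x + 1 / 2 + 1 by ring, Gamma_add_one hx.ne', Gamma_add_one h3,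
    Gamma_add_one h4]
  have e : 1 - 1 / (16 * (x + 1 / 4) ^ 2) = x * (x + 1 / 2) / (x + 1 / 4) ^ 2 := by
    field_simp
    ring
  rw [e]
  field_simp

lemma quarterRatio_nonneg {x : ℝ} (hx : 0 < x) : 0 ≤ quarterRatio x := by
  have h0 := Gamma_pos_of_pos hx
  have h1 : 0 < Gamma (x + 1 / 2) := Gamma_pos_of_pos (by positivity)
  rw [quarterRatio]
  positivity

lemma quarterRatio_le_exp (N : ℕ) {x : ℝ} (hx : 0 < x) :
    quarterRatio x ≤ exp (-(1 / (x + 1 / 4) - 1 / (x + 1 / 4 + N)) / 16) := by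
  induction N generalizing x with
  | zero => simpa using quarterRatio_le_one hx
  | succ N ih =>
    have ih := ih (x := x + 1) (by positivity)
    rw [quarterRatio_succ hx]
    have hle : 1 - 1 / (16 * (x + 1 / 4) ^ 2) ≤ exp (-(1 / (16 * (x + 1 / 4) ^ 2))) := by
      linarith [add_one_le_exp (-(1 / (16 * (x + 1 / 4) ^ 2)))]
    refine (mul_le_mul_of_nonneg_left hle (quarterRatio_nonneg (by positivity))).trans
      ((mul_le_mul_of_nonneg_right ih (exp_pos _).le).trans ?_)
    rw [← exp_add, exp_le_exp]
    push_cast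
    rw [show x + 1 + 1 / 4 + (N : ℝ) = x + 1 / 4 + (N + 1) by ring]
    have h : 1 / (x + 1 / 4) - 1 / (x + 1 + 1 / 4) ≤ 1 / (x + 1 / 4) ^ 2 := by
      rw [div_sub_div _ _ (by positivity) (by positivity), div_le_div_iff₀ (by positivity)
        (by positivity)]
      nlinarith
    have h' : 1 / (16 * (x + 1 / 4) ^ 2) = 1 / (x + 1 / 4) ^ 2 / 16 := by
      field_simp
    rw [h']
    linarith

lemma quarterRatio_le {x : ℝ} (hx : 0 < x) : quarterRatio x ≤ exp (-1 / (32 * x + 8)) := by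
  obtain ⟨N, hN⟩ := exists_nat_ge (x + 1 / 4)
  refine (quarterRatio_le_exp N hx).trans (exp_le_exp.2 ?_)
  have h : 1 / (x + 1 / 4 + N) ≤ 1 / (x + 1 / 4) / 2 := by
    rw [div_div]
    exact one_div_le_one_div_of_le (by positivity) (by linarith)
  have h2 : -1 / (32 * x + 8) = -(1 / (x + 1 / 4) / 2) / 16 := by
    field_simp
    ring
  rw [h2]
  linarith

/-- The mean step weight decays geometrically along a subdivided edge. -/
lemma four_mul_quarterRatio_pow_le {r : ℕ} {a : ℝ} (ha : 0 < a) (har : a < ((r : ℝ) - 129) / 256) :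
    4 * quarterRatio (a / 2) ^ r ≤ 1 / 2 := by
  have h1 := quarterRatio_le (x := a / 2) (by positivity)
  have h2 := pow_le_pow_left₀ (quarterRatio_nonneg (x := a / 2) (by positivity)) h1 r
  rw [← exp_nat_mul] at h2
  have h3 : exp ((r : ℝ) * (-1 / (32 * (a / 2) + 8))) ≤ exp (-8) := by
    rw [exp_le_exp, mul_div_assoc', div_le_iff₀ (by positivity)]
    linarith
  have h4 : 4 * exp (-8) ≤ 1 / 2 := by
    have h5 := add_one_le_exp (8 : ℝ)
    rw [exp_neg, mul_inv_le_iff₀ (exp_pos 8)]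
    linarith
  linarith

end ERRWZ2

namespace ERRWZ2

open Set Real Function

variable {V : Type*} [DecidableEq V]

lemma sawSum_congr {f g : V → V → ℝ≥0∞} {n : ℕ} {S : Finset V} {i v : V} (hi : i ∈ S)
    (h : ∀ i ∈ S, ∀ j ∈ S, i ≠ j → f i j = g i j) : sawSum f n S i v = sawSum g n S i v := by
  induction n generalizing S i with
  | zero => rfl
  | succ n ih =>
    rw [sawSum, sawSum]
    split_ifs
    · rfl
    · refine Finset.sum_congr rfl fun j hj => ?_
      have hj' := Finset.mem_of_mem_erase hj
      rw [h i hi j hj' (Finset.ne_of_mem_erase hj).symm, ih hj fun x hx y hy =>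
        h x (Finset.mem_of_mem_erase hx) y (Finset.mem_of_mem_erase hy)]

lemma stepWeight_zero : stepWeight 0 = 0 := by simp [stepWeight]

variable [Fintype V] (G : SimpleGraph V)

/-- The averaged step weights. -/
noncomputable def meanStep (a : ℝ) (i j : V) : ℝ≥0∞ := if G.Adj i j then stepMean a else 0

lemma measurable_sawSum_edgeW (n : ℕ) (S : Finset V) (i v : V) : Measurable fun w : Sym2 V → ℝ =>
    sawSum (fun i j => stepWeight (edgeW G w i j)) n S i v := by
  induction n generalizing S i with
  | zero => exact measurable_const
  | succ n ih =>
    simp only [sawSum]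
    split_ifs
    · exact measurable_const
    · exact Finset.measurable_fun_sum _ fun j _ => (measurable_stepWeight.comp
        (measurable_pi_iff.1 (measurable_pi_iff.1 (measurable_edgeW G) i) j)).mul (ih _ _)

lemma lintegral_sawSum {a : ℝ} (ha : 0 < a) (n : ℕ) (S : Finset V) (i v : V) :
    ∫⁻ w, sawSum (fun i j => stepWeight (edgeW G w i j)) n S i v ∂(weightMeasure a)
      = sawSum (meanStep G a) n S i v := by
  have := ProbabilityTheory.isProbabilityMeasure_gammaMeasure ha one_pos
  have hp := isProbabilityMeasure_weightMeasure (V := V) ha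
  induction n generalizing S i with
  | zero => simp [sawSum]
  | succ n ih =>
    simp only [sawSum]
    split_ifs
    · simp
    · have hm : ∀ j ∈ S.erase i, Measurable fun w : Sym2 V → ℝ => stepWeight (edgeW G w i j) *
          sawSum (fun i j => stepWeight (edgeW G w i j)) n (S.erase i) j v := fun j _ =>
        (measurable_stepWeight.comp
          (measurable_pi_iff.1 (measurable_pi_iff.1 (measurable_edgeW G) i) j)).mul
          (measurable_sawSum_edgeW G _ _ _ _)
      rw [lintegral_finsetSum _ hm]
      refine Finset.sum_congr rfl fun j hj => ?_
      rw [meanStep]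
      by_cases hij : G.Adj i j
      · rw [if_pos hij, ← ih]
        have h1 : ∀ w : Sym2 V → ℝ,
            stepWeight (edgeW G w i j) = stepWeight |w s(i, j)| := fun w => by
          rw [edgeW, if_pos hij]
        simp_rw [h1]
        rw [weightMeasure, lintegral_pi_mul (e := s(i, j)) (f := fun x => stepWeight |x|)
          (measurable_stepWeight.comp measurable_norm) (measurable_sawSum_edgeW G _ _ _ _)]
        · congr 1
          refine lintegral_congr_ae ?_
          filter_upwards [ae_pos_gammaMeasure a] with x hx
          rw [abs_of_pos hx]
        · refine fun w y => sawSum_congr hj fun k hk l hl _ => ?_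
          have hne : s(k, l) ≠ s(i, j) := fun h => by
            rcases Sym2.eq_iff.1 h with ⟨h1, _⟩ | ⟨_, h2⟩
            · exact Finset.ne_of_mem_erase hk h1
            · exact Finset.ne_of_mem_erase hl h2
          simp only [edgeW, update_of_ne hne]
      · simp [edgeW, hij, stepWeight_zero]

lemma lintegral_env_sqrt_le (o : V) {a : ℝ} (ha : 0 < a) {v : V} (hv : o ≠ v) :
    ∫⁻ p, ENNReal.ofReal √(rootField (edgeW G p.1) o p.2 v) ∂(env G o a)
      ≤ sawSum (meanStep G a) (Fintype.card V + 1) Finset.univ o v := by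
  rw [lintegral_env G o a (measurable_env_rootField G o v).sqrt.ennreal_ofReal,
    ← lintegral_sawSum G ha]
  refine lintegral_mono fun w => ?_
  simp only [sawSum, if_neg hv]
  have hW := isWeight_edgeW G w
  set W := edgeW G w with hWdef
  set S : Finset V := Finset.univ.erase o with hS
  have hmd := measurable_potDensity_right hW S (W o) 1
  have hmi : ∀ j, Measurable fun b : V → ℝ => ENNReal.ofReal (potDensity W S (W o) 1 b) *
      ENNReal.ofReal √((hmat W b S)⁻¹ j v) := fun j =>
    hmd.mul (measurable_hmat_inv S j v).sqrt.ennreal_ofReal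
  calc ∫⁻ b, ENNReal.ofReal (potDensity W S (W o) 1 b) * ENNReal.ofReal √(rootField W o b v)
        ∂(Measure.pi (rootMeasure o))
      ≤ ∫⁻ b, ∑ j ∈ S, ENNReal.ofReal √(W o j) * (ENNReal.ofReal (potDensity W S (W o) 1 b) *
        ENNReal.ofReal √((hmat W b S)⁻¹ j v)) ∂(Measure.pi (rootMeasure o)) := by
        refine lintegral_mono fun b => ?_
        have hz : rootField W o b v = ∑ j ∈ S, W o j * (hmat W b S)⁻¹ j v := by
          rw [rootField_of_ne hv.symm, ← peelDir_apply hW]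
          rfl
        rw [hz]
        simp_rw [mul_left_comm (ENNReal.ofReal √(W o _))]
        rw [← Finset.mul_sum]
        refine mul_le_mul_right ?_ _
        refine (ENNReal.ofReal_le_ofReal (sqrt_sum_le S _)).trans ?_
        rw [ENNReal.ofReal_sum_of_nonneg fun _ _ => sqrt_nonneg _]
        refine Finset.sum_le_sum fun j _ => ?_
        rw [sqrt_mul (hW.nonneg o j), ENNReal.ofReal_mul (sqrt_nonneg _)]
    _ = ∑ j ∈ S, ENNReal.ofReal √(W o j) * ∫⁻ b, ENNReal.ofReal (potDensity W S (W o) 1 b) *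
        ENNReal.ofReal √((hmat W b S)⁻¹ j v) ∂(Measure.pi (rootMeasure o)) := by
        rw [lintegral_finsetSum _ fun j _ => (hmi j).const_mul _]
        exact Finset.sum_congr rfl fun j _ => lintegral_const_mul' _ _ ENNReal.ofReal_ne_top
    _ ≤ _ := by
        refine Finset.sum_le_sum fun j hj => ?_
        rcases (hW.nonneg o j).eq_or_lt with h0 | h0
        · simp [← h0]
        · rw [stepWeight, mul_assoc, lintegral_rootMeasure o (hmi j)]
          exact mul_le_mul_right (lmarginal_potDensity_sqrt_le_sawSum hW _ (Finset.card_le_univ S)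
            (fun i hi => rootMeasure_of_mem o hi) hj (hW.nonneg o) h0 v 0) _

end ERRWZ2

namespace ERRWZ2

open Set Real Function Matrix

variable {V : Type*} [Fintype V] [DecidableEq V] (G : SimpleGraph V) (o : V)

/-- The Green function of the environment, killed at the root. -/
noncomputable def green (p : (Sym2 V → ℝ) × (V → ℝ)) (j v : V) : ℝ :=
  (hmat (edgeW G p.1) p.2 (Finset.univ.erase o))⁻¹ j v

/-- The harmonic-measure quotient of `v`, seen from `j`. -/
noncomputable def greenRatio (p : (Sym2 V → ℝ) × (V → ℝ)) (v j : V) : ℝ :=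
  green G o p j v * rootField (edgeW G p.1) o p.2 v /
    (rootField (edgeW G p.1) o p.2 j * green G o p v v)

/-- A superharmonic upper bound for the probability to hit `B` before the root. -/
noncomputable def escape (B : Finset V) (p : (Sym2 V → ℝ) × (V → ℝ)) (j : V) : ℝ :=
  min 1 (∑ v ∈ B, greenRatio G o p v j)

lemma measurable_green (j v : V) : Measurable fun p => green G o p j v := by
  have h : Measurable fun p : (Sym2 V → ℝ) × (V → ℝ) => edgeW G p.1 :=
    (measurable_edgeW G).comp measurable_fst
  exact measurable_matrix_inv (measurable_hmat h measurable_snd _) j v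

lemma measurable_escape (B : Finset V) (j : V) : Measurable fun p => escape G o B p j := by
  refine measurable_const.min (Finset.measurable_fun_sum _ fun v _ => ?_)
  exact ((measurable_green G o j v).mul (measurable_env_rootField G o v)).div
    ((measurable_env_rootField G o j).mul (measurable_green G o v v))

lemma measurable_jump (i j : V) : Measurable fun p => jump G o p i j :=
  (((measurable_pi_iff.1 (measurable_pi_iff.1 ((measurable_edgeW G).comp measurable_fst) i) j)).mul
    (measurable_env_rootField G o j)).div
    ((measurable_env_rootPot G o i).mul (measurable_env_rootField G o i))

variable {G o} {p : (Sym2 V → ℝ) × (V → ℝ)}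

namespace GoodEnv

lemma green_nonneg (h : GoodEnv G o p) (j v : V) : 0 ≤ green G o p j v :=
  hmat_inv_nonneg (isWeight_edgeW G p.1) h.2 j v

lemma green_root (h : GoodEnv G o p) {v : V} (hv : v ≠ o) : green G o p o v = 0 := by
  have h1 := hmat_inv_mulVec_of_notMem h.2 (Finset.notMem_erase o Finset.univ) (Pi.single v 1)
  rw [mulVec_single_one, Matrix.col_apply, Pi.single_eq_of_ne hv.symm] at h1
  exact h1

lemma sum_edgeW_mul_green (h : GoodEnv G o p) {v : V} (hv : v ≠ o) {i : V} (hi : i ≠ o) :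
    ∑ j, edgeW G p.1 i j * green G o p j v
      = p.2 i * green G o p i v - if i = v then 1 else 0 := by
  have h1 := congrFun (hmat_mulVec_inv h.2 (Pi.single v 1)) i
  rw [hmat_mulVec_of_mem (by simp [hi])] at h1
  simp only [mulVec_single_one, Matrix.col_apply, Pi.single_apply] at h1
  rw [sum_eq_root_add _ o, h.green_root hv, ← h1]
  simp [green]

lemma sum_root_mul_green (h : GoodEnv G o p) {v : V} (hv : v ≠ o) :
    ∑ j, edgeW G p.1 o j * green G o p j v = rootField (edgeW G p.1) o p.2 v := by
  rw [sum_eq_root_add _ o, h.green_root hv, mul_zero, zero_add, rootField_of_ne hv]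
  exact (peelDir_apply (isWeight_edgeW G p.1) v).symm

lemma one_le_pot_mul_green (h : GoodEnv G o p) {v : V} (hv : v ≠ o) :
    1 ≤ p.2 v * green G o p v v := by
  have h1 := h.sum_edgeW_mul_green hv hv
  rw [if_pos rfl] at h1
  have h2 : 0 ≤ ∑ j, edgeW G p.1 v j * green G o p j v := Finset.sum_nonneg fun j _ =>
    mul_nonneg ((isWeight_edgeW G p.1).nonneg v j) (h.green_nonneg j v)
  linarith

variable [Nontrivial V]

lemma pot_pos (h : GoodEnv G o p) (hG : G.Connected) {v : V} (hv : v ≠ o) : 0 < p.2 v := by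
  have := h.rootPot_pos hG v
  rwa [rootPot_of_ne hv] at this

lemma green_pos (h : GoodEnv G o p) (hG : G.Connected)
    {v : V} (hv : v ≠ o) : 0 < green G o p v v := by
  have h1 := h.one_le_pot_mul_green hv
  exact pos_of_mul_pos_right (zero_lt_one.trans_le h1) (h.pot_pos hG hv).le

lemma jump_nonneg (h : GoodEnv G o p) (hG : G.Connected) (i j : V) : 0 ≤ jump G o p i j :=
  div_nonneg (mul_nonneg ((isWeight_edgeW G p.1).nonneg i j) (h.rootField_pos hG j).le)
    (mul_nonneg (h.rootPot_pos hG i).le (h.rootField_pos hG i).le)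

lemma sum_jump (h : GoodEnv G o p) (hG : G.Connected) (i : V) : ∑ j, jump G o p i j = 1 := by
  unfold jump
  rw [← Finset.sum_div, ← rootPot_mul_rootField (isWeight_edgeW G p.1) h.2, div_self]
  exact (mul_pos (h.rootPot_pos hG i) (h.rootField_pos hG i)).ne'

lemma jump_mul_greenRatio (h : GoodEnv G o p) (hG : G.Connected) {v i j : V} :
    jump G o p i j * greenRatio G o p v j = edgeW G p.1 i j * green G o p j v *
      (rootField (edgeW G p.1) o p.2 v / (rootPot (edgeW G p.1) o p.2 i *
        rootField (edgeW G p.1) o p.2 i * green G o p v v)) := by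
  have h1 := (h.rootField_pos hG j).ne'
  rw [jump, greenRatio, mul_div_assoc']
  generalize rootPot (edgeW G p.1) o p.2 i * rootField (edgeW G p.1) o p.2 i = x
  generalize green G o p v v = y
  generalize rootField (edgeW G p.1) o p.2 j = z at *
  generalize green G o p j v = g
  generalize rootField (edgeW G p.1) o p.2 v = q
  rw [div_mul_eq_mul_div, div_div, mul_div_assoc']
  rw [show edgeW G p.1 i j * z * (g * q) = z * (edgeW G p.1 i j * g * q) by ring,
    show x * (z * y) = z * (x * y) by ring, mul_div_mul_left _ _ h1]

lemma greenRatio_nonneg (h : GoodEnv G o p) (hG : G.Connected)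
    (v j : V) : 0 ≤ greenRatio G o p v j :=
  div_nonneg (mul_nonneg (h.green_nonneg j v) (h.rootField_pos hG v).le)
    (mul_nonneg (h.rootField_pos hG j).le (h.green_nonneg v v))

lemma greenRatio_self (h : GoodEnv G o p) (hG : G.Connected)
    {v : V} (hv : v ≠ o) : greenRatio G o p v v = 1 := by
  have h1 := h.rootField_pos hG v
  have h2 := h.green_pos hG hv
  rw [greenRatio, mul_comm, div_self (by positivity)]

lemma sum_jump_mul_greenRatio_le (h : GoodEnv G o p) (hG : G.Connected)
    {v i : V} (hv : v ≠ o) (hi : i ≠ o) :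
    ∑ j, jump G o p i j * greenRatio G o p v j ≤ greenRatio G o p v i := by
  have h1 := h.rootField_pos hG v
  have h2 := h.green_pos hG hv
  have h3 := h.rootField_pos hG i
  have h4 := h.pot_pos hG hi
  simp_rw [h.jump_mul_greenRatio hG]
  rw [← Finset.sum_mul, h.sum_edgeW_mul_green hv hi, rootPot_of_ne hi]
  refine (mul_le_mul_of_nonneg_right (sub_le_self _ (by split_ifs <;> norm_num))
    (by positivity)).trans (le_of_eq ?_)
  rw [greenRatio]
  field_simp

lemma sum_root_jump_mul_greenRatio_le (h : GoodEnv G o p) (hG : G.Connected) {v : V} (hv : v ≠ o) :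
    ∑ j, jump G o p o j * greenRatio G o p v j
      ≤ p.2 v * rootField (edgeW G p.1) o p.2 v ^ 2 / rootPot (edgeW G p.1) o p.2 o := by
  have h1 := h.rootField_pos hG v
  have h2 := h.green_pos hG hv
  have h3 := h.rootPot_pos hG o
  have h4 := h.one_le_pot_mul_green hv
  simp_rw [h.jump_mul_greenRatio hG]
  rw [← Finset.sum_mul, h.sum_root_mul_green hv, rootField_self, mul_one, mul_div_assoc',
    div_le_div_iff₀ (by positivity) h3]
  generalize rootField (edgeW G p.1) o p.2 v = x at *
  have : x ^ 2 * rootPot (edgeW G p.1) o p.2 o * 1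
      ≤ x ^ 2 * rootPot (edgeW G p.1) o p.2 o * (p.2 v * green G o p v v) := by gcongr
  linarith

lemma escape_nonneg (h : GoodEnv G o p) (hG : G.Connected)
    (B : Finset V) (j : V) : 0 ≤ escape G o B p j :=
  le_min zero_le_one (Finset.sum_nonneg fun v _ => h.greenRatio_nonneg hG v j)

lemma escape_eq_one (h : GoodEnv G o p) (hG : G.Connected)
    {B : Finset V} (hB : o ∉ B) {v : V} (hv : v ∈ B) : escape G o B p v = 1 := by
  refine min_eq_left ?_
  rw [← h.greenRatio_self hG (v := v) (fun h => hB (h ▸ hv))]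
  exact Finset.single_le_sum (f := fun w => greenRatio G o p w v)
    (fun w _ => h.greenRatio_nonneg hG w v) hv

lemma sum_jump_mul_escape_le_sum (h : GoodEnv G o p) (hG : G.Connected) (B : Finset V)
    (i : V) : ∑ j, jump G o p i j * escape G o B p j
      ≤ min 1 (∑ v ∈ B, ∑ j, jump G o p i j * greenRatio G o p v j) := by
  refine le_min ?_ ?_
  · rw [← h.sum_jump hG i]
    exact Finset.sum_le_sum fun j _ =>
      mul_le_of_le_one_right (h.jump_nonneg hG i j) (min_le_left _ _)
  · rw [Finset.sum_comm]
    refine Finset.sum_le_sum fun j _ => ?_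
    rw [← Finset.mul_sum]
    exact mul_le_mul_of_nonneg_left (min_le_right _ _) (h.jump_nonneg hG i j)

lemma sum_jump_mul_escape_le (h : GoodEnv G o p) (hG : G.Connected)
    {B : Finset V} (hB : o ∉ B) {i : V} (hi : i ≠ o) :
    ∑ j, jump G o p i j * escape G o B p j ≤ escape G o B p i := by
  refine (h.sum_jump_mul_escape_le_sum hG B i).trans (min_le_min_left _ ?_)
  exact Finset.sum_le_sum fun v hv =>
    h.sum_jump_mul_greenRatio_le hG (fun h => hB (h ▸ hv)) hi

lemma sum_root_jump_mul_escape_le (h : GoodEnv G o p) (hG : G.Connected)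
    {B : Finset V} (hB : o ∉ B) :
    ∑ j, jump G o p o j * escape G o B p j ≤ ∑ v ∈ B, min 1 (p.2 v *
      rootField (edgeW G p.1) o p.2 v ^ 2 / rootPot (edgeW G p.1) o p.2 o) := by
  refine (h.sum_jump_mul_escape_le_sum hG B o).trans ?_
  have hnn : ∀ v, 0 ≤ ∑ j, jump G o p o j * greenRatio G o p v j := fun v =>
    Finset.sum_nonneg fun j _ => mul_nonneg (h.jump_nonneg hG o j) (h.greenRatio_nonneg hG v j)
  have hmin : min 1 (∑ v ∈ B, ∑ j, jump G o p o j * greenRatio G o p v j)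
      ≤ ∑ v ∈ B, min 1 (∑ j, jump G o p o j * greenRatio G o p v j) := by
    clear hB
    induction B using Finset.induction_on with
    | empty => simp
    | insert v B hv ih =>
      rw [Finset.sum_insert hv, Finset.sum_insert hv]
      refine le_trans ?_ (add_le_add_right ih _)
      have h1 := hnn v
      have h2 := Finset.sum_nonneg fun v (_ : v ∈ B) => hnn v
      rcases min_cases 1 (∑ j, jump G o p o j * greenRatio G o p v j) with h3 | h3 <;>
      rcases min_cases 1 (∑ v ∈ B, ∑ j, jump G o p o j * greenRatio G o p v j) with h4 | h4 <;>
      rw [h3.1, h4.1] <;>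
      first
        | exact min_le_right _ _
        | exact (min_le_left _ _).trans (by linarith)
  exact hmin.trans (Finset.sum_le_sum fun v hv => min_le_min_left _
    (h.sum_root_jump_mul_greenRatio_le hG fun h => hB (h ▸ hv)))

end GoodEnv

end ERRWZ2

namespace ERRWZ2

open Set Real Function

variable {V : Type*} [Fintype V] [DecidableEq V] (G : SimpleGraph V) (o : V)

lemma lintegral_env_exp {a : ℝ} (ha : 0 < a) (hG : G.Connected) (i : V) {s : ℝ} (hs : 0 < s) :
    ∫⁻ p, ENNReal.ofReal (exp (-((s - 1) * rootPot (edgeW G p.1) o p.2 i) / 2)) ∂(env G o a)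
      = ENNReal.ofReal (s ^ (-((wdeg G (fun _ => a) i + 1 - if i = o then 1 else 0) / 2))) := by
  have h := lintegral_env_moment G o ha hG (t := update (fun _ => 1) i s) (fun j => by
    rcases eq_or_ne j i with rfl | hj <;> simp [*]) (fun _ => 0) o
  have h1 : ∏ j, update (fun _ => (1 : ℝ)) i s j ^ (-momentExp G a (fun _ => 0) o j)
      = s ^ (-((wdeg G (fun _ => a) i + 1 - if i = o then 1 else 0) / 2)) := by
    rw [Finset.prod_eq_single i (fun j _ hj => by simp [hj]) (by simp)]
    simp [momentExp]
  have h2 : gammaRatio G a (fun _ => 0) = 1 := by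
    refine Finset.prod_eq_one fun e _ => ?_
    simp [(Gamma_pos_of_pos ha).ne']
  have h3 : ∀ p : (Sym2 V → ℝ) × (V → ℝ), ∑ j, (update (fun _ => (1 : ℝ)) i s j - 1) *
      rootPot (edgeW G p.1) o p.2 j = (s - 1) * rootPot (edgeW G p.1) o p.2 i := fun p => by
    rw [Finset.sum_eq_single i (fun j _ hj => by simp [hj]) (by simp)]
    simp
  rw [h1, h2, one_mul] at h
  simpa [h3, rootField_self] using h

lemma min_one_le {A b u δ : ℝ} (hA : 0 < A) (hu : 0 < u) (hδ : 0 < δ) :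
    min 1 (b * u ^ 2 / A) ≤ 3 * exp (-(A / δ)) + 3 * δ * exp (3 / 8 * b) + √u / √δ := by
  have e1 : 0 < 3 * exp (-(A / δ)) := by positivity
  have e2 : 0 < 3 * δ * exp (3 / 8 * b) := by positivity
  have e3 : 0 < √u / √δ := by positivity
  by_cases h1 : A ≤ δ
  · have h2 : exp (-1) ≤ exp (-(A / δ)) := by
      rw [exp_le_exp, neg_le_neg_iff, div_le_one hδ]
      exact h1
    have h3 : 1 ≤ 3 * exp (-1) := by
      rw [exp_neg, ← div_eq_mul_inv, le_div_iff₀ (exp_pos 1)]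
      linarith [exp_one_lt_three]
    linarith [min_le_left 1 (b * u ^ 2 / A)]
  by_cases h2 : 1 ≤ δ * b
  · have h3 := add_one_le_exp (3 / 8 * b)
    have h4 : 3 * δ * (3 / 8 * b + 1) ≤ 3 * δ * exp (3 / 8 * b) := by gcongr
    have h5 : 1 ≤ 3 * δ * (3 / 8 * b + 1) := by nlinarith
    linarith [min_le_left 1 (b * u ^ 2 / A)]
  push Not at h1 h2
  have h3 : b * u ^ 2 / A ≤ (u / δ) ^ 2 := by
    rw [div_pow, div_le_div_iff₀ hA (by positivity)]
    have h4 : u ^ 2 * ((δ * b) * δ) ≤ u ^ 2 * (1 * A) := by gcongr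
    nlinarith
  rw [← sqrt_div hu.le] at e3 ⊢
  have h4 : min 1 (b * u ^ 2 / A) ≤ √(u / δ) := by
    rcases le_total 1 (u / δ) with h5 | h5
    · exact (min_le_left _ _).trans (one_le_sqrt.2 h5)
    · refine (min_le_right _ _).trans (h3.trans ?_)
      refine le_sqrt_of_sq_le ?_
      have h6 : 0 < u / δ := by positivity
      calc ((u / δ) ^ 2) ^ 2 = (u / δ) ^ 4 := by ring
        _ ≤ (u / δ) ^ 1 := pow_le_pow_of_le_one h6.le h5 (by norm_num)
        _ = u / δ := pow_one _
  linarith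

variable [Nontrivial V]

/-- The expected harmonic measure of a single vertex, given the decay of the field there. -/
lemma lintegral_env_min_le {a : ℝ} (ha : 0 < a) (hG : G.Connected) {v : V} (hv : v ≠ o)
    {δ : ℝ} (hδ : 0 < δ) (hδ1 : δ ≤ 1) (ho : a ≤ wdeg G (fun _ => a) o)
    (hdeg : wdeg G (fun _ => a) v ≤ 4 * a)
    (hsq : ∫⁻ p, ENNReal.ofReal √(rootField (edgeW G p.1) o p.2 v) ∂(env G o a)
      ≤ ENNReal.ofReal (8 * δ)) :
    ∫⁻ p, ENNReal.ofReal (min 1 (p.2 v * rootField (edgeW G p.1) o p.2 v ^ 2 /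
        rootPot (edgeW G p.1) o p.2 o)) ∂(env G o a)
      ≤ ENNReal.ofReal (3 * δ ^ (a / 2) + 3 * (1 / 4) ^ (-((4 * a + 1) / 2)) * δ + 8 * √δ) := by
  have m1 : Measurable fun p : (Sym2 V → ℝ) × (V → ℝ) =>
      ENNReal.ofReal (exp (-((1 + 2 / δ - 1) * rootPot (edgeW G p.1) o p.2 o) / 2)) :=
    ((((measurable_env_rootPot G o o).const_mul _).neg.div_const _).exp).ennreal_ofReal
  have m2 : Measurable fun p : (Sym2 V → ℝ) × (V → ℝ) =>
      ENNReal.ofReal (exp (-((1 / 4 - 1) * rootPot (edgeW G p.1) o p.2 v) / 2)) :=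
    ((((measurable_env_rootPot G o v).const_mul _).neg.div_const _).exp).ennreal_ofReal
  have i1 := lintegral_env_exp G o ha hG o (s := 1 + 2 / δ) (by positivity)
  have i2 := lintegral_env_exp G o ha hG v (s := 1 / 4) (by norm_num)
  rw [if_pos rfl, add_sub_cancel_right] at i1
  rw [if_neg hv, sub_zero] at i2
  have b1 : (1 + 2 / δ) ^ (-(wdeg G (fun _ => a) o / 2)) ≤ δ ^ (a / 2) := by
    rw [rpow_neg (by positivity), ← inv_rpow (by positivity)]
    have h1 : (1 + 2 / δ)⁻¹ ≤ δ := by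
      rw [inv_le_comm₀ (by positivity) hδ, inv_eq_one_div]
      have : 1 / δ ≤ 2 / δ := by gcongr; norm_num
      linarith
    refine (rpow_le_rpow (by positivity) h1 (by linarith)).trans ?_
    exact rpow_le_rpow_of_exponent_ge hδ hδ1 (by linarith)
  have b2 : (1 / 4 : ℝ) ^ (-((wdeg G (fun _ => a) v + 1) / 2))
      ≤ (1 / 4) ^ (-((4 * a + 1) / 2)) :=
    rpow_le_rpow_of_exponent_ge (by norm_num) (by norm_num) (by linarith)
  have hpt : ∀ᵐ p ∂(env G o a), ENNReal.ofReal (min 1 (p.2 v *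
      rootField (edgeW G p.1) o p.2 v ^ 2 / rootPot (edgeW G p.1) o p.2 o)) ≤
      ENNReal.ofReal 3 * ENNReal.ofReal (exp (-((1 + 2 / δ - 1) *
          rootPot (edgeW G p.1) o p.2 o) / 2)) +
      ENNReal.ofReal (3 * δ) * ENNReal.ofReal (exp (-((1 / 4 - 1) *
          rootPot (edgeW G p.1) o p.2 v) / 2)) +
      ENNReal.ofReal (1 / √δ) * ENNReal.ofReal √(rootField (edgeW G p.1) o p.2 v) := by
    filter_upwards [ae_goodEnv G o ha] with p h
    have hb := h.pot_pos hG hv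
    have := min_one_le (b := p.2 v) (h.rootPot_pos hG o) (h.rootField_pos hG v) hδ
    rw [← ENNReal.ofReal_mul (by norm_num), ← ENNReal.ofReal_mul (by positivity),
      ← ENNReal.ofReal_mul (by positivity), ← ENNReal.ofReal_add (by positivity) (by positivity),
      ← ENNReal.ofReal_add (by positivity) (by positivity), rootPot_of_ne hv]
    refine ENNReal.ofReal_le_ofReal (this.trans (le_of_eq ?_))
    have q1 : -(rootPot (edgeW G p.1) o p.2 o / δ)
        = -((1 + 2 / δ - 1) * rootPot (edgeW G p.1) o p.2 o) / 2 := by ring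
    have q2 : 3 / 8 * p.2 v = -((1 / 4 - 1) * p.2 v) / 2 := by ring
    rw [q1, q2, one_div_mul_eq_div]
  refine (lintegral_mono_ae hpt).trans ?_
  have m3 := m1.const_mul (ENNReal.ofReal 3)
  have m4 := m2.const_mul (ENNReal.ofReal (3 * δ))
  rw [lintegral_add_left (by exact m3.add m4), lintegral_add_left (by exact m3),
    lintegral_const_mul' _ _ ENNReal.ofReal_ne_top,
    lintegral_const_mul' _ _ ENNReal.ofReal_ne_top, lintegral_const_mul' _ _ ENNReal.ofReal_ne_top,
    i1, i2]
  refine (add_le_add (add_le_add (mul_le_mul_right (ENNReal.ofReal_le_ofReal b1) _)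
    (mul_le_mul_right (ENNReal.ofReal_le_ofReal b2) _)) (mul_le_mul_right hsq _)).trans
    (le_of_eq ?_)
  have hp : (0 : ℝ) < (1 / 4) ^ (-((4 * a + 1) / 2)) := by positivity
  rw [← ENNReal.ofReal_mul (by norm_num), ← ENNReal.ofReal_mul (by positivity),
    ← ENNReal.ofReal_mul (by positivity), ← ENNReal.ofReal_add (by positivity) (by positivity),
    ← ENNReal.ofReal_add (by positivity) (by positivity)]
  congr 1
  have hs : 1 / √δ * (8 * δ) = 8 * √δ := by
    rw [one_div_mul_eq_div, div_eq_iff (by positivity), mul_assoc, mul_self_sqrt hδ.le]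
  rw [hs]
  ring

end ERRWZ2

namespace ERRWZ2

open Set Function

lemma sawSum_map {V V' : Type*} [DecidableEq V] [DecidableEq V'] (e : V ↪ V')
    (f : V' → V' → ℝ≥0∞) (n : ℕ) (S : Finset V) (i v : V) :
    sawSum f n (S.map e) (e i) (e v) = sawSum (fun a b => f (e a) (e b)) n S i v := by
  induction n generalizing S i with
  | zero => rfl
  | succ n ih => simp only [sawSum, e.injective.eq_iff, ← Finset.map_erase, Finset.sum_map, ih]

/-- The four unit vectors of the square lattice. -/
def unitVecs : Finset (ℤ × ℤ) := {(1, 0), (-1, 0), (0, 1), (0, -1)}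

lemma AdjG.exists_unitVec {r : ℕ} {x y : ℤ × ℤ} (h : AdjG r x y) : ∃ d ∈ unitVecs, y = x + d := by
  obtain ⟨x1, x2⟩ := x
  obtain ⟨y1, y2⟩ := y
  have h3 := h.2.2
  simp only at h3
  refine ⟨(y1 - x1, y2 - x2), ?_, by ext <;> simp⟩
  obtain ⟨s, rfl⟩ : ∃ s, y1 = x1 + s := ⟨y1 - x1, by ring⟩
  obtain ⟨t, rfl⟩ : ∃ t, y2 = x2 + t := ⟨y2 - x2, by ring⟩
  have hs : s ≤ 1 ∧ -1 ≤ s := ⟨by nlinarith, by nlinarith⟩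
  have ht : t ≤ 1 ∧ -1 ≤ t := ⟨by nlinarith, by nlinarith⟩
  obtain ⟨hs1, hs2⟩ := hs
  obtain ⟨ht1, ht2⟩ := ht
  interval_cases s <;> interval_cases t <;> simp_all [unitVecs]

/-- The vertex at distance `k` from the crossing `r • m` in direction `d`. -/
def segPt (r : ℕ) (m d : ℤ × ℤ) (k : ℕ) : ℤ × ℤ := (r * m.1 + k * d.1, r * m.2 + k * d.2)

lemma segPt_self (r : ℕ) (m d : ℤ × ℤ) : segPt r m d r = segPt r (m + d) d 0 := by
  simp [segPt, mul_add]

lemma segPt_zero_add (r : ℕ) (m d : ℤ × ℤ) : segPt r m d 0 + d = segPt r m d 1 := by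
  ext <;> simp [segPt]

lemma not_dvd_mul_add {r : ℕ} {k : ℕ} (hk : 0 < k) (hkr : k < r) (m : ℤ) :
    ¬ (r : ℤ) ∣ r * m + k := by
  rw [dvd_add_right (dvd_mul_right _ _), Int.natCast_dvd_natCast]
  exact Nat.not_dvd_of_pos_of_lt hk hkr

lemma not_dvd_mul_sub {r : ℕ} {k : ℕ} (hk : 0 < k) (hkr : k < r) (m : ℤ) :
    ¬ (r : ℤ) ∣ r * m - k := by
  rw [dvd_sub_right (dvd_mul_right _ _), Int.natCast_dvd_natCast]
  exact Nat.not_dvd_of_pos_of_lt hk hkr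

lemma AdjG.eq_segPt {r k : ℕ} {m d j : ℤ × ℤ} (hd : d ∈ unitVecs) (hk : 0 < k) (hkr : k < r)
    (h : AdjG r (segPt r m d k) j) : j = segPt r m d (k - 1) ∨ j = segPt r m d (k + 1) := by
  obtain ⟨d', hd', rfl⟩ := h.exists_unitVec
  have h2 := h.2.1
  obtain ⟨k, rfl⟩ : ∃ k', k = k' + 1 := ⟨k - 1, by omega⟩
  have hr : ¬ (r : ℤ) ∣ 1 := fun h => by
    have := Int.le_of_dvd one_pos h
    omega
  have n1 := not_dvd_mul_add hk hkr m.1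
  have n2 := not_dvd_mul_add hk hkr m.2
  have n3 := not_dvd_mul_sub hk hkr m.1
  have n4 := not_dvd_mul_sub hk hkr m.2
  have c1 : ¬ (r : ℤ) ∣ r * m.1 + 1 := by rwa [dvd_add_right (dvd_mul_right _ _)]
  have c2 : ¬ (r : ℤ) ∣ r * m.2 + 1 := by rwa [dvd_add_right (dvd_mul_right _ _)]
  have c3 : ¬ (r : ℤ) ∣ r * m.1 - 1 := by rwa [dvd_sub_right (dvd_mul_right _ _)]
  have c4 : ¬ (r : ℤ) ∣ r * m.2 - 1 := by rwa [dvd_sub_right (dvd_mul_right _ _)]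
  have n5 : ¬ (r : ℤ) ∣ -1 - k := by
    rw [← dvd_neg, show -(-1 - (k : ℤ)) = ((k + 1 : ℕ) : ℤ) by push_cast; ring,
      Int.natCast_dvd_natCast]
    exact Nat.not_dvd_of_pos_of_lt hk hkr
  simp only [Vr, Set.mem_ofPred_eq, segPt] at h2
  simp only [unitVecs, Finset.mem_insert, Finset.mem_singleton] at hd hd'
  push_cast at n1 n2 n3 n4 h2
  rcases hd with rfl | rfl | rfl | rfl <;> rcases hd' with rfl | rfl | rfl | rfl <;>
    simp_all [segPt, Prod.ext_iff, ← sub_eq_add_neg] <;> omega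

/-- The distance (in crossings) from the crossing `r • m` to the boundary of the box of size `l`. -/
def depth (l : ℕ) (m : ℤ × ℤ) : ℕ := l - max m.1.natAbs m.2.natAbs

lemma depth_sub_one_le {l : ℕ} {m d : ℤ × ℤ} (hd : d ∈ unitVecs) :
    depth l m - 1 ≤ depth l (m + d) := by
  simp only [unitVecs, Finset.mem_insert, Finset.mem_singleton] at hd
  rcases hd with rfl | rfl | rfl | rfl <;> simp only [depth, Prod.fst_add, Prod.snd_add] <;> omega

lemma depth_eq_zero {r l k : ℕ} {m d : ℤ × ℤ} (hd : d ∈ unitVecs) (hkr : k < r)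
    (h : linf (segPt r m d k) = r * l) : depth l m = 0 := by
  by_contra h0
  rw [depth] at h0
  have h1 : |m.1| ≤ l - 1 := by
    rw [Int.abs_eq_natAbs]
    omega
  have h2 : |m.2| ≤ l - 1 := by
    rw [Int.abs_eq_natAbs]
    omega
  have hd1 : |d.1| ≤ 1 ∧ |d.2| ≤ 1 := by
    simp only [unitVecs, Finset.mem_insert, Finset.mem_singleton] at hd
    rcases hd with rfl | rfl | rfl | rfl <;> simp
  have key : ∀ s t : ℤ, |s| ≤ l - 1 → |t| ≤ 1 → |(r : ℤ) * s + k * t| < r * l := fun s t hs ht => by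
    refine (abs_add_le _ _).trans_lt ?_
    rw [abs_mul, abs_mul, Nat.abs_cast, Nat.abs_cast]
    have e1 : (r : ℤ) * |s| ≤ r * (l - 1) := by gcongr
    have e2 : (k : ℤ) * |t| ≤ k * 1 := by gcongr
    have e3 : (k : ℤ) < r := by exact_mod_cast hkr
    linarith
  have := max_lt (key _ _ h1 hd1.1) (key _ _ h2 hd1.2)
  rw [linf, segPt] at h
  exact absurd h this.ne

variable {r l : ℕ} {c : ℝ≥0∞} {v : ℤ × ℤ}

/-- The constant step weight on the edges of the subdivided lattice. -/
noncomputable def latStep (r : ℕ) (c : ℝ≥0∞) (i j : ℤ × ℤ) : ℝ≥0∞ := if AdjG r i j then c else 0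

lemma sawSum_latStep_cross (hr : 0 < r) (hc : c ≤ 1) (hk : 4 * c ^ r ≤ 2⁻¹) (hv : linf v = r * l)
    {n : ℕ} (ih : ∀ (S : Finset (ℤ × ℤ)) (m d : ℤ × ℤ), d ∈ unitVecs → ∀ k, 1 ≤ k → k ≤ r →
      segPt r m d (k - 1) ∉ S → sawSum (latStep r c) n S (segPt r m d k) v ≤
        (if ∃ k', k' < r ∧ v = segPt r m d k' then 1 else 0) +
          c ^ (r - k) * (8 * (4 * c ^ r) ^ (depth l m - 1)))
    (S : Finset (ℤ × ℤ)) (m d : ℤ × ℤ) :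
    sawSum (latStep r c) (n + 1) S (segPt r m d 0) v ≤ 8 * (4 * c ^ r) ^ depth l m := by
  set x := segPt r m d 0 with hx
  have hx' : ∀ d', segPt r m d' 0 = x := fun d' => by simp [hx, segPt]
  set κ := 4 * c ^ r with hκ
  have hd0 : (1, 0) ∈ unitVecs := by simp [unitVecs]
  rw [sawSum]
  split_ifs with hxv
  · have := depth_eq_zero (l := l) (m := m) hd0 hr (by rw [hx', hxv, hv])
    rw [this, pow_zero, mul_one]
    norm_num
  have hle : ∑ j ∈ S.erase x, latStep r c x j * sawSum (latStep r c) n (S.erase x) j v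
      ≤ ∑ d ∈ unitVecs, c * sawSum (latStep r c) n (S.erase x) (x + d) v := by
    rw [← Finset.sum_image (s := unitVecs) (g := fun d => x + d)
      (f := fun j => c * sawSum (latStep r c) n (S.erase x) j v)
      (fun _ _ _ _ h => add_left_cancel h)]
    calc _ ≤ ∑ j ∈ unitVecs.image (fun d => x + d),
          latStep r c x j * sawSum (latStep r c) n (S.erase x) j v := by
          refine Finset.sum_le_sum_of_ne_zero fun j _ hj => ?_
          have : AdjG r x j := by
            by_contra h
            simp [latStep, h] at hj
          obtain ⟨d', hd', rfl⟩ := this.exists_unitVec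
          exact Finset.mem_image_of_mem _ hd'
      _ ≤ _ := by
          refine Finset.sum_le_sum fun j _ => mul_le_mul_left ?_ _
          rw [latStep]
          split_ifs <;> simp
  refine hle.trans ?_
  have hterm : ∀ d' ∈ unitVecs, c * sawSum (latStep r c) n (S.erase x) (x + d') v ≤
      (if depth l m = 0 then 1 else 0) + c ^ r * (8 * κ ^ (depth l m - 1)) := fun d' hd' => by
    have h := ih (S.erase x) m d' hd' 1 le_rfl hr (by simp [hx'])
    rw [← segPt_zero_add, hx'] at h
    refine (mul_le_mul_right h c).trans ?_
    rw [mul_add]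
    refine add_le_add ?_ (le_of_eq ?_)
    · refine (mul_le_of_le_one_left' hc).trans ?_
      split_ifs with h1 h2
      · rfl
      · obtain ⟨k', hk', rfl⟩ := h1
        exact absurd (depth_eq_zero hd' hk' hv) h2
      · simp
      · rfl
    · rw [← mul_assoc, ← pow_succ', Nat.sub_add_cancel hr]
  refine (Finset.sum_le_sum hterm).trans ?_
  rw [Finset.sum_const, show unitVecs.card = 4 from rfl, nsmul_eq_mul, mul_add, ← mul_assoc]
  norm_cast
  split_ifs with h0
  · rw [h0, pow_zero]
    push_cast
    rw [← hκ]
    calc 4 + κ * (8 * 1) ≤ 4 + 2⁻¹ * (8 * 1) := by gcongr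
      _ = 4 + 2⁻¹ * (2 * 4) := by norm_num
      _ = 8 * 1 := by
        rw [← mul_assoc, ENNReal.inv_mul_cancel (by norm_num) (by norm_num)]
        norm_num
  · push_cast
    rw [← hκ, zero_add, mul_left_comm, ← pow_succ', Nat.sub_add_cancel (by omega)]

lemma sawSum_latStep_seg (hr : 0 < r) (hc : c ≤ 1) (hk : 4 * c ^ r ≤ 2⁻¹) (hv : linf v = r * l)
    (n : ℕ) (S : Finset (ℤ × ℤ)) (m d : ℤ × ℤ) (hd : d ∈ unitVecs) (k : ℕ) (hk1 : 1 ≤ k)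
    (hkr : k ≤ r) (hS : segPt r m d (k - 1) ∉ S) :
    sawSum (latStep r c) n S (segPt r m d k) v ≤
      (if ∃ k', k' < r ∧ v = segPt r m d k' then 1 else 0) +
        c ^ (r - k) * (8 * (4 * c ^ r) ^ (depth l m - 1)) := by
  induction n generalizing S m d k with
  | zero => simp [sawSum]
  | succ n ih =>
    rcases hkr.eq_or_lt with rfl | hkr'
    · rw [segPt_self]
      refine (sawSum_latStep_cross hr hc hk hv ih S (m + d) d).trans ?_
      rw [Nat.sub_self, pow_zero, one_mul]
      refine le_add_left (mul_le_mul_right ?_ _)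
      exact pow_le_pow_right_of_le_one' (hk.trans (by simp)) (depth_sub_one_le hd)
    · rw [sawSum]
      split_ifs with h1 h2 h2
      · exact le_self_add
      · exact absurd ⟨k, hkr', h1.symm⟩ h2
      all_goals
        have hle : ∑ j ∈ S.erase (segPt r m d k), latStep r c (segPt r m d k) j *
              sawSum (latStep r c) n (S.erase (segPt r m d k)) j v
            ≤ c * sawSum (latStep r c) n (S.erase (segPt r m d k)) (segPt r m d (k + 1)) v := by
          calc _ ≤ ∑ j ∈ {segPt r m d (k + 1)}, latStep r c (segPt r m d k) j *
                sawSum (latStep r c) n (S.erase (segPt r m d k)) j v := by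
                refine Finset.sum_le_sum_of_ne_zero fun j hj hj0 => ?_
                have hadj : AdjG r (segPt r m d k) j := by
                  by_contra h
                  simp [latStep, h] at hj0
                rcases hadj.eq_segPt hd hk1 hkr' with rfl | rfl
                · exact absurd (Finset.mem_of_mem_erase hj) hS
                · simp
            _ ≤ _ := by
                rw [Finset.sum_singleton]
                refine mul_le_mul_left ?_ _
                rw [latStep]
                split_ifs <;> simp
        refine hle.trans ((mul_le_mul_right (ih _ m d hd (k + 1) (by omega) hkr'
          (by simp)) c).trans ?_)
        simp only [h2, if_true, if_false]
        rw [mul_add, ← mul_assoc c (c ^ _), ← pow_succ', show r - (k + 1) + 1 = r - k by omega]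
        exact add_le_add_left (mul_le_of_le_one_left' hc) _

lemma sawSum_latStep_le (hr : 0 < r) (hc : c ≤ 1) (hk : 4 * c ^ r ≤ 2⁻¹) (hv : linf v = r * l)
    (n : ℕ) (S : Finset (ℤ × ℤ)) : sawSum (latStep r c) (n + 1) S (0, 0) v
      ≤ 8 * (4 * c ^ r) ^ l := by
  have h := sawSum_latStep_cross hr hc hk hv (sawSum_latStep_seg hr hc hk hv n) S (0, 0) (0, 0)
  simpa [segPt, depth] using h

end ERRWZ2

namespace ERRWZ2

open Set Function

/-- The vertices of the subdivided lattice in the box with boundary `linf v = r * l`. -/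
def boxSet (r l : ℕ) : Set (ℤ × ℤ) := {x | x ∈ Vr r ∧ linf x ≤ r * l}

lemma boxSet_subset (r l : ℕ) :
    boxSet r l ⊆ (Finset.Icc (-((r * l : ℕ) : ℤ)) (r * l : ℕ) ×ˢ
      Finset.Icc (-((r * l : ℕ) : ℤ)) (r * l : ℕ) : Finset (ℤ × ℤ)) := fun x hx => by
  have h := max_le_iff.1 hx.2
  have h1 := abs_le.1 h.1
  have h2 := abs_le.1 h.2
  simp only [Finset.mem_coe, Finset.mem_product, Finset.mem_Icc]
  push_cast
  exact ⟨h1, h2⟩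

noncomputable instance (r l : ℕ) : Fintype (boxSet r l) :=
  ((Finset.finite_toSet _).subset (boxSet_subset r l)).fintype

lemma card_boxSet_le (r l : ℕ) : Fintype.card (boxSet r l) ≤ (2 * (r * l) + 1) ^ 2 := by
  have h1 : (boxSet r l).toFinset ⊆ Finset.Icc (-((r * l : ℕ) : ℤ)) (r * l : ℕ) ×ˢ
      Finset.Icc (-((r * l : ℕ) : ℤ)) (r * l : ℕ) := by
    rw [← Finset.coe_subset, coe_toFinset]
    exact boxSet_subset r l
  have h := Finset.card_le_card h1
  rw [toFinset_card, Finset.card_product, Int.card_Icc, ← sq] at h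
  refine h.trans (Nat.pow_le_pow_left ?_ 2)
  omega

/-- The subdivided lattice restricted to a box. -/
def boxGraph (r l : ℕ) : SimpleGraph (boxSet r l) where
  Adj x y := AdjG r x y
  symm := ⟨fun x y h => ⟨h.2.1, h.1, by rw [← h.2.2]; ring⟩⟩
  loopless := ⟨fun x h => by simpa using h.2.2⟩

/-- The centre of the box. -/
def boxRoot (r l : ℕ) : boxSet r l := ⟨(0, 0), by simp [boxSet, Vr, linf]; positivity⟩

variable {r l : ℕ}

lemma AdjG.mem_boxSet {x y : ℤ × ℤ} (h : AdjG r x y) (hx : linf x < r * l) : y ∈ boxSet r l := by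
  refine ⟨h.2.1, ?_⟩
  obtain ⟨d, hd, rfl⟩ := h.exists_unitVec
  have h1 := abs_lt.1 (max_lt_iff.1 hx).1
  have h2 := abs_lt.1 (max_lt_iff.1 hx).2
  simp only [unitVecs, Finset.mem_insert, Finset.mem_singleton] at hd
  rcases hd with rfl | rfl | rfl | rfl <;> simp only [linf, Prod.fst_add, Prod.snd_add] <;>
    exact max_le (abs_le.2 ⟨by omega, by omega⟩) (abs_le.2 ⟨by omega, by omega⟩)

lemma exists_abs_sub_lt {x : ℤ} (hx : x ≠ 0) : ∃ y : ℤ, (x - y) ^ 2 = 1 ∧ |y| < |x| := by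
  rcases lt_or_gt_of_ne hx with h | h
  · exact ⟨x + 1, by ring, by rw [abs_lt]; constructor <;> rw [abs_of_neg h] <;> omega⟩
  · exact ⟨x - 1, by ring, by rw [abs_lt]; constructor <;> rw [abs_of_pos h] <;> omega⟩

lemma boxGraph_reachable (x : boxSet r l) : (boxGraph r l).Reachable x (boxRoot r l) := by
  induction hN : (|x.1.1| + |x.1.2|).toNat using Nat.strong_induction_on generalizing x with
  | _ N ih =>
    obtain ⟨⟨x1, x2⟩, hx, hb⟩ := x
    simp only at hN
    have hb' := max_le_iff.1 hb
    simp only at hb'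
    by_cases h1 : x1 ≠ 0 ∧ (r : ℤ) ∣ x2
    · obtain ⟨y, hy, hlt⟩ := exists_abs_sub_lt h1.1
      have hm : (y, x2) ∈ boxSet r l := ⟨Or.inr h1.2, max_le (hlt.le.trans hb'.1) hb'.2⟩
      have hadj : (boxGraph r l).Adj ⟨(x1, x2), hx, hb⟩ ⟨(y, x2), hm⟩ :=
        ⟨hx, hm.1, by simpa using hy⟩
      refine hadj.reachable.trans (ih _ ?_ _ rfl)
      have := abs_nonneg x2
      have := abs_nonneg y
      simp only
      omega
    by_cases h2 : x2 ≠ 0 ∧ (r : ℤ) ∣ x1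
    · obtain ⟨y, hy, hlt⟩ := exists_abs_sub_lt h2.1
      have hm : (x1, y) ∈ boxSet r l := ⟨Or.inl h2.2, max_le hb'.1 (hlt.le.trans hb'.2)⟩
      have hadj : (boxGraph r l).Adj ⟨(x1, x2), hx, hb⟩ ⟨(x1, y), hm⟩ :=
        ⟨hx, hm.1, by simpa using hy⟩
      refine hadj.reachable.trans (ih _ ?_ _ rfl)
      have := abs_nonneg x1
      have := abs_nonneg y
      simp only
      omega
    have h0 : x1 = 0 ∧ x2 = 0 := by
      by_contra h
      rcases hx with hx | hx <;> simp only at hx <;> by_cases e1 : x1 = 0 <;>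
        by_cases e2 : x2 = 0 <;> simp_all
    obtain ⟨rfl, rfl⟩ := h0
    exact SimpleGraph.Reachable.refl _

lemma boxGraph_connected : (boxGraph r l).Connected where
  preconnected x y := (boxGraph_reachable x).trans (boxGraph_reachable y).symm
  nonempty := ⟨boxRoot r l⟩

lemma nontrivial_boxSet (hr : 1 ≤ r) (hl : 1 ≤ l) : Nontrivial (boxSet r l) := by
  have h1 : (1 : ℤ) ≤ r * l := by exact_mod_cast Nat.mul_pos hr hl
  have h : ((1, 0) : ℤ × ℤ) ∈ boxSet r l := ⟨Or.inr (by simp), by simpa [linf] using h1⟩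
  exact ⟨boxRoot r l, ⟨_, h⟩, fun e => by simpa [boxRoot] using congrArg (fun x => x.1.1) e⟩

lemma wdeg_boxGraph_le {a : ℝ} (ha : 0 < a) (v : boxSet r l) :
    wdeg (boxGraph r l) (fun _ => a) v ≤ 4 * a := by
  have h : ∑ y ∈ Finset.univ.map (Embedding.subtype (· ∈ boxSet r l)), (if AdjG r v y then a else 0)
      ≤ ∑ y ∈ unitVecs.image (fun d => v.1 + d), a := by
    rw [← Finset.sum_filter]
    refine Finset.sum_le_sum_of_subset_of_nonneg (fun y hy => ?_) fun _ _ _ => ha.le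
    obtain ⟨d, hd, rfl⟩ := (Finset.mem_filter.1 hy).2.exists_unitVec
    exact Finset.mem_image_of_mem _ hd
  rw [Finset.sum_map, Finset.sum_const, nsmul_eq_mul] at h
  refine h.trans (mul_le_mul_of_nonneg_right ?_ ha.le)
  exact_mod_cast Finset.card_image_le

lemma le_wdeg_of_connected {V : Type*} [Fintype V] [Nontrivial V] {G : SimpleGraph V}
    (hG : G.Connected) {a : ℝ} (ha : 0 < a) (v : V) : a ≤ wdeg G (fun _ => a) v := by
  obtain ⟨j, hj⟩ := hG.preconnected.exists_adj_of_nontrivial v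
  have h := Finset.single_le_sum (f := fun j => if G.Adj v j then a else 0)
    (fun i _ => by split_ifs; exacts [ha.le, le_rfl]) (Finset.mem_univ j)
  rwa [if_pos hj] at h

lemma crossings_box (a : ℝ) (u : ℕ → boxSet r l) (n : ℕ) (x y : boxSet r l) :
    wt a (fun t => (u t : ℤ × ℤ)) n x y = a + crossings u n s(x, y) := by
  simp only [wt, crossings, Sym2.eq_iff, Subtype.coe_inj]

lemma totWt_box (a : ℝ) (u : ℕ → boxSet r l) {n : ℕ} (h : linf (u n) < r * l) :
    totWt r a (fun t => (u t : ℤ × ℤ)) n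
      = wdeg (boxGraph r l) (fun e => a + crossings u n e) (u n) := by
  set F : ℤ × ℤ → ℝ := fun y =>
    if AdjG r (u n) y then wt a (fun t => (u t : ℤ × ℤ)) n (u n) y else 0 with hF
  have h1 : totWt r a (fun t => (u t : ℤ × ℤ)) n
      = ∑ y ∈ unitVecs.image (fun d => (u n : ℤ × ℤ) + d), F y := by
    rw [Finset.sum_image (fun _ _ _ _ h => add_left_cancel h)]
    rfl
  have h2 : wdeg (boxGraph r l) (fun e => a + crossings u n e) (u n)
      = ∑ y ∈ Finset.univ.map (Embedding.subtype (· ∈ boxSet r l)), F y := by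
    rw [Finset.sum_map]
    refine Finset.sum_congr rfl fun j _ => ?_
    simp only [hF, Embedding.subtype_apply, crossings_box]
    rfl
  rw [h1, h2]
  refine Finset.sum_congr_of_eq_on_inter (fun y _ hy => ?_) (fun y _ hy => ?_) fun _ _ _ => rfl
  · refine if_neg fun hadj => hy ?_
    exact Finset.mem_map.2 ⟨⟨y, hadj.mem_boxSet h⟩, Finset.mem_univ _, rfl⟩
  · refine if_neg fun hadj => hy ?_
    obtain ⟨d, hd, rfl⟩ := hadj.exists_unitVec
    exact Finset.mem_image_of_mem _ hd

end ERRWZ2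

namespace ERRWZ2

open Set Function

/-- The boundary of the box. -/
noncomputable def boxBdry (r l : ℕ) : Finset (boxSet r l) :=
  Finset.univ.filter fun v => linf v = r * l

/-- The trajectories that follow `u` up to time `n`. -/
def cyl {S : Set (ℤ × ℤ)} (u : ℕ → S) (n : ℕ) : Set (ℕ → ℤ × ℤ) := {X | ∀ t ≤ n, X t = u t}

/-- The trajectories that hit the boundary of the box at some time in `[n, n + m]`, without
visiting the origin between time `n` and that time. -/
def hitSet (r l n m : ℕ) : Set (ℕ → ℤ × ℤ) :=
  {X | ∃ t, n ≤ t ∧ t ≤ n + m ∧ (X t ∈ Vr r ∧ linf (X t) = r * l) ∧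
    ∀ s, n ≤ s → s ≤ t → X s ≠ (0, 0)}

lemma mem_boxBdry {r l : ℕ} {v : boxSet r l} : v ∈ boxBdry r l ↔ linf v = r * l := by
  rw [boxBdry, Finset.mem_filter]
  exact and_iff_right (Finset.mem_univ v)

variable {r l : ℕ} {a : ℝ} {P : Measure (ℕ → ℤ × ℤ)}

lemma IsERRW.measure_cyl_inter_le (hP : IsERRW r a P) (u : ℕ → boxSet r l) {n : ℕ}
    (h : linf (u n) < r * l) (H : Set (ℕ → ℤ × ℤ)) :
    P (cyl u n ∩ H) ≤ ∑ j, if (boxGraph r l).Adj (u n) j then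
      P (cyl (update u (n + 1) j) (n + 1) ∩ H) else 0 := by
  set N : Set (ℕ → ℤ × ℤ) := ⋃ y ∈ {y | ¬ AdjG r (u n) y},
    {X | ∀ t ≤ n + 1, X t = update (fun t => (u t : ℤ × ℤ)) (n + 1) y t} with hN
  have hnull : P N = 0 := by
    refine (measure_biUnion_null_iff (to_countable _)).2 fun y hy => ?_
    rw [hP.2, if_neg]
    rintro ⟨_, h2⟩
    have := h2 n (Nat.lt_succ_self n)
    rw [update_self, update_of_ne (by omega)] at this
    exact hy this
  have hsub : cyl u n ∩ H ⊆ (⋃ j ∈ Finset.univ.filter fun j => (boxGraph r l).Adj (u n) j,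
      cyl (update u (n + 1) j) (n + 1) ∩ H) ∪ N := by
    rintro X ⟨hX, hH⟩
    by_cases hadj : AdjG r (u n) (X (n + 1))
    · have hadj' : (boxGraph r l).Adj (u n) ⟨X (n + 1), hadj.mem_boxSet h⟩ := hadj
      refine Or.inl (mem_biUnion (x := ⟨X (n + 1), hadj.mem_boxSet h⟩)
        (Finset.mem_coe.2 (Finset.mem_filter.2 ⟨Finset.mem_univ _, hadj'⟩)) ⟨fun t ht => ?_, hH⟩)
      · rcases eq_or_ne t (n + 1) with rfl | ht'
        · rw [update_self]
        · rw [update_of_ne ht', hX t (by omega)]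
    · refine Or.inr (mem_biUnion (x := X (n + 1)) hadj fun t ht => ?_)
      rcases eq_or_ne t (n + 1) with rfl | ht'
      · rw [update_self]
      · rw [update_of_ne ht', hX t (by omega)]
  refine (measure_mono hsub).trans ((measure_union_le _ _).trans ?_)
  rw [hnull, add_zero, ← Finset.sum_filter]
  exact measure_biUnion_finset_le _ _

/-- The quenched probability of the first `n` steps of the path `u`. -/
noncomputable def pathProd (u : ℕ → boxSet r l) (n : ℕ)
    (p : (Sym2 (boxSet r l) → ℝ) × (boxSet r l → ℝ)) : ℝ :=
  ∏ s ∈ Finset.range n, jump (boxGraph r l) (boxRoot r l) p (u s) (u (s + 1))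

lemma pathProd_update (u : ℕ → boxSet r l) (n : ℕ) (j : boxSet r l)
    (p : (Sym2 (boxSet r l) → ℝ) × (boxSet r l → ℝ)) :
    pathProd (update u (n + 1) j) (n + 1) p
      = pathProd u n p * jump (boxGraph r l) (boxRoot r l) p (u n) j := by
  rw [pathProd, Finset.prod_range_succ, update_self, update_of_ne (by omega)]
  congr 1
  refine Finset.prod_congr rfl fun s hs => ?_
  rw [Finset.mem_range] at hs
  rw [update_of_ne (by omega), update_of_ne (by omega)]

lemma measurable_pathProd (u : ℕ → boxSet r l) (n : ℕ) : Measurable (pathProd u n) :=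
  Finset.measurable_fun_prod _ fun _ _ => measurable_jump _ _ _ _

lemma IsERRW.measure_cyl [Nontrivial (boxSet r l)] (hP : IsERRW r a P) (ha : 0 < a)
    {u : ℕ → boxSet r l} {n : ℕ}
    (h0 : u 0 = boxRoot r l) (hu : ∀ s < n, (boxGraph r l).Adj (u s) (u (s + 1)))
    (hi : ∀ s < n, linf (u s) < r * l) :
    P (cyl u n) = ∫⁻ p, ENNReal.ofReal (pathProd u n p) ∂(env (boxGraph r l) (boxRoot r l) a) := by
  simp only [pathProd]
  rw [lintegral_env_jump _ _ ha boxGraph_connected h0 hu, cyl, hP.2 n, if_pos ⟨by rw [h0]; rfl, hu⟩]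
  congr 1
  refine Finset.prod_congr rfl fun s hs => ?_
  rw [totWt_box a u (hi s (Finset.mem_range.1 hs)), crossings_box]

lemma boxRoot_notMem_boxBdry (hr : 1 ≤ r) (hl : 1 ≤ l) : boxRoot r l ∉ boxBdry r l := by
  have h1 : (0 : ℤ) < r * l := by exact_mod_cast Nat.mul_pos hr hl
  rw [mem_boxBdry]
  exact h1.ne

lemma sum_lintegral_pathProd_update [Nontrivial (boxSet r l)] (ha : 0 < a) (u : ℕ → boxSet r l)
    (n : ℕ) (B : Finset (boxSet r l)) :
    ∑ j, ∫⁻ p, ENNReal.ofReal (pathProd (update u (n + 1) j) (n + 1) p *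
        escape (boxGraph r l) (boxRoot r l) B p j) ∂(env (boxGraph r l) (boxRoot r l) a)
      = ∫⁻ p, ENNReal.ofReal (pathProd u n p *
          ∑ j, jump (boxGraph r l) (boxRoot r l) p (u n) j *
            escape (boxGraph r l) (boxRoot r l) B p j) ∂(env (boxGraph r l) (boxRoot r l) a) := by
  have hm : ∀ j ∈ Finset.univ, Measurable fun p =>
      ENNReal.ofReal (pathProd (update u (n + 1) j) (n + 1) p *
        escape (boxGraph r l) (boxRoot r l) B p j) := fun j _ =>
    ((measurable_pathProd _ _).mul (measurable_escape _ _ _ _)).ennreal_ofReal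
  rw [← lintegral_finsetSum _ hm]
  refine lintegral_congr_ae ?_
  filter_upwards [ae_goodEnv (boxGraph r l) (boxRoot r l) ha] with p h
  have hj := h.jump_nonneg boxGraph_connected
  have hp : ∀ (u : ℕ → boxSet r l) n, 0 ≤ pathProd u n p := fun u n =>
    Finset.prod_nonneg fun _ _ => hj _ _
  rw [← ENNReal.ofReal_sum_of_nonneg fun j _ => mul_nonneg (hp _ _)
    (h.escape_nonneg boxGraph_connected _ j), Finset.mul_sum]
  simp_rw [pathProd_update, mul_assoc]

lemma IsERRW.measure_cyl_inter_hitSet_le (hP : IsERRW r a P) (ha : 0 < a) (hr : 1 ≤ r)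
    (hl : 1 ≤ l) (m : ℕ) {u : ℕ → boxSet r l} {n : ℕ} (h0 : u 0 = boxRoot r l)
    (hu : ∀ s < n, (boxGraph r l).Adj (u s) (u (s + 1))) (hi : ∀ s < n, linf (u s) < r * l) :
    P (cyl u n ∩ hitSet r l n m) ≤ ∫⁻ p, ENNReal.ofReal (pathProd u n p *
      escape (boxGraph r l) (boxRoot r l) (boxBdry r l) p (u n))
        ∂(env (boxGraph r l) (boxRoot r l) a) := by
  have := nontrivial_boxSet hr hl
  have hB := boxRoot_notMem_boxBdry hr hl
  induction m generalizing u n with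
  | zero =>
    by_cases hb : u n ∈ boxBdry r l
    · refine (measure_mono inter_subset_left).trans ?_
      rw [hP.measure_cyl ha h0 hu hi]
      refine (lintegral_congr_ae ?_).le
      filter_upwards [ae_goodEnv (boxGraph r l) (boxRoot r l) ha] with p h
      rw [h.escape_eq_one boxGraph_connected hB hb, mul_one]
    · have : cyl u n ∩ hitSet r l n 0 = ∅ := by
        refine eq_empty_of_forall_notMem ?_
        rintro X ⟨hX, t, h1, h2, h3, -⟩
        obtain rfl : t = n := by omega
        rw [hX t le_rfl] at h3
        exact hb (mem_boxBdry.2 h3.2)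
      simp [this]
  | succ m ih =>
    by_cases hb : u n ∈ boxBdry r l
    · refine (measure_mono inter_subset_left).trans ?_
      rw [hP.measure_cyl ha h0 hu hi]
      refine (lintegral_congr_ae ?_).le
      filter_upwards [ae_goodEnv (boxGraph r l) (boxRoot r l) ha] with p h
      rw [h.escape_eq_one boxGraph_connected hB hb, mul_one]
    by_cases ho : u n = boxRoot r l
    · have : cyl u n ∩ hitSet r l n (m + 1) = ∅ := by
        refine eq_empty_of_forall_notMem ?_
        rintro X ⟨hX, t, h1, h2, h3, h4⟩
        refine h4 n le_rfl h1 ?_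
        rw [hX n le_rfl, ho]
        rfl
      simp [this]
    have hlt : linf (u n) < r * l := lt_of_le_of_ne (u n).2.2 (mt mem_boxBdry.2 hb)
    refine (hP.measure_cyl_inter_le u hlt _).trans ?_
    calc _ ≤ ∑ j, ∫⁻ p, ENNReal.ofReal (pathProd (update u (n + 1) j) (n + 1) p *
          escape (boxGraph r l) (boxRoot r l) (boxBdry r l) p j)
            ∂(env (boxGraph r l) (boxRoot r l) a) := by
          refine Finset.sum_le_sum fun j _ => ?_
          split_ifs with hj
          swap
          · exact zero_le
          have h := ih (u := update u (n + 1) j) (n := n + 1) (by rwa [update_of_ne (by omega)])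
            (fun s hs => by
              rcases Nat.lt_succ_iff_lt_or_eq.1 hs with hs' | rfl
              · rw [update_of_ne (by omega), update_of_ne (by omega)]
                exact hu s hs'
              · rwa [update_self, update_of_ne (by omega)])
            (fun s hs => by
              rw [update_of_ne (by omega)]
              rcases Nat.lt_succ_iff_lt_or_eq.1 hs with hs' | rfl
              exacts [hi s hs', hlt])
          rw [update_self] at h
          refine (measure_mono ?_).trans h
          rintro X ⟨hX, t, h1, h2, h3, h4⟩
          refine ⟨hX, t, ?_, by omega, h3, fun s hs => h4 s (by omega)⟩
          refine lt_of_le_of_ne h1 ?_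
          rintro rfl
          have := hX n (by omega)
          rw [update_of_ne (by omega)] at this
          rw [this] at h3
          exact hlt.ne h3.2
      _ = _ := sum_lintegral_pathProd_update ha u n _
      _ ≤ _ := by
          refine lintegral_mono_ae ?_
          filter_upwards [ae_goodEnv (boxGraph r l) (boxRoot r l) ha] with p h
          refine ENNReal.ofReal_le_ofReal (mul_le_mul_of_nonneg_left ?_ ?_)
          · exact h.sum_jump_mul_escape_le boxGraph_connected hB ho
          · exact Finset.prod_nonneg fun _ _ => h.jump_nonneg boxGraph_connected _ _

lemma IsERRW.measure_hitSet_le (hP : IsERRW r a P) (ha : 0 < a) (hr : 1 ≤ r)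
    (hl : 1 ≤ l) (m : ℕ) : P (hitSet r l 1 m) ≤ ∑ v ∈ boxBdry r l, ∫⁻ p, ENNReal.ofReal (min 1
      (p.2 v * rootField (edgeW (boxGraph r l) p.1) (boxRoot r l) p.2 v ^ 2 /
        rootPot (edgeW (boxGraph r l) p.1) (boxRoot r l) p.2 (boxRoot r l)))
        ∂(env (boxGraph r l) (boxRoot r l) a) := by
  have := nontrivial_boxSet hr hl
  have := hP.1
  have hB := boxRoot_notMem_boxBdry hr hl
  set u : ℕ → boxSet r l := fun _ => boxRoot r l with hu
  have hlt : linf (u 0) < r * l :=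
    lt_of_le_of_ne (u 0).2.2 (mt mem_boxBdry.2 hB)
  have hcyl : P (cyl u 0)ᶜ = 0 := by
    have hset : (cyl u 0)ᶜ = ⋃ y ∈ {y : ℤ × ℤ | y ≠ (0, 0)}, {X | ∀ t ≤ 0, X t = y} := by
      ext X
      simp [cyl, hu, boxRoot]
    rw [hset]
    refine (measure_biUnion_null_iff (to_countable _)).2 fun y hy => ?_
    rw [hP.2 0 fun _ => y, if_neg fun h => hy h.1]
  have h1 : P (hitSet r l 1 m) ≤ P (cyl u 0 ∩ hitSet r l 1 m) := by
    rw [← add_zero (P (cyl u 0 ∩ hitSet r l 1 m)), ← hcyl]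
    refine (measure_mono fun X hX => ?_).trans (measure_union_le _ _)
    by_cases h : X ∈ cyl u 0
    exacts [Or.inl ⟨h, hX⟩, Or.inr h]
  refine h1.trans ((hP.measure_cyl_inter_le u hlt _).trans ?_)
  calc _ ≤ ∑ j, ∫⁻ p, ENNReal.ofReal (pathProd (update u (0 + 1) j) (0 + 1) p *
        escape (boxGraph r l) (boxRoot r l) (boxBdry r l) p j)
          ∂(env (boxGraph r l) (boxRoot r l) a) := by
        refine Finset.sum_le_sum fun j _ => ?_
        split_ifs with hj
        swap
        · exact zero_le
        have h := hP.measure_cyl_inter_hitSet_le ha hr hl m (u := update u (0 + 1) j) (n := 0 + 1)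
          (by rw [update_of_ne (by omega)])
          (fun s hs => by
            obtain rfl : s = 0 := by omega
            rwa [update_self, update_of_ne (by omega)])
          (fun s hs => by
            obtain rfl : s = 0 := by omega
            rwa [update_of_ne (by omega)])
        rwa [update_self] at h
    _ = _ := sum_lintegral_pathProd_update ha u 0 _
    _ ≤ ∫⁻ p, ∑ v ∈ boxBdry r l, ENNReal.ofReal (min 1
      (p.2 v * rootField (edgeW (boxGraph r l) p.1) (boxRoot r l) p.2 v ^ 2 /
        rootPot (edgeW (boxGraph r l) p.1) (boxRoot r l) p.2 (boxRoot r l)))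
        ∂(env (boxGraph r l) (boxRoot r l) a) := by
        refine lintegral_mono_ae ?_
        filter_upwards [ae_goodEnv (boxGraph r l) (boxRoot r l) ha] with p h
        have hp := h.rootPot_pos boxGraph_connected (boxRoot r l)
        rw [← ENNReal.ofReal_sum_of_nonneg]
        · refine ENNReal.ofReal_le_ofReal ?_
          rw [pathProd, Finset.range_zero, Finset.prod_empty, one_mul]
          exact h.sum_root_jump_mul_escape_le boxGraph_connected hB
        · intro v hv
          have := h.pot_pos boxGraph_connected (v := v) fun h => hB (h ▸ hv)
          positivity
    _ = _ := by
        refine lintegral_finsetSum _ fun v _ => ?_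
        refine (measurable_const.min
          (Measurable.div ?_ (measurable_env_rootPot _ _ _))).ennreal_ofReal
        exact ((measurable_pi_apply v).comp measurable_snd).mul
          ((measurable_env_rootField _ _ _).pow_const 2)

lemma tau_lt_tau_subset (r l : ℕ) : {X : ℕ → ℤ × ℤ |
    tau {v | v ∈ Vr r ∧ linf v = (r : ℤ) * (l : ℤ)} X < tau {(0, 0)} X} ⊆ ⋃ m, hitSet r l 1 m := by
  intro X hX
  obtain ⟨_, ⟨t, ht, rfl⟩, hlt⟩ := sInf_lt_iff.1 (mem_ofPred_eq ▸ hX)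
  refine mem_iUnion.2 ⟨t, t, ht.1, by omega, ht.2, fun s hs hst h0 => ?_⟩
  have h1 : tau {(0, 0)} X ≤ (s : ℕ∞) := sInf_le ⟨s, ⟨hs, h0⟩, rfl⟩
  exact absurd (hlt.trans_le h1) (not_lt.2 (Nat.cast_le.2 hst))

lemma measure_tau_lt_tau_le {C : ℝ≥0∞}
    (hC : ∀ m, P (hitSet r l 1 m) ≤ C) :
    P {X | tau {v | v ∈ Vr r ∧ linf v = (r : ℤ) * (l : ℤ)} X < tau {(0, 0)} X} ≤ C := by
  refine (measure_mono (tau_lt_tau_subset r l)).trans ?_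
  have hm : Monotone (hitSet r l 1) := fun m m' h X => by
    rintro ⟨t, h1, h2, h3⟩
    exact ⟨t, h1, by omega, h3⟩
  rw [hm.measure_iUnion]
  exact iSup_le hC

end ERRWZ2

namespace ERRWZ2

open Filter Topology

lemma lintegral_env_boxGraph_sqrt_le {r l : ℕ} {a : ℝ} (ha : 0 < a)
    (har : a < ((r : ℝ) - 129) / 256) (hr : 1 ≤ r) (hl : 1 ≤ l) {v : boxSet r l}
    (hv : v ∈ boxBdry r l) :
    ∫⁻ p, ENNReal.ofReal √(rootField (edgeW (boxGraph r l) p.1) (boxRoot r l) p.2 v)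
      ∂env (boxGraph r l) (boxRoot r l) a ≤ ENNReal.ofReal (8 * (1 / 2) ^ l) := by
  have hov : boxRoot r l ≠ v := fun h => boxRoot_notMem_boxBdry hr hl (h ▸ hv)
  refine (lintegral_env_sqrt_le _ _ ha hov).trans ?_
  have hq : 0 ≤ quarterRatio (a / 2) := quarterRatio_nonneg (by positivity)
  have h := sawSum_map (Function.Embedding.subtype (· ∈ boxSet r l)) (latStep r (stepMean a))
    (Fintype.card (boxSet r l) + 1) Finset.univ (boxRoot r l) v
  refine (h.symm.le.trans ?_ : sawSum (fun x y : boxSet r l => latStep r (stepMean a) x y) _ _ _ _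
    ≤ _)
  have hk : 4 * stepMean a ^ r ≤ 2⁻¹ := by
    have := ENNReal.ofReal_le_ofReal (four_mul_quarterRatio_pow_le ha har)
    rw [ENNReal.ofReal_mul (by norm_num), ENNReal.ofReal_pow hq, ← stepMean_eq ha, one_div,
      ENNReal.ofReal_inv_of_pos two_pos] at this
    simpa using this
  have hc : stepMean a ≤ 1 := by
    rw [stepMean_eq ha]
    exact ENNReal.ofReal_le_one.2 (quarterRatio_le_one (by positivity))
  refine (sawSum_latStep_le (v := (v : ℤ × ℤ)) hr hc hk (mem_boxBdry.1 hv) _ _).trans ?_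
  rw [ENNReal.ofReal_mul (by norm_num), ENNReal.ofReal_pow (by norm_num), one_div,
    ENNReal.ofReal_inv_of_pos two_pos]
  simp only [ENNReal.ofReal_ofNat]
  gcongr

/-- A union bound over the boundary of the box. -/
lemma IsERRW.measure_hitSet_le_ofReal {r l : ℕ} {a : ℝ} {P : Measure (ℕ → ℤ × ℤ)}
    (hP : IsERRW r a P) (ha : 0 < a) (har : a < ((r : ℝ) - 129) / 256) (hr : 1 ≤ r) (hl : 1 ≤ l)
    (m : ℕ) : P (hitSet r l 1 m) ≤ ENNReal.ofReal ((2 * (r * l) + 1) ^ 2 *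
      (3 * ((1 / 2) ^ l) ^ (a / 2) + 3 * (1 / 4) ^ (-((4 * a + 1) / 2)) * (1 / 2) ^ l +
        8 * √((1 / 2) ^ l))) := by
  have := nontrivial_boxSet hr hl
  have hG := boxGraph_connected (r := r) (l := l)
  have hcard : ((boxBdry r l).card : ℝ) ≤ (2 * (r * l) + 1) ^ 2 := by
    exact_mod_cast (Finset.card_le_univ _).trans (card_boxSet_le r l)
  refine (hP.measure_hitSet_le ha hr hl m).trans ((Finset.sum_le_sum fun v hv =>
    lintegral_env_min_le _ _ ha hG (fun h => boxRoot_notMem_boxBdry hr hl (by rwa [h] at hv))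
      (by positivity) (pow_le_one₀ (by norm_num) (by norm_num)) (le_wdeg_of_connected hG ha _)
      (wdeg_boxGraph_le ha v) (lintegral_env_boxGraph_sqrt_le ha har hr hl hv)).trans ?_)
  rw [Finset.sum_const, nsmul_eq_mul, ← ENNReal.ofReal_natCast,
    ← ENNReal.ofReal_mul (by positivity)]
  gcongr

lemma tendsto_mul_sq_mul_pow (c : ℝ) {ρ : ℝ} (h0 : 0 ≤ ρ) (h1 : ρ < 1) :
    Tendsto (fun l : ℕ => l * ((c * l + 1) ^ 2 * ρ ^ l)) atTop (𝓝 0) := by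
  have h k := tendsto_pow_const_mul_const_pow_of_abs_lt_one k ((abs_of_nonneg h0).trans_lt h1)
  have := (((h 3).const_mul (c ^ 2)).add ((h 2).const_mul (2 * c))).add (h 1)
  simp only [mul_zero, add_zero] at this
  refine this.congr fun l => ?_
  ring

lemma eventually_sq_mul_le (c K : ℝ) {b : ℝ} (hb : 0 < b) :
    ∀ᶠ l : ℕ in atTop, (c * l + 1) ^ 2 * (3 * ((1 / 2) ^ l) ^ b + K * (1 / 2) ^ l +
      8 * √((1 / 2) ^ l)) ≤ 8 * (l : ℝ) ^ (-1 : ℝ) := by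
  have h1 := tendsto_mul_sq_mul_pow c (ρ := (1 / 2) ^ b) (by positivity)
    (Real.rpow_lt_one (by norm_num) (by norm_num) hb)
  have h2 := tendsto_mul_sq_mul_pow c (ρ := 1 / 2) (by norm_num) (by norm_num)
  have h3 := tendsto_mul_sq_mul_pow c (ρ := √(1 / 2)) (by positivity)
    (by rw [Real.sqrt_lt' one_pos]; norm_num)
  have := ((h1.const_mul 3).add (h2.const_mul K)).add (h3.const_mul 8)
  simp only [mul_zero, add_zero] at this
  filter_upwards [this.eventually (gt_mem_nhds (by norm_num : (0 : ℝ) < 8)), eventually_ge_atTop 1]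
    with l hl hl1
  have hl0 : (0 : ℝ) < l := by exact_mod_cast hl1
  have e1 : ((1 / 2 : ℝ) ^ l) ^ b = ((1 / 2) ^ b) ^ l :=
    (Real.rpow_pow_comm (by norm_num) _ _).symm
  have e2 : √((1 / 2 : ℝ) ^ l) = √(1 / 2) ^ l := by
    rw [Real.sqrt_eq_rpow, Real.sqrt_eq_rpow, Real.rpow_pow_comm (by norm_num : (0 : ℝ) ≤ 1 / 2)]
  rw [Real.rpow_neg_one, ← div_eq_mul_inv, le_div_iff₀ hl0, e1, e2]
  refine le_of_eq_of_le ?_ hl.le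
  ring

end ERRWZ2

/-- Theorem 1.2(b): for `r ≥ 130` and `0 < a < (r-129)/256`, there are `l₀ ∈ ℕ` and
`ξ > 0` such that for every `l ≥ l₀`, the edge-reinforced random walk hits the set
`𝒱_l = {v ∈ V_r : |v|_∞ = r·l}` before returning to `0` with probability at most
`8·l^{-ξ}`. -/
theorem errw_hitting_box (r : ℕ) (hr : 130 ≤ r) (a : ℝ) (ha : 0 < a)
    (ha' : a < ((r : ℝ) - 129) / 256) :
    ∃ (l₀ : ℕ) (ξ : ℝ), 0 < ξ ∧
      ∀ l : ℕ, l₀ ≤ l →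
        ∀ P : Measure (ℕ → ℤ × ℤ), ERRWZ2.IsERRW r a P →
          P {X | ERRWZ2.tau {v | v ∈ ERRWZ2.Vr r ∧ ERRWZ2.linf v = (r : ℤ) * (l : ℤ)} X <
              ERRWZ2.tau {(0, 0)} X}
            ≤ ENNReal.ofReal (8 * (l : ℝ) ^ (-ξ)) := by
  obtain ⟨l₀, hl₀⟩ := Filter.eventually_atTop.1 (ERRWZ2.eventually_sq_mul_le (2 * r)
    (3 * (1 / 4) ^ (-((4 * a + 1) / 2))) (b := a / 2) (by positivity))
  refine ⟨max l₀ 1, 1, one_pos, fun l hl P hP => ERRWZ2.measure_tau_lt_tau_le fun m =>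
    (hP.measure_hitSet_le_ofReal ha ha' (by omega) ((le_max_right _ _).trans hl) m).trans
      (ENNReal.ofReal_le_ofReal ?_)⟩
  rw [← mul_assoc]
  exact hl₀ l ((le_max_left _ _).trans hl)
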